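/- Let u_ε be a sequence of topological solutions of (E_ε) (u_ε → 0 uniformly on compact subsets of Ω∖Z), fix p = p_{j₀,2} ∈ Z₂ with multiplicity ν := m_{j₀,2}, choose r₀ > 0 with B_{r₀}(p) ∩ Z = {p}, and set û_ε(y) := u_ε(εy) in local coordinates centered at p. Then, along a subsequence, sup_{B_{r₀/ε}(0)} |û_ε − u| → 0 as ε → 0, where u is a solution on ℝ² of Δu + f_τ(u) = −4πν δ₀ satisfying: u(y) + 2ν ln|y| extends smoothly across 0; sup_{ℝ²∖B₁(0)} |∇u| < ∞; f_τ(u) ∈ L¹(ℝ²); (1−e^u)²/(τ+e^u)² ∈ L¹(ℝ²); and u(x) → 0 as |x| → ∞ (u is topological). Moreover ∫_{ℝ²} (1−e^u)²/(τ+e^u)² dx = 4(τ+1)π ν². -/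

import Mathlib

open MeasureTheory Real Filter Set Metric Topology

noncomputable section

/-- The Euclidean plane `ℝ²`. -/
abbrev Pl := EuclideanSpace ℝ (Fin 2)

/-- The unit lattice `ℤ² ⊆ ℝ²`; the flat 2-torus `Ω` is its quotient, which we model by
working with doubly periodic functions on the plane. -/
def unitLattice : Set Pl :=
  {v | ∃ a b : ℤ, v = (a : ℝ) • EuclideanSpace.single 0 (1:ℝ) +
      (b : ℝ) • EuclideanSpace.single 1 (1:ℝ)}

/-- A fundamental domain for the torus `Ω` (of total area `|Ω| = 1`). -/
def fund : Set Pl := {x | x 0 ∈ Ico (0:ℝ) 1 ∧ x 1 ∈ Ico (0:ℝ) 1}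

/-- A doubly periodic function on the plane, i.e. a function on the torus `Ω`. -/
def Periodic2 (u : Pl → ℝ) : Prop := ∀ x : Pl, ∀ v ∈ unitLattice, u (x + v) = u x

/-- Partial derivative in the `i`-th coordinate direction. -/
def pd (u : Pl → ℝ) (i : Fin 2) : Pl → ℝ :=
  fun x => lineDeriv ℝ u x (EuclideanSpace.single i (1:ℝ))

/-- The Laplacian `Δu`. -/
def lap (u : Pl → ℝ) (x : Pl) : ℝ := pd (pd u 0) 0 x + pd (pd u 1) 1 x

/-- `|∇u|²`. -/
def gradSq (u : Pl → ℝ) (x : Pl) : ℝ := (pd u 0 x) ^ 2 + (pd u 1 x) ^ 2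

/-- The nonlinearity `f_τ(t) = e^t (1 − e^t) / (τ + e^t)³`. -/
def fτ (τ t : ℝ) : ℝ := exp t * (1 - exp t) / (τ + exp t) ^ 3

/-- `f_τ'(t) = e^t (τ − 2(τ+1) e^t + e^{2t}) / (τ + e^t)⁴`. -/
def fτ' (τ t : ℝ) : ℝ := exp t * (τ - 2 * (τ + 1) * exp t + exp (2 * t)) / (τ + exp t) ^ 4

/-- The antiderivative `F_{2,τ}(t) = e^t ((1−τ) e^t + 2τ) / (2τ² (τ+e^t)²)` of `f_τ`. -/
def F2τ (τ t : ℝ) : ℝ := exp t * ((1 - τ) * exp t + 2 * τ) / (2 * τ ^ 2 * (τ + exp t) ^ 2)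

/-- `u − 2a ln‖· − p‖` extends smoothly across `p`: this encodes the distributional
equation `Δu = 4πa δ_p + (smooth)` near `p`. -/
def LogSing (u : Pl → ℝ) (p : Pl) (a : ℝ) : Prop :=
  ∃ r > 0, ∃ v : Pl → ℝ, ContDiffOn ℝ (⊤ : ℕ∞) v (ball p r) ∧
    ∀ x ∈ ball p r, x ≠ p → u x = 2 * a * Real.log ‖x - p‖ + v x

/-- The vortex data: distinct points `p_{j,1}` (`1 ≤ j ≤ d₁`), `p_{j,2}` (`1 ≤ j ≤ d₂`)
of the torus with multiplicities `m_{j,1} ≥ 0`, `m_{j,2} ≥ 0`. -/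
structure VortexData where
  d₁ : ℕ
  d₂ : ℕ
  p₁ : Fin d₁ → Pl
  p₂ : Fin d₂ → Pl
  m₁ : Fin d₁ → ℝ
  m₂ : Fin d₂ → ℝ
  m₁_nonneg : ∀ j, 0 ≤ m₁ j
  m₂_nonneg : ∀ j, 0 ≤ m₂ j
  distinct : ∀ i j : Fin d₁ ⊕ Fin d₂, i ≠ j → ∀ v ∈ unitLattice,
      Sum.elim p₁ p₂ i ≠ Sum.elim p₁ p₂ j + v

namespace VortexData
variable (V : VortexData)

/-- The set `Z₁` of vortex points `p_{j,1}` (viewed in the plane: all lattice translates). -/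
def Z1 : Set Pl := {x | ∃ j v, v ∈ unitLattice ∧ x = V.p₁ j + v}

/-- The set `Z₂` of vortex points `p_{j,2}` (viewed in the plane: all lattice translates). -/
def Z2 : Set Pl := {x | ∃ j v, v ∈ unitLattice ∧ x = V.p₂ j + v}

/-- The full vortex set `Z = Z₁ ∪ Z₂`. -/
def Z : Set Pl := V.Z1 ∪ V.Z2

/-- `N₁ = Σ_j m_{j,1}`. -/
def N1 : ℝ := ∑ j, V.m₁ j

/-- `N₂ = Σ_j m_{j,2}`. -/
def N2 : ℝ := ∑ j, V.m₂ j

end VortexData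

/-- `u` is a solution of `(E_ε)`:
`Δu + ε⁻² f_τ(u) = 4π Σ_j m_{j,1} δ_{p_{j,1}} − 4π Σ_j m_{j,2} δ_{p_{j,2}}` on `Ω`,
formulated classically: `u` is doubly periodic, smooth away from `Z`, solves the PDE
classically off `Z`, and has the prescribed logarithmic singularities at the vortices. -/
structure IsSolution (V : VortexData) (τ ε : ℝ) (u : Pl → ℝ) : Prop where
  periodic : Periodic2 u
  smooth : ContDiffOn ℝ (⊤ : ℕ∞) u (V.Z)ᶜ
  pde : ∀ x ∉ V.Z, lap u x + (ε ^ 2)⁻¹ * fτ τ (u x) = 0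
  sing₁ : ∀ j, LogSing u (V.p₁ j) (V.m₁ j)
  sing₂ : ∀ j, LogSing u (V.p₂ j) (-(V.m₂ j))

/-- The quadratic form `∫_Ω |∇φ|² − ε⁻² f_τ'(u) φ²` of the linearized operator at `u`. -/
def QuadForm (τ ε : ℝ) (u φ : Pl → ℝ) : ℝ :=
  ∫ x in fund, (gradSq φ x - (ε ^ 2)⁻¹ * fτ' τ (u x) * (φ x) ^ 2)

/-- `u` is a stable solution: the first eigenvalue `μ_ε` of the linearized operator is
nonnegative, i.e. the quadratic form is nonnegative on all (smooth, doubly periodic)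
test functions. -/
def Stable (τ ε : ℝ) (u : Pl → ℝ) : Prop :=
  ∀ φ : Pl → ℝ, ContDiff ℝ (⊤ : ℕ∞) φ → Periodic2 φ → 0 ≤ QuadForm τ ε u φ

/-- `u` is strictly stable: the first eigenvalue `μ_ε` of the linearized operator is
strictly positive. -/
def StrictlyStable (τ ε : ℝ) (u : Pl → ℝ) : Prop :=
  ∃ μ > 0, ∀ φ : Pl → ℝ, ContDiff ℝ (⊤ : ℕ∞) φ → Periodic2 φ →
    μ * (∫ x in fund, (φ x) ^ 2) ≤ QuadForm τ ε u φ

/-- basis vector -/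
abbrev ee (i : Fin 2) : Pl := EuclideanSpace.single i (1:ℝ)

/-- smooth at a point -/
abbrev Sm (u : Pl → ℝ) (x : Pl) : Prop := ContDiffAt ℝ (⊤ : ℕ∞) u x

lemma Sm.diff {u : Pl → ℝ} {x : Pl} (h : Sm u x) : DifferentiableAt ℝ u x :=
  ContDiffAt.differentiableAt h (by simp)

lemma Sm.diff_ev {u : Pl → ℝ} {x : Pl} (h : Sm u x) : ∀ᶠ y in 𝓝 x, DifferentiableAt ℝ u y := by
  have h1 : ContDiffAt ℝ 1 u x := h.of_le (by exact_mod_cast le_top)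
  filter_upwards [h1.eventually (by simp)] with y hy
  exact hy.differentiableAt (by simp)

lemma pd_eq {u : Pl → ℝ} {x : Pl} (h : DifferentiableAt ℝ u x) (i : Fin 2) :
    pd u i x = fderiv ℝ u x (ee i) := h.lineDeriv_eq_fderiv

lemma pd_congr {u v : Pl → ℝ} {x : Pl} (h : u =ᶠ[𝓝 x] v) (i : Fin 2) : pd u i x = pd v i x :=
  h.lineDeriv_eq

lemma pd_congr_ev {u v : Pl → ℝ} {x : Pl} (h : u =ᶠ[𝓝 x] v) (i : Fin 2) :
    pd u i =ᶠ[𝓝 x] pd v i := by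
  filter_upwards [h.eventually_nhds] with y hy using pd_congr hy i

lemma lap_congr {u v : Pl → ℝ} {x : Pl} (h : u =ᶠ[𝓝 x] v) : lap u x = lap v x := by
  unfold lap
  rw [pd_congr (pd_congr_ev h 0), pd_congr (pd_congr_ev h 1)]

lemma Sm.pd_ev {u : Pl → ℝ} {x : Pl} (h : Sm u x) (i : Fin 2) :
    pd u i =ᶠ[𝓝 x] fun y => fderiv ℝ u y (ee i) := by
  filter_upwards [h.diff_ev] with y hy using pd_eq hy i

lemma Sm.pd {u : Pl → ℝ} {x : Pl} (h : Sm u x) (i : Fin 2) : Sm (pd u i) x := by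
  have : ContDiffAt ℝ (⊤ : ℕ∞) (fun y => fderiv ℝ u y (ee i)) x :=
    (ContDiffAt.fderiv_right h (by simp)).clm_apply contDiffAt_const
  exact this.congr_of_eventuallyEq (h.pd_ev i)

lemma Sm.lap {u : Pl → ℝ} {x : Pl} (h : Sm u x) : Sm (lap u) x :=
  ContDiffAt.add ((h.pd 0).pd 0) ((h.pd 1).pd 1)

lemma pd_of_hasFDerivAt {u : Pl → ℝ} {x : Pl} {L : Pl →L[ℝ] ℝ} (h : HasFDerivAt u L x)
    (i : Fin 2) : pd u i x = L (ee i) := by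
  rw [pd_eq h.differentiableAt, h.fderiv]

lemma pd_add {u v : Pl → ℝ} {x : Pl} (hu : DifferentiableAt ℝ u x) (hv : DifferentiableAt ℝ v x)
    (i : Fin 2) : pd (fun y => u y + v y) i x = pd u i x + pd v i x := by
  rw [pd_of_hasFDerivAt (u := fun y => u y + v y) (hu.hasFDerivAt.add hv.hasFDerivAt), pd_eq hu, pd_eq hv]; rfl

lemma pd_sub {u v : Pl → ℝ} {x : Pl} (hu : DifferentiableAt ℝ u x) (hv : DifferentiableAt ℝ v x)
    (i : Fin 2) : pd (fun y => u y - v y) i x = pd u i x - pd v i x := by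
  rw [pd_of_hasFDerivAt (u := fun y => u y - v y) (hu.hasFDerivAt.sub hv.hasFDerivAt), pd_eq hu, pd_eq hv]; rfl

lemma pd_mul {u v : Pl → ℝ} {x : Pl} (hu : DifferentiableAt ℝ u x) (hv : DifferentiableAt ℝ v x)
    (i : Fin 2) : pd (fun y => u y * v y) i x = pd u i x * v x + u x * pd v i x := by
  rw [pd_of_hasFDerivAt (u := fun y => u y * v y) (hu.hasFDerivAt.mul hv.hasFDerivAt), pd_eq hu, pd_eq hv]
  simp; ring

lemma pd_const (c : ℝ) (x : Pl) (i : Fin 2) : pd (fun _ => c) i x = 0 := by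
  rw [pd_of_hasFDerivAt (hasFDerivAt_const c x)]; rfl

lemma pd_const_mul {u : Pl → ℝ} {x : Pl} (c : ℝ) (hu : DifferentiableAt ℝ u x)
    (i : Fin 2) : pd (fun y => c * u y) i x = c * pd u i x := by
  rw [pd_mul (differentiableAt_const c) hu, pd_const]; ring

lemma pd_comp {u : Pl → ℝ} {x : Pl} {g : ℝ → ℝ} {g' : ℝ} (hg : HasDerivAt g g' (u x))
    (hu : DifferentiableAt ℝ u x) (i : Fin 2) :
    pd (fun y => g (u y)) i x = g' * pd u i x := by
  rw [pd_of_hasFDerivAt (u := fun y => g (u y)) (hg.comp_hasFDerivAt x hu.hasFDerivAt), pd_eq hu]; simp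

/-- coordinate functional -/
abbrev cf (j : Fin 2) : Pl →L[ℝ] ℝ := EuclideanSpace.proj j

lemma sm_coord (j : Fin 2) (x : Pl) : Sm (fun y : Pl => y j) x :=
  (cf j).contDiff.contDiffAt

lemma pd_coord (j i : Fin 2) (x : Pl) : pd (fun y : Pl => y j) i x = if j = i then 1 else 0 := by
  rw [pd_of_hasFDerivAt (u := fun y : Pl => y j) (cf j).hasFDerivAt]
  simp

lemma lap_add {u v : Pl → ℝ} {x : Pl} (hu : Sm u x) (hv : Sm v x) :
    lap (fun y => u y + v y) x = lap u x + lap v x := by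
  have h (i : Fin 2) : pd (fun y => u y + v y) i =ᶠ[𝓝 x] fun y => pd u i y + pd v i y := by
    filter_upwards [hu.diff_ev, hv.diff_ev] with y h1 h2 using pd_add h1 h2 i
  unfold lap
  rw [pd_congr (h 0), pd_congr (h 1), pd_add (hu.pd 0).diff (hv.pd 0).diff,
    pd_add (hu.pd 1).diff (hv.pd 1).diff]; ring

lemma lap_const_mul {u : Pl → ℝ} {x : Pl} (c : ℝ) (hu : Sm u x) :
    lap (fun y => c * u y) x = c * lap u x := by
  have h (i : Fin 2) : pd (fun y => c * u y) i =ᶠ[𝓝 x] fun y => c * pd u i y := by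
    filter_upwards [hu.diff_ev] with y h1 using pd_const_mul c h1 i
  unfold lap
  rw [pd_congr (h 0), pd_congr (h 1), pd_const_mul _ (hu.pd 0).diff,
    pd_const_mul _ (hu.pd 1).diff]; ring

lemma lap_neg {u : Pl → ℝ} {x : Pl} (hu : Sm u x) :
    lap (fun y => - u y) x = - lap u x := by
  have := lap_const_mul (-1) hu
  simpa using this

lemma Sm.neg' {u : Pl → ℝ} {x : Pl} (hu : Sm u x) : Sm (fun y => - u y) x := ContDiffAt.neg hu
lemma Sm.add' {u v : Pl → ℝ} {x : Pl} (hu : Sm u x) (hv : Sm v x) :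
    Sm (fun y => u y + v y) x := ContDiffAt.add hu hv
lemma Sm.sub' {u v : Pl → ℝ} {x : Pl} (hu : Sm u x) (hv : Sm v x) :
    Sm (fun y => u y - v y) x := ContDiffAt.sub hu hv
lemma Sm.mul' {u v : Pl → ℝ} {x : Pl} (hu : Sm u x) (hv : Sm v x) :
    Sm (fun y => u y * v y) x := ContDiffAt.mul hu hv
lemma sm_const (c : ℝ) (x : Pl) : Sm (fun _ => c) x := contDiffAt_const

lemma lap_sub {u v : Pl → ℝ} {x : Pl} (hu : Sm u x) (hv : Sm v x) :
    lap (fun y => u y - v y) x = lap u x - lap v x := by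
  have := lap_add hu hv.neg'
  rw [lap_neg hv] at this
  simpa [sub_eq_add_neg] using this

lemma lap_const (c : ℝ) (x : Pl) : lap (fun _ => c) x = 0 := by
  have h := lap_const_mul 0 (sm_const c x)
  have h2 := lap_const_mul 0 (sm_const (1:ℝ) x)
  unfold lap
  have (i : Fin 2) : pd (fun _ => c) i = fun _ => 0 := funext fun y => pd_const c y i
  simp [this, pd_const]

lemma pd_comm {u : Pl → ℝ} {x : Pl} (hu : Sm u x) (i j : Fin 2) :
    pd (pd u i) j x = pd (pd u j) i x := by
  have key (i j : Fin 2) : pd (pd u i) j x = fderiv ℝ (fderiv ℝ u) x (ee j) (ee i) := by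
    rw [pd_congr (hu.pd_ev i)]
    have hd : DifferentiableAt ℝ (fderiv ℝ u) x :=
      (ContDiffAt.fderiv_right (m := (⊤:ℕ∞)) hu (by simp)).differentiableAt (by simp)
    rw [pd_of_hasFDerivAt (hd.hasFDerivAt.clm_apply (hasFDerivAt_const (ee i) x))]
    simp
  rw [key, key]
  exact (ContDiffAt.isSymmSndFDerivAt hu (by simp; exact WithTop.coe_le_coe.mpr le_top)).eq _ _

lemma lap_pd {u : Pl → ℝ} {x : Pl} (hu : Sm u x) (i : Fin 2)
    (hev : ∀ᶠ y in 𝓝 x, Sm u y) : lap (pd u i) x = pd (lap u) i x := by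
  unfold lap
  have e0 (j : Fin 2) : pd (pd u i) j =ᶠ[𝓝 x] pd (pd u j) i := by
    filter_upwards [hev] with y hy using pd_comm hy i j
  rw [pd_congr (e0 0), pd_congr (e0 1), pd_comm (hu.pd 0), pd_comm (hu.pd 1)]
  exact (pd_add ((hu.pd 0).pd 0).diff ((hu.pd 1).pd 1).diff i).symm

/-- second derivative test along a direction -/
lemma pd_pd_nonpos {h : Pl → ℝ} {x : Pl} (hs : Sm h x) (hm : IsLocalMax h x) (i : Fin 2) :
    pd (pd h i) i x ≤ 0 := by
  by_contra hpos
  push Not at hpos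
  set φ : ℝ → ℝ := fun t => h (x + t • ee i) with hφ
  have hlin : Continuous (fun t : ℝ => x + t • ee i) := by fun_prop
  have hd1 : ∀ t, deriv φ t = pd h i (x + t • ee i) := by
    intro t
    simp only [pd, lineDeriv, hφ]
    have : (fun s : ℝ => h (x + t • ee i + s • ee i)) = fun s => φ (t + s) := by
      funext s; simp only [hφ]; congr 1; rw [add_smul, add_assoc]
    have h2 : (fun s : ℝ => φ (t + s)) = fun s => φ (s + t) := by funext s; rw [add_comm]
    change deriv φ t = deriv (fun s : ℝ => h (x + t • ee i + s • ee i)) 0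
    rw [this, h2, deriv_comp_add_const]; simp
  have hd2 : deriv (deriv φ) 0 = pd (pd h i) i x := by
    rw [funext hd1]; rfl
  have hmax : IsLocalMax φ 0 := by
    have ht : Tendsto (fun t : ℝ => x + t • ee i) (𝓝 0) (𝓝 x) := by
      have := hlin.tendsto 0; simpa using this
    have := ht.eventually hm
    filter_upwards [this] with t ht
    simpa [hφ] using ht
  have hcont : ContinuousAt φ 0 := by
    have : ContinuousAt h (x + (0:ℝ) • ee i) := by simpa using hs.continuousAt
    exact ContinuousAt.comp (f := fun t : ℝ => x + t • ee i) this hlin.continuousAt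
  have hmin := isLocalMin_of_deriv_deriv_pos (f := φ) (x₀ := 0) (by rw [hd2]; exact hpos)
    hmax.deriv_eq_zero hcont
  have hconst : φ =ᶠ[𝓝 0] fun _ => φ 0 := by
    filter_upwards [hmax, hmin] with t h1 h2 using le_antisymm h1 h2
  have : deriv (deriv φ) 0 = 0 := by
    have h1 : deriv φ =ᶠ[𝓝 0] deriv (fun _ => φ 0) := hconst.deriv
    rw [h1.deriv_eq]; simp
  rw [hd2] at this
  linarith

lemma lap_nonpos_of_localMax {h : Pl → ℝ} {x : Pl} (hs : Sm h x) (hm : IsLocalMax h x) :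
    lap h x ≤ 0 := by
  have := pd_pd_nonpos hs hm 0
  have := pd_pd_nonpos hs hm 1
  unfold lap; linarith

lemma norm_sq_eq (x : Pl) : ‖x‖ ^ 2 = x 0 ^ 2 + x 1 ^ 2 := by
  rw [EuclideanSpace.norm_sq_eq]; simp

lemma sm_normsq (c x : Pl) : Sm (fun y : Pl => ‖y - c‖ ^ 2) x :=
  ((contDiff_id.sub contDiff_const).norm_sq ℝ).contDiffAt

lemma pd_normsq (c x : Pl) (i : Fin 2) :
    pd (fun y : Pl => ‖y - c‖ ^ 2) i x = 2 * (x i - c i) := by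
  have : (fun y : Pl => ‖y - c‖ ^ 2) = fun y : Pl =>
      ((y 0 - c 0) * (y 0 - c 0) + (y 1 - c 1) * (y 1 - c 1)) := by
    funext y; rw [norm_sq_eq]; simp; ring
  have hd (j : Fin 2) : DifferentiableAt ℝ (fun y : Pl => y j - c j) x :=
    ((sm_coord j x).sub' (sm_const _ x)).diff
  have hm (j : Fin 2) : DifferentiableAt ℝ (fun y : Pl => (y j - c j) * (y j - c j)) x :=
    (hd j).mul (hd j)
  rw [this, pd_add (hm 0) (hm 1), pd_mul (hd 0) (hd 0),
    pd_mul (hd 1) (hd 1)]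
  have hp (j : Fin 2) : pd (fun y : Pl => y j - c j) i x = if j = i then 1 else 0 := by
    rw [pd_sub (sm_coord j x).diff (sm_const _ x).diff, pd_const, pd_coord]; simp
  rw [hp, hp]
  fin_cases i <;> simp <;> ring

lemma lap_normsq (c x : Pl) : lap (fun y : Pl => ‖y - c‖ ^ 2) x = 4 := by
  have h (i : Fin 2) : pd (fun y : Pl => ‖y - c‖ ^ 2) i = fun y => 2 * (y i - c i) :=
    funext fun y => pd_normsq c y i
  have h2 (i : Fin 2) : pd (fun y : Pl => 2 * (y i - c i)) i x = 2 := by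
    rw [pd_const_mul _ ((sm_coord i x).sub' (sm_const _ x)).diff,
      pd_sub (sm_coord i x).diff (sm_const _ x).diff, pd_const, pd_coord]; simp
  unfold lap
  rw [h, h, h2, h2]; norm_num

lemma sm_log {x : Pl} (hx : x ≠ 0) : Sm (fun y : Pl => Real.log ‖y‖) x :=
  ((contDiffAt_norm ℝ hx).log (norm_ne_zero_iff.mpr hx))

lemma log_norm_eq (y : Pl) : Real.log ‖y‖ = (1/2) * Real.log (‖y - 0‖ ^ 2) := by
  rw [Real.log_pow]; simp

lemma pd_log {x : Pl} (hx : x ≠ 0) (i : Fin 2) :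
    pd (fun y : Pl => Real.log ‖y‖) i x = x i / ‖x‖ ^ 2 := by
  have hx' : ‖x - 0‖ ^ 2 ≠ 0 := by simpa using hx
  have h1 := pd_comp (u := fun y : Pl => ‖y - 0‖ ^ 2) (x := x)
    ((Real.hasDerivAt_log hx').const_mul (1/2)) (sm_normsq 0 x).diff i
  rw [funext log_norm_eq, h1, pd_normsq]
  simp; field_simp

lemma lap_log {x : Pl} (hx : x ≠ 0) : lap (fun y : Pl => Real.log ‖y‖) x = 0 := by
  have hn : ‖x - 0‖ ^ 2 ≠ 0 := by simpa using hx
  have h (i : Fin 2) : pd (fun y : Pl => Real.log ‖y‖) i =ᶠ[𝓝 x]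
      fun y => y i * (‖y - 0‖ ^ 2)⁻¹ := by
    filter_upwards [isOpen_ne.mem_nhds hx] with y hy
    rw [pd_log hy]; simp; rfl
  have h2 (i : Fin 2) : pd (fun y : Pl => y i * (‖y - 0‖ ^ 2)⁻¹) i x =
      (‖x‖ ^ 2)⁻¹ - 2 * x i ^ 2 / (‖x‖ ^ 2) ^ 2 := by
    have hi : DifferentiableAt ℝ (fun y : Pl => (‖y - 0‖ ^ 2)⁻¹) x :=
      (sm_normsq 0 x).diff.inv hn
    rw [pd_mul (sm_coord i x).diff hi, pd_coord,
      pd_comp (u := fun y : Pl => ‖y - 0‖ ^ 2) (hasDerivAt_inv hn) (sm_normsq 0 x).diff, pd_normsq]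
    simp; ring
  unfold lap
  rw [pd_congr (h 0), pd_congr (h 1), h2, h2]
  have := norm_sq_eq x
  have hx' : ‖x‖ ^ 2 ≠ 0 := by simpa using hx
  rw [this] at hx' ⊢
  field_simp; ring

lemma maxPrinciple {K U : Set Pl} (hK : IsCompact K) (hU : IsOpen U) (hUK : U ⊆ K) {h : Pl → ℝ}
    (hc : ContinuousOn h K) (hb : ∀ x ∈ K, x ∉ U → h x ≤ 0) (hs : ∀ x ∈ U, 0 < h x → Sm h x)
    (hl : ∀ x ∈ U, 0 < h x → 0 < lap h x) : ∀ x ∈ K, h x ≤ 0 := by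
  intro x hx
  obtain ⟨y, hy, hmax⟩ := hK.exists_isMaxOn ⟨x, hx⟩ hc
  refine le_trans (hmax hx) ?_
  by_contra hpos
  push Not at hpos
  have hyU : y ∈ U := by
    by_contra hn
    exact absurd (hb y hy hn) (not_le.mpr hpos)
  have hloc : IsLocalMax h y := hmax.isLocalMax (mem_of_superset (hU.mem_nhds hyU) hUK)
  have := lap_nonpos_of_localMax (hs y hyU hpos) hloc
  linarith [hl y hyU hpos]

lemma pd_affine {A : Pl → Pl} {s : Fin 2 → ℝ}
    (hA : ∀ z (t : ℝ) k, A (z + t • ee k) = A z + (t * s k) • ee k) (u : Pl → ℝ) (k : Fin 2) (c : ℝ) :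
    pd (fun z => c * u (A z)) k = fun z => (c * s k) * pd u k (A z) := by
  funext z
  change deriv (fun t : ℝ => c * u (A (z + t • ee k))) 0 = _
  simp only [hA]
  rw [deriv_const_mul_field]
  have := deriv_comp_mul_left (s k) (fun t : ℝ => u (A z + t • ee k)) 0
  simp only [mul_comm _ (s k)]
  rw [this]
  simp [pd, lineDeriv]; ring

lemma lap_affine {A : Pl → Pl} {s : Fin 2 → ℝ} {q : ℝ} (hq : ∀ k, s k ^ 2 = q)
    (hA : ∀ z (t : ℝ) k, A (z + t • ee k) = A z + (t * s k) • ee k) (u : Pl → ℝ) (z : Pl) :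
    lap (fun z => u (A z)) z = q * lap u (A z) := by
  have h1 (k : Fin 2) : pd (fun z => u (A z)) k = fun z => s k * pd u k (A z) := by
    simpa using pd_affine hA u k 1
  unfold lap
  rw [h1, h1, pd_affine hA (pd u 0) 0 (s 0), pd_affine hA (pd u 1) 1 (s 1)]
  simp only
  have h0 := hq 0
  have h1 := hq 1
  linear_combination (pd (pd u 0) 0 (A z)) * h0 + (pd (pd u 1) 1 (A z)) * h1

lemma ee_apply (i j : Fin 2) : (ee i) j = if j = i then 1 else 0 := by
  simp [ee]

lemma pd_le_aux {u : Pl → ℝ} {x : Pl} {d M N : ℝ} (hd : 0 < d) (i j : Fin 2) (hij : i ≠ j)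
    (hs : ∀ z, ‖z - x‖ ≤ 2 * d → Sm u z) (hM : ∀ z, ‖z - x‖ ≤ 2 * d → |u z| ≤ M)
    (hN : ∀ z, ‖z - x‖ ≤ 2 * d → |lap u z| < N) :
    pd u i x ≤ 2 * M / d + N * d / 2 := by
  have hM0 : 0 ≤ M := (abs_nonneg _).trans (hM x (by simp; positivity))
  have hN0 : 0 < N := (abs_nonneg _).trans_lt (hN x (by simp; positivity))
  have hns (z : Pl) : ‖z - x‖ ^ 2 = (z i - x i) ^ 2 + (z j - x j) ^ 2 := by
    rw [norm_sq_eq]; fin_cases i <;> fin_cases j <;> simp at hij ⊢; ring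
  set A : Pl → Pl := fun z => z + (-(2 * (z i - x i))) • ee i with hAdef
  have hAi (z : Pl) : (A z) i = 2 * x i - z i := by simp [hAdef]; ring
  have hAj (z : Pl) : (A z) j = z j := by simp [hAdef, hij.symm]
  have hA : ∀ z (t : ℝ) k, A (z + t • ee k) = A z + (t * (if k = i then -1 else 1)) • ee k := by
    intro z t k
    by_cases hk : k = i
    · subst hk
      simp only [hAdef]; ext l; simp; split_ifs <;> ring
    · simp only [hAdef]; ext l; simp [hk, Ne.symm hk]; ring
  have hAn (z : Pl) : ‖A z - x‖ = ‖z - x‖ := by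
    have : ‖A z - x‖ ^ 2 = ‖z - x‖ ^ 2 := by rw [hns, hns, hAi, hAj]; ring
    exact (pow_left_inj₀ (norm_nonneg _) (norm_nonneg _) (by norm_num)).mp this
  have hAs : ContDiff ℝ (⊤ : ℕ∞) A := by
    have hcf : ContDiff ℝ (⊤ : ℕ∞) (fun z : Pl => z i) := (cf i).contDiff
    exact contDiff_id.add ((contDiff_const.mul (hcf.sub contDiff_const)).neg.smul contDiff_const)
  have huA (z : Pl) (hz : ‖z - x‖ ≤ 2 * d) : Sm (fun z => u (A z)) z :=
    ContDiffAt.comp (g := u) (f := A) z (hs _ (by rw [hAn]; exact hz)) hAs.contDiffAt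
  have hlapA (z : Pl) : lap (fun z => u (A z)) z = lap u (A z) := by
    rw [lap_affine (q := 1) ?_ hA]
    · simp
    · intro k; by_cases hk : k = i <;> simp [hk]
  set c1 := M / d ^ 2 with hc1
  set c2 := - (M / d ^ 2) - N / 2 with hc2
  set c3 := 2 * M / d + N * d / 2 with hc3
  set a : Pl → ℝ := fun z => z j - x j with ha
  set t : Pl → ℝ := fun z => z i - x i with ht
  set ψ : Pl → ℝ := fun z => c1 * (a z * a z) + (c2 * (t z * t z) + c3 * t z) with hψ
  have sma (z) : Sm a z := (sm_coord j z).sub' (sm_const _ z)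
  have smt (z) : Sm t z := (sm_coord i z).sub' (sm_const _ z)
  have lapc (l : Fin 2) (c : ℝ) (z : Pl) : lap (fun z : Pl => z l - c) z = 0 := by
    have h (m : Fin 2) : pd (fun z : Pl => z l - c) m = fun _ => if l = m then 1 else 0 := by
      funext y
      rw [pd_sub (sm_coord l y).diff (sm_const _ y).diff, pd_const, pd_coord]; simp
    unfold lap; rw [h, h, pd_const, pd_const]; simp
  have lapsq (l : Fin 2) (c : ℝ) (z : Pl) : lap (fun z : Pl => (z l - c) * (z l - c)) z = 2 := by
    have hsm (y) : Sm (fun z : Pl => z l - c) y := (sm_coord l y).sub' (sm_const _ y)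
    have h0 (m : Fin 2) (y : Pl) : pd (fun z : Pl => z l - c) m y = if l = m then 1 else 0 := by
      rw [pd_sub (sm_coord l y).diff (sm_const _ y).diff, pd_const, pd_coord]; simp
    have h (m : Fin 2) : pd (fun z : Pl => (z l - c) * (z l - c)) m =
        fun y => (2 * if l = m then 1 else 0) * (y l - c) := by
      funext y
      rw [pd_mul (hsm y).diff (hsm y).diff, h0]; ring
    unfold lap; rw [h, h, pd_const_mul _ (hsm z).diff, pd_const_mul _ (hsm z).diff, h0, h0]
    fin_cases l <;> simp
  have smψ (z) : Sm ψ z := ((sm_const c1 z).mul' ((sma z).mul' (sma z))).add'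
    (((sm_const c2 z).mul' ((smt z).mul' (smt z))).add' ((sm_const c3 z).mul' (smt z)))
  have lapψ (z) : lap ψ z = - N := by
    rw [hψ, lap_add ((sm_const c1 z).mul' ((sma z).mul' (sma z)))
      (((sm_const c2 z).mul' ((smt z).mul' (smt z))).add' ((sm_const c3 z).mul' (smt z))),
      lap_add ((sm_const c2 z).mul' ((smt z).mul' (smt z))) ((sm_const c3 z).mul' (smt z)),
      lap_const_mul _ ((sma z).mul' (sma z)), lap_const_mul _ ((smt z).mul' (smt z)),
      lap_const_mul _ (smt z), lapsq, lapsq, lapc]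
    simp only [hc1, hc2]; ring
  set h : Pl → ℝ := fun z => (1/2) * (u z - u (A z)) - ψ z with hh
  set K : Set Pl := {z | |a z| ≤ d ∧ 0 ≤ t z ∧ t z ≤ d} with hK
  set U : Set Pl := {z | |a z| < d ∧ 0 < t z ∧ t z < d} with hU
  have hac : Continuous a := continuous_iff_continuousAt.mpr fun z => (sma z).continuousAt
  have htc : Continuous t := continuous_iff_continuousAt.mpr fun z => (smt z).continuousAt
  have hKb (z : Pl) (hz : z ∈ K) : ‖z - x‖ ≤ 2 * d := by
    obtain ⟨h1, h2, h3⟩ := hz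
    have h4 : ‖z - x‖ ^ 2 ≤ (2 * d) ^ 2 := by
      rw [hns]
      have e1 : (z i - x i) ^ 2 ≤ d ^ 2 := by
        apply sq_le_sq' <;> simp only [ht] at h2 h3 <;> linarith
      have e2 : (z j - x j) ^ 2 ≤ d ^ 2 := by
        rw [← sq_abs]; exact pow_le_pow_left₀ (abs_nonneg _) h1 2
      nlinarith
    exact le_of_sq_le_sq h4 (by positivity)
  have hKc : IsCompact K := by
    refine Metric.isCompact_of_isClosed_isBounded ?_ ?_
    · exact (isClosed_le hac.abs continuous_const).inter
        ((isClosed_le continuous_const htc).inter (isClosed_le htc continuous_const))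
    · refine (Metric.isBounded_closedBall (x := x) (r := 2 * d)).subset fun z hz => ?_
      rw [mem_closedBall, dist_eq_norm]; exact hKb z hz
  have hUo : IsOpen U := (isOpen_lt hac.abs continuous_const).inter
        ((isOpen_lt continuous_const htc).inter (isOpen_lt htc continuous_const))
  have hUK : U ⊆ K := fun z hz => ⟨hz.1.le, hz.2.1.le, hz.2.2.le⟩
  have smh (z) (hz : z ∈ K) : Sm h z :=
    ((sm_const (1/2) z).mul' ((hs z (hKb z hz)).sub' (huA z (hKb z hz)))).sub' (smψ z)
  have main : ∀ z ∈ K, h z ≤ 0 := by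
    refine maxPrinciple hKc hUo hUK (fun z hz => (smh z hz).continuousAt.continuousWithinAt) ?_
      (fun z hz _ => smh z (hUK hz)) ?_
    · intro z hz hzU
      have hψe : ψ z = M / d ^ 2 * ((a z) ^ 2 + t z * (2 * d - t z)) + N / 2 * (t z * (d - t z)) := by
        simp only [hψ, hc1, hc2, hc3]; field_simp; ring
      obtain ⟨h1, h2, h3⟩ := hz
      have hb1 := abs_le.mp (hM z (hKb z ⟨h1, h2, h3⟩))
      have hb2 := abs_le.mp (hM (A z) (by rw [hAn]; exact hKb z ⟨h1, h2, h3⟩))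
      have hφ : (1/2) * (u z - u (A z)) ≤ M := by linarith [hb1.2, hb2.1]
      have q0 : 0 ≤ N / 2 * (t z * (d - t z)) := by
        have : 0 ≤ d - t z := by linarith
        positivity
      rcases h2.eq_or_lt with h0 | h0
      · have : A z = z := by
          simp only [hAdef]
          have : z i - x i = 0 := h0.symm
          rw [this]; simp
        simp only [hh, this, sub_self, mul_zero, zero_sub, hψe, ← h0]
        have : 0 ≤ M / d ^ 2 * (a z) ^ 2 := by positivity
        simp; linarith
      have hge : d ^ 2 ≤ (a z) ^ 2 + t z * (2 * d - t z) := by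
        rcases h3.eq_or_lt with hd' | hd'
        · rw [hd']; nlinarith [sq_nonneg (a z)]
        · have : d ≤ |a z| := by
            by_contra hc; push Not at hc
            exact hzU ⟨hc, h0, hd'⟩
          have : d ^ 2 ≤ (a z) ^ 2 := by
            rw [← sq_abs (a z)]; exact pow_le_pow_left₀ hd.le this 2
          have h4 : 0 ≤ t z * (2 * d - t z) := mul_nonneg h2 (by linarith)
          linarith
      have : M ≤ M / d ^ 2 * ((a z) ^ 2 + t z * (2 * d - t z)) := by
        calc M = M / d ^ 2 * d ^ 2 := by field_simp
          _ ≤ _ := by gcongr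
      simp only [hh, hψe]; linarith
    · intro z hz _
      have hz' := hKb z (hUK hz)
      have e : lap h z = (1/2) * (lap u z - lap u (A z)) + N := by
        rw [hh, lap_sub ((sm_const (1/2) z).mul' ((hs z hz').sub' (huA z hz'))) (smψ z),
          lap_const_mul _ ((hs z hz').sub' (huA z hz')), lap_sub (hs z hz') (huA z hz'),
          hlapA, lapψ]; ring
      rw [e]
      have b1 := abs_lt.mp (hN z hz')
      have b2 := abs_lt.mp (hN (A z) (by rw [hAn]; exact hz'))
      linarith [b1.1, b2.2]
  -- derivative
  have hline (s : ℝ) : HasDerivAt (fun s : ℝ => x + s • ee i) (ee i) s := by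
    simpa using ((hasDerivAt_id s).smul_const (ee i)).const_add x
  have hux : HasFDerivAt u (fderiv ℝ u x) x := (hs x (by simp; positivity)).diff.hasFDerivAt
  have d1 : HasDerivAt (fun s : ℝ => u (x + s • ee i)) (pd u i x) 0 := by
    rw [pd_eq hux.differentiableAt]
    have hux' : HasFDerivAt u (fderiv ℝ u x) (x + (0:ℝ) • ee i) := by simpa using hux
    exact hux'.comp_hasDerivAt 0 (hline 0)
  have d2 : HasDerivAt (fun s : ℝ => u (x + (-s) • ee i)) (-(pd u i x)) 0 := by
    have d1' : HasDerivAt (fun s : ℝ => u (x + s • ee i)) (pd u i x) (-0) := by simpa using d1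
    have := HasDerivAt.comp (0:ℝ) d1' (hasDerivAt_neg (0:ℝ))
    rw [mul_neg_one] at this
    exact this
  have d3 := ((d1.sub d2).const_mul (1/2)).tendsto_slope_zero_right
  have : 1 / 2 * (pd u i x - -pd u i x) = pd u i x := by ring
  rw [this] at d3
  refine le_of_tendsto d3 ?_
  filter_upwards [Ioo_mem_nhdsGT hd] with s hs'
  have hK' : x + s • ee i ∈ K := by
    refine ⟨?_, ?_, ?_⟩ <;> simp [ha, ht, hij.symm, hs'.1.le, hs'.2.le, hd.le]
  have := main _ hK'
  have hAx : A (x + s • ee i) = x + (-s) • ee i := by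
    simp only [hAdef]; ext l; simp; split_ifs <;> ring
  have hψs : ψ (x + s • ee i) = c2 * (s * s) + c3 * s := by simp [hψ, ha, ht, hij.symm]
  simp only [hh, hAx, hψs] at this
  have hc2n : c2 * (s * s) ≤ 0 := by
    have : 0 ≤ M / d ^ 2 := by positivity
    have h5 : c2 ≤ 0 := by rw [hc2]; linarith
    exact mul_nonpos_of_nonpos_of_nonneg h5 (mul_self_nonneg s)
  simp only [Pi.sub_apply, zero_add, neg_zero, zero_smul, add_zero, sub_self, mul_zero, sub_zero,
    smul_eq_mul]
  rw [inv_mul_le_iff₀ hs'.1]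
  linarith

lemma pd_bound {u : Pl → ℝ} {x : Pl} {d M N : ℝ} (hd : 0 < d) (i : Fin 2)
    (hs : ∀ z, ‖z - x‖ ≤ 2 * d → Sm u z) (hM : ∀ z, ‖z - x‖ ≤ 2 * d → |u z| ≤ M)
    (hN : ∀ z, ‖z - x‖ ≤ 2 * d → |lap u z| < N) :
    |pd u i x| ≤ 2 * M / d + N * d / 2 := by
  obtain ⟨j, hij⟩ : ∃ j : Fin 2, i ≠ j := by fin_cases i; exacts [⟨1, by simp⟩, ⟨0, by simp⟩]
  have h1 := pd_le_aux hd i j hij hs hM hN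
  have h2 := pd_le_aux (u := fun y => - u y) hd i j hij (fun z hz => (hs z hz).neg')
    (fun z hz => by simpa using hM z hz)
    (fun z hz => by rw [lap_neg (hs z hz)]; simpa using hN z hz)
  have h3 : pd (fun y => - u y) i x = - pd u i x := by
    simpa using pd_const_mul (-1) (hs x (by simp; positivity)).diff i
  rw [h3] at h2
  exact abs_le.mpr ⟨by linarith, h1⟩

/-- nonlinearity in the variable `s = e^{-u}` -/
def Ph (τ s : ℝ) : ℝ := s * (1 - s) / (1 + τ * s) ^ 3
/-- potential in the variable `s = e^{-u}` -/
def Gs (τ s : ℝ) : ℝ := (1 - s) ^ 2 / (1 + τ * s) ^ 2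
/-- `|y|^{2ν}` -/
def sg (ν : ℝ) (y : Pl) : ℝ := ‖y‖ ^ (2 * ν)
/-- `e^{-u}` in terms of the regular part -/
def SS (ν : ℝ) (v : Pl → ℝ) (y : Pl) : ℝ := sg ν y * exp (-(v y))
/-- `u` in terms of the regular part -/
def hat (ν : ℝ) (v : Pl → ℝ) (y : Pl) : ℝ := v y - 2 * ν * Real.log ‖y‖

structure Sol (τ ν R : ℝ) (v : Pl → ℝ) : Prop where
  sm : ∀ y, ‖y‖ < R → Sm v y
  eq : ∀ y, ‖y‖ < R → lap v y = Ph τ (SS ν v y)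

lemma sg_nonneg (ν : ℝ) (y : Pl) : 0 ≤ sg ν y := Real.rpow_nonneg (norm_nonneg _) _

lemma SS_nonneg (ν : ℝ) (v : Pl → ℝ) (y : Pl) : 0 ≤ SS ν v y :=
  mul_nonneg (sg_nonneg ν y) (exp_pos _).le

lemma sg_continuous {ν : ℝ} (hν : 0 ≤ ν) : Continuous (sg ν) :=
  continuous_norm.rpow_const fun _ => Or.inr (by positivity)

lemma SS_eq {ν : ℝ} {v : Pl → ℝ} {y : Pl} (hy : y ≠ 0 ∨ ν = 0) : SS ν v y = exp (-(hat ν v y)) := by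
  rcases hy with hy | hy
  · have : 0 < ‖y‖ := norm_pos_iff.mpr hy
    unfold SS sg hat
    rw [Real.rpow_def_of_pos this, ← Real.exp_add]; congr 1; ring
  · subst hy; simp [SS, sg, hat]

lemma sm_hat {ν : ℝ} {v : Pl → ℝ} {y : Pl} (hv : Sm v y) (hy : y ≠ 0 ∨ ν = 0) : Sm (hat ν v) y := by
  rcases hy with hy | hy
  · exact hv.sub' ((sm_const (2 * ν) y).mul' (sm_log hy))
  · subst hy
    have : hat 0 v = v := by funext z; simp [hat]
    rw [this]; exact hv

lemma lap_hat {ν : ℝ} {v : Pl → ℝ} {y : Pl} (hv : Sm v y) (hy : y ≠ 0 ∨ ν = 0) :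
    lap (hat ν v) y = lap v y := by
  rcases hy with hy | hy
  · unfold hat
    rw [lap_sub hv ((sm_const (2 * ν) y).mul' (sm_log hy)), lap_const_mul _ (sm_log hy), lap_log hy]
    simp
  · subst hy
    have : hat 0 v = v := by funext z; simp [hat]
    rw [this]

lemma Ph_pos {τ s : ℝ} (hτ : 0 < τ) (h0 : 0 < s) (h1 : s < 1) : 0 < Ph τ s := by
  unfold Ph
  have : 0 < 1 - s := by linarith
  positivity

lemma Ph_nonneg {τ s : ℝ} (hτ : 0 < τ) (h0 : 0 ≤ s) (h1 : s ≤ 1) : 0 ≤ Ph τ s := by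
  unfold Ph
  have : 0 ≤ 1 - s := by linarith
  positivity

lemma Ph_neg {τ s : ℝ} (hτ : 0 < τ) (h1 : 1 < s) : Ph τ s < 0 := by
  unfold Ph
  have : 0 < s - 1 := by linarith
  have h2 : 0 < s * (s - 1) / (1 + τ * s) ^ 3 := by positivity
  have : s * (1 - s) / (1 + τ * s) ^ 3 = - (s * (s - 1) / (1 + τ * s) ^ 3) := by ring
  linarith

/-- bound of the nonlinearity -/
def C0 (τ : ℝ) : ℝ := (1 / τ) * (1 + 1 / τ)

lemma C0_pos {τ : ℝ} (hτ : 0 < τ) : 0 < C0 τ := by unfold C0; positivity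

lemma Ph_bound {τ s : ℝ} (hτ : 0 < τ) (h0 : 0 ≤ s) : |Ph τ s| ≤ C0 τ := by
  unfold Ph C0
  have hp : 0 < 1 + τ * s := by positivity
  have h1 : 1 ≤ 1 + τ * s := by nlinarith [mul_nonneg hτ.le h0]
  rw [abs_div, abs_mul, abs_of_nonneg h0, abs_of_pos (pow_pos hp 3), div_le_iff₀ (pow_pos hp 3)]
  have e1 : s ≤ (1 / τ) * (1 + τ * s) := by
    have : (1 / τ) * (1 + τ * s) = 1 / τ + s := by field_simp
    rw [this]; linarith [one_div_pos.mpr hτ]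
  have e2 : |1 - s| ≤ (1 + 1 / τ) * (1 + τ * s) := by
    have h3 : |1 - s| ≤ 1 + s := by rw [abs_le]; constructor <;> linarith
    have : (1 + 1 / τ) * (1 + τ * s) = 1 + τ * s + 1 / τ + s := by field_simp; ring
    rw [this]
    have : 0 < 1 / τ := by positivity
    have : 0 ≤ τ * s := by positivity
    linarith
  calc s * |1 - s| ≤ ((1 / τ) * (1 + τ * s)) * ((1 + 1 / τ) * (1 + τ * s)) := by
        apply mul_le_mul e1 e2 (abs_nonneg _) (by positivity)
    _ = (1 / τ * (1 + 1 / τ)) * (1 + τ * s) ^ 2 * 1 := by ring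
    _ ≤ (1 / τ * (1 + 1 / τ)) * (1 + τ * s) ^ 2 * (1 + τ * s) := by gcongr
    _ = _ := by ring

/-- coercivity constant -/
def c0 (τ : ℝ) : ℝ := (1 / 9) / (1 + 3 * τ) ^ 3

lemma c0_pos {τ : ℝ} (hτ : 0 < τ) : 0 < c0 τ := by unfold c0; positivity

lemma exp_le_three {t : ℝ} (ht : |t| ≤ 1) : exp t ≤ 3 := by
  have := Real.exp_le_exp.mpr (abs_le.mp ht).2
  linarith [Real.exp_one_lt_d9]

lemma third_le_exp {t : ℝ} (ht : |t| ≤ 1) : 1 / 3 ≤ exp t := by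
  have := exp_le_three (t := -t) (by simpa using ht)
  rw [Real.exp_neg] at this
  have hp := exp_pos t
  rw [inv_le_comm₀ hp (by norm_num)] at this
  simpa using this

lemma Ph_lower {τ t : ℝ} (hτ : 0 < τ) (h0 : 0 ≤ t) (h1 : t ≤ 1) : c0 τ * t ≤ Ph τ (exp (-t)) := by
  have ha : |-t| ≤ 1 := by rw [abs_neg, abs_le]; constructor <;> linarith
  have e1 := exp_le_three ha
  have e2 := third_le_exp ha
  set s := exp (-t) with hs
  have hs0 : 0 < s := exp_pos _
  have e3 : t * s ≤ 1 - s := by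
    have h3 : s * exp t = 1 := by rw [hs, ← Real.exp_add]; simp
    have h2 := Real.add_one_le_exp t
    nlinarith
  unfold Ph c0
  have : (1 / 9 : ℝ) / (1 + 3 * τ) ^ 3 * t = (1 / 9 * t) / (1 + 3 * τ) ^ 3 := by ring
  rw [this]
  have h9 : 1 / 9 * t ≤ s * (1 - s) := by
    have : 1/3 * t ≤ t * s := by nlinarith
    nlinarith
  apply div_le_div₀ (by nlinarith) h9 (by positivity)
  apply pow_le_pow_left₀ (by positivity); nlinarith

lemma Ph_upper {τ t : ℝ} (hτ : 0 < τ) (h0 : t ≤ 0) (h1 : -1 ≤ t) : Ph τ (exp (-t)) ≤ c0 τ * t := by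
  have ha : |-t| ≤ 1 := by rw [abs_neg, abs_le]; constructor <;> linarith
  have e1 := exp_le_three ha
  have e2 := Real.add_one_le_exp (-t)
  set s := exp (-t) with hs
  have hs1 : 1 ≤ s := by linarith
  unfold Ph c0
  have h1 : (1 / 9 : ℝ) / (1 + 3 * τ) ^ 3 * t = -((1 / 9 * (-t)) / (1 + 3 * τ) ^ 3) := by ring
  have h2 : s * (1 - s) / (1 + τ * s) ^ 3 = - (s * (s - 1) / (1 + τ * s) ^ 3) := by ring
  rw [h1, h2, neg_le_neg_iff]
  apply div_le_div₀ (by nlinarith) (by nlinarith) (by positivity)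
  apply pow_le_pow_left₀ (by positivity); nlinarith

lemma one_sub_exp_bound {t : ℝ} (ht : |t| ≤ 1) : |1 - exp (-t)| ≤ 3 * |t| := by
  have e1 := exp_le_three (t := -t) (by simpa using ht)
  have e2 := Real.add_one_le_exp (-t)
  have e3 := Real.add_one_le_exp t
  have h3 : exp (-t) * exp t = 1 := by rw [← Real.exp_add]; simp
  have hp := exp_pos (-t)
  rw [abs_le]
  rcases le_total 0 t with h | h
  · rw [abs_of_nonneg h]; constructor <;> nlinarith [Real.exp_le_one_iff.mpr (neg_nonpos.mpr h)]
  · rw [abs_of_nonpos h]; constructor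
    · nlinarith
    · nlinarith

lemma Ph_lin {τ t : ℝ} (hτ : 0 < τ) (ht : |t| ≤ 1) : |Ph τ (exp (-t))| ≤ 9 * |t| := by
  have e1 := exp_le_three (t := -t) (by simpa using ht)
  have e2 := one_sub_exp_bound ht
  set s := exp (-t) with hs
  have hs0 : 0 < s := exp_pos _
  unfold Ph
  rw [abs_div, abs_mul, abs_of_pos hs0, abs_of_pos (by positivity : 0 < (1 + τ * s) ^ 3),
    div_le_iff₀ (by positivity)]
  have h1 : (1:ℝ) ≤ (1 + τ * s) ^ 3 := one_le_pow₀ (by nlinarith [mul_pos hτ hs0])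
  calc s * |1 - s| ≤ 3 * (3 * |t|) := mul_le_mul e1 e2 (abs_nonneg _) (by norm_num)
    _ = 9 * |t| * 1 := by ring
    _ ≤ _ := by gcongr

lemma Gs_nonneg {τ s : ℝ} : 0 ≤ Gs τ s := by unfold Gs; positivity

lemma Gs_quad {τ t : ℝ} (hτ : 0 < τ) (ht : |t| ≤ 1) : Gs τ (exp (-t)) ≤ 9 * t ^ 2 := by
  have e2 := one_sub_exp_bound ht
  set s := exp (-t) with hs
  have hs0 : 0 < s := exp_pos _
  unfold Gs
  rw [div_le_iff₀ (by positivity)]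
  have h1 : (1:ℝ) ≤ (1 + τ * s) ^ 2 := one_le_pow₀ (by nlinarith [mul_pos hτ hs0])
  calc (1 - s) ^ 2 = |1 - s| ^ 2 := (sq_abs _).symm
    _ ≤ (3 * |t|) ^ 2 := by gcongr
    _ = 9 * t ^ 2 * 1 := by rw [mul_pow, sq_abs]; ring
    _ ≤ _ := by gcongr

lemma Gs_anti {τ s s' : ℝ} (hτ : 0 < τ) (h0 : 0 ≤ s) (h : s ≤ s') (h1 : s' ≤ 1) :
    Gs τ s' ≤ Gs τ s := by
  unfold Gs
  apply div_le_div₀ (by positivity) _ (by positivity) _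
  · apply pow_le_pow_left₀ <;> linarith
  · apply pow_le_pow_left₀ (by have := h0.trans h; positivity)
    nlinarith

lemma Gs_pos {τ s : ℝ} (hτ : 0 < τ) (h0 : 0 ≤ s) (h1 : s < 1) : 0 < Gs τ s := by
  unfold Gs
  have : 0 < 1 - s := by linarith
  positivity

lemma sm_continuousOn {v : Pl → ℝ} {s : Set Pl} (h : ∀ y ∈ s, Sm v y) : ContinuousOn v s :=
  fun y hy => (h y hy).continuousAt.continuousWithinAt

lemma cb_compact (r : ℝ) : IsCompact {y : Pl | ‖y‖ ≤ r} := by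
  have : {y : Pl | ‖y‖ ≤ r} = closedBall 0 r := by ext; simp
  rw [this]; exact isCompact_closedBall _ _

lemma ob_open (r : ℝ) : IsOpen {y : Pl | ‖y‖ < r} := isOpen_lt continuous_norm continuous_const

/-- lower bound by the maximum principle -/
lemma comp_lower {τ ν R r B : ℝ} {v : Pl → ℝ} (hτ : 0 < τ) (hν : 0 ≤ ν) (hS : Sol τ ν R v)
    (hrR : r < R) (hB : 0 ≤ B) (hb : ∀ y, ‖y‖ = r → SS ν v y ≤ exp B) :
    ∀ y, ‖y‖ ≤ r → SS ν v y ≤ exp B := by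
  intro x hx
  have hc : ContinuousOn (SS ν v) {y : Pl | ‖y‖ ≤ r} := by
    have h1 : ContinuousOn v {y : Pl | ‖y‖ ≤ r} :=
      sm_continuousOn fun y hy => hS.sm y (lt_of_le_of_lt hy hrR)
    exact (sg_continuous hν).continuousOn.mul (Real.continuous_exp.comp_continuousOn h1.neg)
  obtain ⟨y, hy, hmax⟩ := (cb_compact r).exists_isMaxOn ⟨x, hx⟩ hc
  refine le_trans (hmax hx) ?_
  by_contra hgt
  push Not at hgt
  have hyr : ‖y‖ < r := by
    refine lt_of_le_of_ne hy fun h => ?_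
    exact absurd (hb y h) (not_le.mpr hgt)
  have h1 : 1 < SS ν v y := lt_of_le_of_lt (Real.one_le_exp hB) hgt
  have hy0 : y ≠ 0 ∨ ν = 0 := by
    by_contra hcon
    push Not at hcon
    have : SS ν v y = 0 := by
      unfold SS sg; rw [hcon.1, norm_zero, Real.zero_rpow (by simpa using hcon.2)]; simp
    linarith
  have hsm := hS.sm y (hyr.trans hrR)
  have hloc : IsLocalMax (fun z => - hat ν v z) y := by
    have h2 : IsLocalMax (SS ν v) y :=
      hmax.isLocalMax (mem_of_superset ((ob_open r).mem_nhds hyr) fun z (hz : ‖z‖ < r) => (le_of_lt hz : ‖z‖ ≤ r))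
    have h3 : ∀ᶠ z in 𝓝 y, z ≠ 0 ∨ ν = 0 := by
      rcases hy0 with h | h
      · filter_upwards [isOpen_ne.mem_nhds h] with z hz using Or.inl hz
      · exact Eventually.of_forall fun _ => Or.inr h
    filter_upwards [h2, h3] with z h4 h5
    rw [SS_eq h5, SS_eq hy0] at h4
    exact Real.exp_le_exp.mp h4
  have h6 := lap_nonpos_of_localMax (sm_hat hsm hy0).neg' hloc
  rw [lap_neg (sm_hat hsm hy0), lap_hat hsm hy0, hS.eq y (hyr.trans hrR)] at h6
  linarith [Ph_neg hτ h1]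

/-- upper bound for the regular part in a ball -/
lemma comp_upper {τ ν R r M : ℝ} {v : Pl → ℝ} (hτ : 0 < τ) (hν : 0 ≤ ν) (hS : Sol τ ν R v)
    (hr : 0 < r) (hrR : r < R) (hM : 0 ≤ M) (hb : ∀ y, ‖y‖ = r → hat ν v y ≤ M) :
    ∀ y, ‖y‖ ≤ r → v y ≤ M + 2 * ν * Real.log r := by
  intro x hx
  by_contra hgt
  push Not at hgt
  set κ := (v x - (M + 2 * ν * Real.log r)) / (2 * r ^ 2) with hκ
  have hκ0 : 0 < κ := by rw [hκ]; apply div_pos <;> [linarith; positivity]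
  have hκ2 : κ * r ^ 2 < v x - (M + 2 * ν * Real.log r) := by
    rw [hκ]; field_simp; linarith
  have := maxPrinciple (K := {y : Pl | ‖y‖ ≤ r}) (U := {y : Pl | ‖y‖ < r}) (cb_compact r)
    (ob_open r) (fun z (hz : ‖z‖ < r) => (le_of_lt hz : ‖z‖ ≤ r))
    (h := fun y => v y + κ * ‖y - 0‖ ^ 2 - (M + 2 * ν * Real.log r + κ * r ^ 2))
    (sm_continuousOn fun y hy => ((hS.sm y (lt_of_le_of_lt hy hrR)).add'
      ((sm_const κ y).mul' (sm_normsq 0 y))).sub' (sm_const _ y)) ?_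
    (fun y hy _ => ((hS.sm y (lt_trans hy hrR)).add'
      ((sm_const κ y).mul' (sm_normsq 0 y))).sub' (sm_const _ y)) ?_ x hx
  · simp only [sub_zero] at this
    nlinarith [sq_nonneg ‖x‖]
  · intro y hy hyn
    have hyr : ‖y‖ = r := le_antisymm hy (not_lt.mp hyn)
    have h1 := hb y hyr
    unfold hat at h1
    simp only [sub_zero, hyr] at h1 ⊢
    linarith
  · intro y hy hpos
    have hy' : ‖y‖ < r := hy
    have hsm := hS.sm y (hy'.trans hrR)
    rw [lap_sub (hsm.add' ((sm_const κ y).mul' (sm_normsq 0 y))) (sm_const _ y),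
      lap_add hsm ((sm_const κ y).mul' (sm_normsq 0 y)), lap_const_mul _ (sm_normsq 0 y),
      lap_normsq, lap_const, hS.eq y (hy'.trans hrR)]
    have hv : 2 * ν * Real.log r ≤ v y := by
      simp only [sub_zero] at hpos
      have : κ * ‖y‖ ^ 2 ≤ κ * r ^ 2 := by gcongr
      linarith
    have hs1 : SS ν v y ≤ 1 := by
      have h1 : sg ν y ≤ r ^ (2 * ν) := Real.rpow_le_rpow (norm_nonneg _) hy'.le (by positivity)
      rw [Real.rpow_def_of_pos hr] at h1
      calc SS ν v y ≤ exp (Real.log r * (2 * ν)) * exp (-(v y)) := by unfold SS; gcongr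
        _ = exp (Real.log r * (2 * ν) - v y) := by rw [← Real.exp_add]; rfl
        _ ≤ 1 := by rw [Real.exp_le_one_iff]; linarith
    have := Ph_nonneg hτ (SS_nonneg ν v y) hs1
    linarith

lemma comp_annulus {τ ν R r r' B : ℝ} {v : Pl → ℝ} (hτ : 0 < τ) (hS : Sol τ ν R v)
    (hr : 0 < r) (hrR : r' < R) (hB : 0 ≤ B) (hb : ∀ y, ‖y‖ = r → hat ν v y ≤ B)
    (hb' : ∀ y, ‖y‖ = r' → hat ν v y ≤ B) :
    ∀ y, r ≤ ‖y‖ → ‖y‖ ≤ r' → hat ν v y ≤ B := by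
  intro x hx hx'
  have hne : ∀ y : Pl, r ≤ ‖y‖ → y ≠ 0 := fun y hy => norm_pos_iff.mp (lt_of_lt_of_le hr hy)
  have hsm : ∀ y : Pl, r ≤ ‖y‖ → ‖y‖ ≤ r' → Sm (hat ν v) y := fun y h1 h2 =>
    sm_hat (hS.sm y (h2.trans_lt hrR)) (Or.inl (hne y h1))
  have := maxPrinciple (K := {y : Pl | r ≤ ‖y‖ ∧ ‖y‖ ≤ r'}) (U := {y : Pl | r < ‖y‖ ∧ ‖y‖ < r'})
    ((cb_compact r').inter_left (isClosed_le continuous_const continuous_norm))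
    ((isOpen_lt continuous_const continuous_norm).inter (ob_open r'))
    (fun z hz => ⟨hz.1.le, hz.2.le⟩)
    (h := fun y => hat ν v y - B)
    (sm_continuousOn fun y hy => (hsm y hy.1 hy.2).sub' (sm_const _ y)) ?_
    (fun y hy _ => (hsm y hy.1.le hy.2.le).sub' (sm_const _ y)) ?_ x ⟨hx, hx'⟩
  · linarith
  · intro y hy hyn
    rcases hy.1.eq_or_lt with h | h
    · linarith [hb y h.symm]
    · rcases hy.2.eq_or_lt with h2 | h2
      · linarith [hb' y h2]
      · exact absurd ⟨h, h2⟩ hyn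
  · intro y hy hpos
    have h0 : y ≠ 0 ∨ ν = 0 := Or.inl (hne y hy.1.le)
    have hvs := hS.sm y (hy.2.trans hrR)
    rw [lap_sub (hsm y hy.1.le hy.2.le) (sm_const _ y), lap_const, lap_hat hvs h0,
      hS.eq y (hy.2.trans hrR), SS_eq h0, sub_zero]
    apply Ph_pos hτ (exp_pos _)
    rw [Real.exp_lt_one_iff]; linarith

lemma comp_vlower {τ ν R r m : ℝ} {v : Pl → ℝ} (hτ : 0 < τ) (hS : Sol τ ν R v)
    (hrR : r < R) (hb : ∀ y, ‖y‖ = r → m ≤ v y) :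
    ∀ y, ‖y‖ ≤ r → m - C0 τ * r ^ 2 ≤ v y := by
  intro x hx
  have hsm : ∀ y : Pl, ‖y‖ ≤ r → Sm (fun y => C0 τ * ‖y - 0‖ ^ 2 - v y - (C0 τ * r ^ 2 - m)) y :=
    fun y hy => (((sm_const _ y).mul' (sm_normsq 0 y)).sub' (hS.sm y (hy.trans_lt hrR))).sub'
      (sm_const _ y)
  have := maxPrinciple (K := {y : Pl | ‖y‖ ≤ r}) (U := {y : Pl | ‖y‖ < r}) (cb_compact r)
    (ob_open r) (fun z (hz : ‖z‖ < r) => (le_of_lt hz : ‖z‖ ≤ r))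
    (h := fun y => C0 τ * ‖y - 0‖ ^ 2 - v y - (C0 τ * r ^ 2 - m))
    (sm_continuousOn hsm) ?_ (fun y hy _ => hsm y (le_of_lt hy)) ?_ x hx
  · have h2 := mul_nonneg (C0_pos hτ).le (sq_nonneg ‖x - 0‖)
    linarith
  · intro y hy hyn
    have hyr : ‖y‖ = r := le_antisymm hy (not_lt.mp hyn)
    have h1 := hb y hyr
    simp only [sub_zero, hyr]
    linarith
  · intro y hy _
    have hy' : ‖y‖ < R := lt_trans hy hrR
    rw [lap_sub (((sm_const _ y).mul' (sm_normsq 0 y)).sub' (hS.sm y hy')) (sm_const _ y),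
      lap_sub ((sm_const _ y).mul' (sm_normsq 0 y)) (hS.sm y hy'), lap_const_mul _ (sm_normsq 0 y),
      lap_normsq, lap_const, hS.eq y hy']
    have := (abs_le.mp (Ph_bound hτ (SS_nonneg ν v y))).2
    linarith [C0_pos hτ]

/-- decay estimate for small solutions in the variable `u` -/
lemma decay_aux {τ ρ δ s : ℝ} {u : Pl → ℝ} {x : Pl} (hτ : 0 < τ) (hρ : 0 < ρ) (hδ : 0 < δ) (hδ1 : δ ≤ 1)
    (hsm : ∀ z, ‖z - x‖ ≤ ρ → Sm u z) (heq : ∀ z, ‖z - x‖ ≤ ρ → lap u z = Ph τ (exp (-(u z))))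
    (hb : ∀ z, ‖z - x‖ ≤ ρ → |u z| ≤ δ) (hs : s = 1 ∨ s = -1) :
    s * u x ≤ 4 / c0 τ * δ / ρ ^ 2 := by
  have hc := c0_pos hτ
  have hsm' : ∀ z, ‖z - x‖ ≤ ρ → Sm (fun z => s * u z - (δ / ρ ^ 2 * ‖z - x‖ ^ 2 + 4 / c0 τ * δ / ρ ^ 2)) z :=
    fun z hz => ((sm_const s z).mul' (hsm z hz)).sub'
      (((sm_const _ z).mul' (sm_normsq x z)).add' (sm_const _ z))
  have hcb : {z : Pl | ‖z - x‖ ≤ ρ} = closedBall x ρ := by ext; simp [dist_eq_norm]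
  have hob : {z : Pl | ‖z - x‖ < ρ} = ball x ρ := by ext; simp [dist_eq_norm]
  have := maxPrinciple (K := {z : Pl | ‖z - x‖ ≤ ρ}) (U := {z : Pl | ‖z - x‖ < ρ})
    (by rw [hcb]; exact isCompact_closedBall _ _) (by rw [hob]; exact isOpen_ball)
    (fun z (hz : ‖z - x‖ < ρ) => (le_of_lt hz : ‖z - x‖ ≤ ρ)) (h := fun z => s * u z - (δ / ρ ^ 2 * ‖z - x‖ ^ 2 + 4 / c0 τ * δ / ρ ^ 2))
    (sm_continuousOn hsm') ?_ (fun z hz _ => hsm' z (le_of_lt hz)) ?_ x (by simp; positivity)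
  · simp only [sub_self, norm_zero] at this
    norm_num at this
    exact this
  · intro z hz hzn
    have hzr : ‖z - x‖ = ρ := le_antisymm hz (not_lt.mp hzn)
    have h1 := abs_le.mp (hb z hz)
    simp only [hzr]
    have h2 : δ / ρ ^ 2 * ρ ^ 2 = δ := by field_simp
    have h3 : 0 < 4 / c0 τ * δ / ρ ^ 2 := by positivity
    rcases hs with h | h <;> subst h <;> linarith
  · intro z hz hpos
    have hz' : ‖z - x‖ ≤ ρ := le_of_lt hz
    have h1 := abs_le.mp (hb z hz')
    rw [lap_sub ((sm_const s z).mul' (hsm z hz'))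
      (((sm_const _ z).mul' (sm_normsq x z)).add' (sm_const _ z)), lap_const_mul _ (hsm z hz'),
      lap_add ((sm_const _ z).mul' (sm_normsq x z)) (sm_const _ z),
      lap_const_mul _ (sm_normsq x z), lap_normsq, lap_const, heq z hz']
    have hlow : 4 / c0 τ * δ / ρ ^ 2 < s * u z := by
      have : 0 ≤ δ / ρ ^ 2 * ‖z - x‖ ^ 2 := by positivity
      linarith
    have h2 : 0 < 4 / c0 τ * δ / ρ ^ 2 := by positivity
    have h3 : c0 τ * (s * u z) ≤ s * Ph τ (exp (-(u z))) := by
      rcases hs with h | h <;> subst h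
      · have := Ph_lower hτ (t := u z) (by linarith) (by linarith)
        linarith
      · have := Ph_upper hτ (t := u z) (by linarith) (by linarith)
        linarith
    have h4 : c0 τ * (4 / c0 τ * δ / ρ ^ 2) < c0 τ * (s * u z) := by gcongr
    have h5 : c0 τ * (4 / c0 τ * δ / ρ ^ 2) = δ / ρ ^ 2 * 4 := by field_simp
    linarith

lemma decay {τ ρ δ : ℝ} {u : Pl → ℝ} {x : Pl} (hτ : 0 < τ) (hρ : 0 < ρ) (hδ : 0 < δ) (hδ1 : δ ≤ 1)
    (hsm : ∀ z, ‖z - x‖ ≤ ρ → Sm u z) (heq : ∀ z, ‖z - x‖ ≤ ρ → lap u z = Ph τ (exp (-(u z))))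
    (hb : ∀ z, ‖z - x‖ ≤ ρ → |u z| ≤ δ) :
    |u x| ≤ 4 / c0 τ * δ / ρ ^ 2 := by
  have h1 := decay_aux (s := 1) hτ hρ hδ hδ1 hsm heq hb (Or.inl rfl)
  have h2 := decay_aux (s := -1) hτ hρ hδ hδ1 hsm heq hb (Or.inr rfl)
  rw [abs_le]; constructor <;> linarith

/-- decay estimate with gradient -/
lemma decay_grad {τ ρ δ : ℝ} {u : Pl → ℝ} {x : Pl} (hτ : 0 < τ) (hρ : 4 ≤ ρ) (hδ : 0 < δ) (hδ1 : δ ≤ 1)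
    (hsm : ∀ z, ‖z - x‖ ≤ ρ → Sm u z) (heq : ∀ z, ‖z - x‖ ≤ ρ → lap u z = Ph τ (exp (-(u z))))
    (hb : ∀ z, ‖z - x‖ ≤ ρ → |u z| ≤ δ) (i : Fin 2) :
    |pd u i x| ≤ 128 / c0 τ * δ / ρ ^ 2 := by
  have hc := c0_pos hτ
  have hin : ∀ z, ‖z - x‖ ≤ 2 * 1 → ∀ y, ‖y - z‖ ≤ ρ / 2 → ‖y - x‖ ≤ ρ := by
    intro z hz y hy
    calc ‖y - x‖ = ‖(y - z) + (z - x)‖ := by congr 1; abel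
      _ ≤ ‖y - z‖ + ‖z - x‖ := norm_add_le _ _
      _ ≤ ρ := by linarith
  have h1 : ∀ z, ‖z - x‖ ≤ 2 * 1 → |u z| ≤ 4 / c0 τ * δ / (ρ / 2) ^ 2 := fun z hz =>
    decay hτ (by positivity) hδ hδ1 (fun y hy => hsm y (hin z hz y hy))
      (fun y hy => heq y (hin z hz y hy)) (fun y hy => hb y (hin z hz y hy))
  set κ := 4 / c0 τ * δ / (ρ / 2) ^ 2 with hκ
  have hκ0 : 0 < κ := by positivity
  have h2 : ∀ z, ‖z - x‖ ≤ 2 * 1 → |lap u z| < 10 * κ := by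
    intro z hz
    have hzρ : ‖z - x‖ ≤ ρ := by linarith
    rw [heq z hzρ]
    have := Ph_lin hτ ((hb z hzρ).trans hδ1)
    linarith [h1 z hz]
  have := pd_bound one_pos i (fun z hz => hsm z (by linarith)) h1 h2
  refine this.trans (le_of_lt ?_)
  have e : 128 / c0 τ * δ / ρ ^ 2 = 8 * κ := by rw [hκ]; field_simp; ring
  rw [e]; linarith

lemma sm_Ph {τ s : ℝ} (hτ : 0 < τ) (h0 : 0 ≤ s) : ContDiffAt ℝ (⊤ : ℕ∞) (Ph τ) s := by
  unfold Ph
  apply ContDiffAt.div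
  · fun_prop
  · fun_prop
  · positivity

lemma sm_sg_ne {ν : ℝ} {y : Pl} (hy : y ≠ 0) : Sm (sg ν) y :=
  (contDiffAt_norm ℝ hy).rpow_const_of_ne (norm_ne_zero_iff.mpr hy)

lemma sg_zero {ν : ℝ} (hν : 0 < ν) : sg ν 0 = 0 := by
  unfold sg; rw [norm_zero, Real.zero_rpow (by positivity)]

lemma sm_sg {τ ν R : ℝ} {v : Pl → ℝ} (hτ : 0 < τ) (hν : 0 ≤ ν) (hR : 0 < R) (hS : Sol τ ν R v)
    (y : Pl) : Sm (sg ν) y := by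
  by_cases hy : y = 0
  swap
  · exact sm_sg_ne hy
  subst hy
  rcases hν.eq_or_lt with h | hν'
  · subst h
    have : sg 0 = fun _ => (1:ℝ) := by funext z; simp [sg]
    rw [this]; exact sm_const _ _
  have hvs : Sm v 0 := hS.sm 0 (by simpa using hR)
  have hPd : HasDerivAt (Ph τ) 1 0 := by
    have h1 : HasDerivAt (fun s : ℝ => s * (1 - s)) (1 * (1 - 0) + 0 * (-1)) 0 :=
      (hasDerivAt_id (0:ℝ)).mul ((hasDerivAt_id (0:ℝ)).const_sub 1)
    have h2 : HasDerivAt (fun s : ℝ => (1 + τ * s) ^ 3) (3 * (1 + τ * 0) ^ 2 * (τ * 1)) 0 := by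
      have := (((hasDerivAt_id' (0:ℝ)).const_mul τ).const_add 1).fun_pow 3
      simpa using this
    have h3 := h1.fun_div h2 (by simp)
    have h4 : Ph τ = fun s => s * (1 - s) / (1 + τ * s) ^ 3 := rfl
    rw [h4]
    exact h3.congr_deriv (by simp)
  have hP0 : ContDiffAt ℝ (⊤ : ℕ∞) (Ph τ) 0 := sm_Ph hτ le_rfl
  have hPf : HasFDerivAt (Ph τ) ((ContinuousLinearEquiv.refl ℝ ℝ : ℝ ≃L[ℝ] ℝ) : ℝ →L[ℝ] ℝ) 0 := by
    exact hPd.hasFDerivAt.congr_fderiv (by ext; simp)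
  have hn : ((⊤ : ℕ∞) : WithTop ℕ∞) ≠ 0 := by simp
  have hinv := hP0.to_localInverse hPf hn
  have hleft : ∀ᶠ s in 𝓝 (0:ℝ), hP0.localInverse hPf hn (Ph τ s) = s :=
    (hP0.hasStrictFDerivAt' hPf hn).eventually_left_inverse
  have hS0 : SS ν v 0 = 0 := by simp [SS, sg_zero hν']
  have hSc : ContinuousAt (SS ν v) 0 :=
    ((sg_continuous hν).continuousAt).mul (Real.continuous_exp.continuousAt.comp hvs.continuousAt.neg)
  have hT : Tendsto (SS ν v) (𝓝 0) (𝓝 0) := by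
    have := hSc.tendsto; rwa [hS0] at this
  have hball : ∀ᶠ z : Pl in 𝓝 0, ‖z‖ < R := (ob_open R).mem_nhds (by simpa using hR)
  have hSe : SS ν v =ᶠ[𝓝 0] fun z => hP0.localInverse hPf hn (lap v z) := by
    filter_upwards [hT.eventually hleft, hball] with z h1 h2
    rw [hS.eq z h2, h1]
  have hSS : Sm (SS ν v) 0 := by
    refine ContDiffAt.congr_of_eventuallyEq ?_ hSe
    refine ContDiffAt.comp (g := hP0.localInverse hPf hn) 0 ?_ hvs.lap
    rw [hS.eq 0 (by simpa using hR), hS0]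
    exact hinv
  have : sg ν = fun z => SS ν v z * exp (v z) := by
    funext z; unfold SS; rw [mul_assoc, ← Real.exp_add]; simp
  rw [this]
  exact hSS.mul' hvs.exp

lemma sg_homog (ν : ℝ) (hν : 0 ≤ ν) (x : Pl) :
    x 0 * pd (sg ν) 0 x + x 1 * pd (sg ν) 1 x = 2 * ν * sg ν x := by
  by_cases hx : x = 0
  · subst hx
    rcases hν.eq_or_lt with h | h
    · subst h; simp
    · simp [sg_zero h]
  have hev : sg ν =ᶠ[𝓝 x] fun y => exp ((2 * ν) * Real.log ‖y‖) := by
    filter_upwards [isOpen_ne.mem_nhds hx] with y hy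
    unfold sg; rw [Real.rpow_def_of_pos (norm_pos_iff.mpr hy), mul_comm]
  have hd : DifferentiableAt ℝ (fun y : Pl => Real.log ‖y‖) x := (sm_log hx).diff
  have h (i : Fin 2) : pd (sg ν) i x = sg ν x * ((2 * ν) * (x i / ‖x‖ ^ 2)) := by
    rw [pd_congr hev, pd_comp (u := fun y => (2 * ν) * Real.log ‖y‖) (Real.hasDerivAt_exp _)
      (hd.const_mul _), pd_const_mul _ hd, pd_log hx, hev.eq_of_nhds]
  have hn : ‖x‖ ^ 2 ≠ 0 := by simpa using hx
  rw [h, h]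
  have := norm_sq_eq x
  field_simp
  rw [this]

/-- cutoff profile -/
def th (t : ℝ) : ℝ := Real.smoothTransition (2 - 4 * t)

lemma th_contDiff : ContDiff ℝ (⊤ : ℕ∞) th :=
  Real.smoothTransition.contDiff.comp (by fun_prop)

lemma th_one {t : ℝ} (h : t ≤ 1 / 4) : th t = 1 := Real.smoothTransition.one_of_one_le (by linarith)
lemma th_zero {t : ℝ} (h : 1 / 2 ≤ t) : th t = 0 := Real.smoothTransition.zero_of_nonpos (by linarith)
lemma th_nonneg (t : ℝ) : 0 ≤ th t := Real.smoothTransition.nonneg _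
lemma th_le_one (t : ℝ) : th t ≤ 1 := Real.smoothTransition.le_one _

lemma th_hasDeriv (t : ℝ) : HasDerivAt th (deriv th t) t :=
  (th_contDiff.differentiable (by simp)).differentiableAt.hasDerivAt

lemma th'_cont : Continuous (deriv th) := th_contDiff.continuous_deriv (by simp)

lemma th'_zero_left {t : ℝ} (h : t < 1 / 4) : deriv th t = 0 := by
  have : th =ᶠ[𝓝 t] fun _ => 1 := by
    filter_upwards [Iio_mem_nhds h] with s hs using th_one (le_of_lt hs)
  rw [this.deriv_eq]; simp

lemma th'_zero_right {t : ℝ} (h : 1 / 2 < t) : deriv th t = 0 := by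
  have : th =ᶠ[𝓝 t] fun _ => 0 := by
    filter_upwards [Ioi_mem_nhds h] with s hs using th_zero (le_of_lt hs)
  rw [this.deriv_eq]; simp

lemma th'_bound : ∃ C, 0 < C ∧ ∀ t, |deriv th t| ≤ C := by
  obtain ⟨C, hC⟩ := (isCompact_Icc (a := (0:ℝ)) (b := 1)).exists_bound_of_continuousOn
    th'_cont.continuousOn
  refine ⟨|C| + 1, by positivity, fun t => ?_⟩
  by_cases h : t ∈ Icc (0:ℝ) 1
  · have := hC t h
    rw [Real.norm_eq_abs] at this
    linarith [le_abs_self C]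
  · have : deriv th t = 0 := by
      by_cases h0 : t < 1 / 4
      · exact th'_zero_left h0
      · apply th'_zero_right
        by_contra h1
        exact h ⟨by linarith, by linarith⟩
    rw [this]; simp; positivity

/-- cutoff function at scale `R` -/
def eta (R : ℝ) (y : Pl) : ℝ := th (‖y - 0‖ ^ 2 / R ^ 2)

lemma sm_eta (R : ℝ) (y : Pl) : Sm (eta R) y :=
  ContDiffAt.comp (g := th) y th_contDiff.contDiffAt ((sm_normsq 0 y).div_const _)

lemma pd_eta {R : ℝ} (y : Pl) (i : Fin 2) :
    pd (eta R) i y = deriv th (‖y‖ ^ 2 / R ^ 2) * (2 * y i / R ^ 2) := by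
  have e : eta R = fun y => th ((1 / R ^ 2) * ‖y - 0‖ ^ 2) := by
    funext z; unfold eta; congr 1; ring
  rw [e, pd_comp (u := fun y : Pl => (1 / R ^ 2) * ‖y - 0‖ ^ 2) (th_hasDeriv _)
    ((sm_normsq 0 y).diff.const_mul _), pd_const_mul _ (sm_normsq 0 y).diff, pd_normsq]
  simp only [sub_zero, PiLp.zero_apply]
  rw [show 1 / R ^ 2 * ‖y‖ ^ 2 = ‖y‖ ^ 2 / R ^ 2 by ring]; ring

lemma eta_zero {R : ℝ} (hR : 0 < R) {y : Pl} (hy : R ^ 2 / 2 ≤ ‖y‖ ^ 2) : eta R y = 0 := by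
  apply th_zero; rw [sub_zero, le_div_iff₀ (by positivity)]; linarith
lemma eta_one {R : ℝ} (hR : 0 < R) {y : Pl} (hy : ‖y‖ ≤ R / 2) : eta R y = 1 := by
  apply th_one; rw [sub_zero, div_le_iff₀ (by positivity)]
  have : ‖y‖ ^ 2 ≤ (R / 2) ^ 2 := by gcongr
  linarith
lemma eta_nonneg (R : ℝ) (y : Pl) : 0 ≤ eta R y := th_nonneg _
lemma eta_le_one (R : ℝ) (y : Pl) : eta R y ≤ 1 := th_le_one _

lemma integral_th' {R : ℝ} (hR : 0 < R) :
    ∫ y : Pl, deriv th (‖y‖ ^ 2 / R ^ 2) * (2 / R ^ 2) = - (2 * π) := by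
  rw [integral_fun_norm_addHaar (volume : Measure Pl) (fun r => deriv th (r ^ 2 / R ^ 2) * (2 / R ^ 2))]
  have hd : ∀ r ∈ Ici (0:ℝ), HasDerivAt (fun r => th (r ^ 2 / R ^ 2))
      (r ^ (Module.finrank ℝ Pl - 1) • (deriv th (r ^ 2 / R ^ 2) * (2 / R ^ 2))) r := by
    intro r _
    have h1 : HasDerivAt (fun r : ℝ => r ^ 2 / R ^ 2) (2 * r / R ^ 2) r := by
      have := ((hasDerivAt_id' r).fun_pow 2).div_const (R ^ 2)
      simpa using this
    have h2 := (th_hasDeriv (r ^ 2 / R ^ 2)).comp r h1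
    refine h2.congr_deriv ?_
    rw [show Module.finrank ℝ Pl - 1 = 1 by simp]
    simp only [smul_eq_mul, pow_one]; ring
  have ht : Tendsto (fun r => th (r ^ 2 / R ^ 2)) atTop (𝓝 0) := by
    refine tendsto_const_nhds.congr' ?_
    filter_upwards [eventually_ge_atTop R] with r hr
    rw [th_zero]
    rw [le_div_iff₀ (by positivity)]
    nlinarith
  have hi : IntegrableOn (fun r : ℝ => r ^ (Module.finrank ℝ Pl - 1) •
      (deriv th (r ^ 2 / R ^ 2) * (2 / R ^ 2))) (Ioi 0) := by
    apply Integrable.integrableOn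
    apply Continuous.integrable_of_hasCompactSupport
    · have := th'_cont
      fun_prop
    · apply HasCompactSupport.intro (isCompact_Icc (a := -R) (b := R))
      intro r hr
      rw [th'_zero_right]
      · simp
      · rw [lt_div_iff₀ (by positivity)]
        have : R < |r| := by
          by_contra h
          exact hr (abs_le.mp (not_lt.mp h))
        have h2 : R ^ 2 < |r| ^ 2 := by gcongr
        rw [sq_abs] at h2
        nlinarith [pow_pos hR 2]
  rw [integral_Ioi_of_hasDerivAt_of_tendsto' hd hi ht]
  have hv : (volume : Measure Pl).real (ball 0 1) = π := by
    rw [Measure.real, EuclideanSpace.volume_ball_fin_two]; simp [Real.pi_pos.le]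
  rw [hv]
  have : th (0 ^ 2 / R ^ 2) = 1 := th_one (by norm_num)
  rw [this]; simp

/-- `f` is differentiable at `x` with `i`-th partial derivative `d` -/
def HP (f : Pl → ℝ) (i : Fin 2) (x : Pl) (d : ℝ) : Prop := DifferentiableAt ℝ f x ∧ pd f i x = d

lemma HP.add {f g : Pl → ℝ} {i : Fin 2} {x : Pl} {a b : ℝ} (hf : HP f i x a) (hg : HP g i x b) :
    HP (fun y => f y + g y) i x (a + b) :=
  ⟨hf.1.add hg.1, by rw [pd_add hf.1 hg.1, hf.2, hg.2]⟩
lemma HP.sub {f g : Pl → ℝ} {i : Fin 2} {x : Pl} {a b : ℝ} (hf : HP f i x a) (hg : HP g i x b) :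
    HP (fun y => f y - g y) i x (a - b) :=
  ⟨hf.1.sub hg.1, by rw [pd_sub hf.1 hg.1, hf.2, hg.2]⟩
lemma HP.mul {f g : Pl → ℝ} {i : Fin 2} {x : Pl} {a b : ℝ} (hf : HP f i x a) (hg : HP g i x b) :
    HP (fun y => f y * g y) i x (a * g x + f x * b) :=
  ⟨hf.1.mul hg.1, by rw [pd_mul hf.1 hg.1, hf.2, hg.2]⟩
lemma HP.cmul {f : Pl → ℝ} {i : Fin 2} {x : Pl} {a : ℝ} (c : ℝ) (hf : HP f i x a)  :
    HP (fun y => c * f y) i x (c * a) :=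
  ⟨hf.1.const_mul c, by rw [pd_const_mul c hf.1, hf.2]⟩
lemma Sm.HP {f : Pl → ℝ} {x : Pl} (h : Sm f x) (i : Fin 2) : HP f i x (_root_.pd f i x) := ⟨h.diff, rfl⟩
lemma HP_coord (j i : Fin 2) (x : Pl) : HP (fun y => y j) i x (if j = i then 1 else 0) :=
  ⟨(sm_coord j x).diff, pd_coord j i x⟩

/-- normalized potential -/
def GG (τ ν : ℝ) (v : Pl → ℝ) (y : Pl) : ℝ := Gs τ (SS ν v y) / (2 * (τ + 1))

lemma Gs_deriv {τ s : ℝ} (hτ : 0 < τ) (hs : 0 ≤ s) :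
    HasDerivAt (fun s => Gs τ s / (2 * (τ + 1))) (-((1 - s) / (1 + τ * s) ^ 3)) s := by
  have hp : 1 + τ * s ≠ 0 := by positivity
  have h1 : HasDerivAt (fun s : ℝ => (1 - s) ^ 2) (2 * (1 - s) * (-1)) s := by
    simpa using ((hasDerivAt_id' s).const_sub 1).fun_pow 2
  have h2 : HasDerivAt (fun s : ℝ => (1 + τ * s) ^ 2) (2 * (1 + τ * s) * τ) s := by
    simpa using (((hasDerivAt_id' s).const_mul τ).const_add 1).fun_pow 2
  have h3 := (h1.fun_div h2 (pow_ne_zero 2 hp)).div_const (2 * (τ + 1))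
  refine h3.congr_deriv ?_
  have : τ + 1 ≠ 0 := by positivity
  field_simp
  ring

lemma sm_Gs {τ s : ℝ} (hτ : 0 < τ) (h0 : 0 ≤ s) : ContDiffAt ℝ (⊤ : ℕ∞) (fun s => Gs τ s / (2 * (τ + 1))) s := by
  unfold Gs
  refine ContDiffAt.div_const (ContDiffAt.div (by fun_prop) (by fun_prop) (by positivity)) _

lemma sm_SS {ν : ℝ} {v : Pl → ℝ} {x : Pl} (hσ : ∀ y, Sm (sg ν) y) (hv : Sm v x) : Sm (SS ν v) x :=
  (hσ x).mul' hv.neg'.exp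

lemma sm_GG {τ ν : ℝ} {v : Pl → ℝ} {x : Pl} (hτ : 0 < τ) (hσ : ∀ y, Sm (sg ν) y) (hv : Sm v x) :
    Sm (GG τ ν v) x :=
  ContDiffAt.comp (g := fun s => Gs τ s / (2 * (τ + 1))) x (sm_Gs hτ (SS_nonneg ν v x)) (sm_SS hσ hv)

lemma GG_grad {τ ν : ℝ} {v : Pl → ℝ} {x : Pl} (hτ : 0 < τ) (hν : 0 ≤ ν) (hσ : ∀ y, Sm (sg ν) y) (hv : Sm v x) :
    x 0 * pd (GG τ ν v) 0 x + x 1 * pd (GG τ ν v) 1 x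
      = Ph τ (SS ν v x) * (x 0 * pd v 0 x + x 1 * pd v 1 x) - 2 * ν * Ph τ (SS ν v x) := by
  have hpS (i : Fin 2) : pd (SS ν v) i x = pd (sg ν) i x * exp (-(v x)) - SS ν v x * pd v i x := by
    have h1 : pd (fun y => exp (-(v y))) i x = exp (-(v x)) * (-(pd v i x)) := by
      rw [pd_comp (u := fun y => -(v y)) (Real.hasDerivAt_exp _) hv.neg'.diff]
      congr 1
      simpa using pd_const_mul (-1) hv.diff i
    have h2 := pd_mul (hσ x).diff (Sm.diff (hv.neg'.exp)) i
    have h3 : SS ν v = fun y => sg ν y * exp (-(v y)) := rfl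
    rw [h3, h2, h1]; ring
  have hpG (i : Fin 2) : pd (GG τ ν v) i x
      = -((1 - SS ν v x) / (1 + τ * SS ν v x) ^ 3) * pd (SS ν v) i x :=
    pd_comp (Gs_deriv hτ (SS_nonneg ν v x)) (sm_SS hσ hv).diff i
  rw [hpG, hpG, hpS, hpS]
  have hh := sg_homog ν hν x
  have hSx : SS ν v x = sg ν x * exp (-(v x)) := rfl
  have hP : Ph τ (SS ν v x) = SS ν v x * ((1 - SS ν v x) / (1 + τ * SS ν v x) ^ 3) := by unfold Ph; ring
  rw [hP]
  set A := (1 - SS ν v x) / (1 + τ * SS ν v x) ^ 3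
  have : x 0 * (-A * (pd (sg ν) 0 x * exp (-v x) - SS ν v x * pd v 0 x)) +
      x 1 * (-A * (pd (sg ν) 1 x * exp (-v x) - SS ν v x * pd v 1 x))
      = -A * exp (-v x) * (x 0 * pd (sg ν) 0 x + x 1 * pd (sg ν) 1 x)
        + A * SS ν v x * (x 0 * pd v 0 x + x 1 * pd v 1 x) := by ring
  rw [this, hh]
  have : -A * exp (-v x) * (2 * ν * sg ν x) = - (2 * ν * A) * SS ν v x := by rw [hSx]; ring
  rw [this]; ring

/-- Pohozaev vector field, first component -/
def Y0 (τ ν : ℝ) (v : Pl → ℝ) (y : Pl) : ℝ :=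
  (1 / 2) * (y 0 * (pd v 0 y * pd v 0 y - pd v 1 y * pd v 1 y)) + y 1 * (pd v 0 y * pd v 1 y)
    - (2 * ν) * pd v 0 y - y 0 * GG τ ν v y
/-- Pohozaev vector field, second component -/
def Y1 (τ ν : ℝ) (v : Pl → ℝ) (y : Pl) : ℝ :=
  (1 / 2) * (y 1 * (pd v 1 y * pd v 1 y - pd v 0 y * pd v 0 y)) + y 0 * (pd v 0 y * pd v 1 y)
    - (2 * ν) * pd v 1 y - y 1 * GG τ ν v y

lemma sm_Y0 {τ ν : ℝ} {v : Pl → ℝ} {x : Pl} (hτ : 0 < τ) (hσ : ∀ y, Sm (sg ν) y) (hv : Sm v x) :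
    Sm (Y0 τ ν v) x :=
  ((((sm_const _ x).mul' ((sm_coord 0 x).mul' (((hv.pd 0).mul' (hv.pd 0)).sub' ((hv.pd 1).mul' (hv.pd 1))))).add'
    ((sm_coord 1 x).mul' ((hv.pd 0).mul' (hv.pd 1)))).sub' ((sm_const _ x).mul' (hv.pd 0))).sub'
    ((sm_coord 0 x).mul' (sm_GG hτ hσ hv))

lemma sm_Y1 {τ ν : ℝ} {v : Pl → ℝ} {x : Pl} (hτ : 0 < τ) (hσ : ∀ y, Sm (sg ν) y) (hv : Sm v x) :
    Sm (Y1 τ ν v) x :=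
  ((((sm_const _ x).mul' ((sm_coord 1 x).mul' (((hv.pd 1).mul' (hv.pd 1)).sub' ((hv.pd 0).mul' (hv.pd 0))))).add'
    ((sm_coord 0 x).mul' ((hv.pd 0).mul' (hv.pd 1)))).sub' ((sm_const _ x).mul' (hv.pd 1))).sub'
    ((sm_coord 1 x).mul' (sm_GG hτ hσ hv))

lemma div_Y {τ ν : ℝ} {v : Pl → ℝ} {x : Pl} (hτ : 0 < τ) (hν : 0 ≤ ν) (hσ : ∀ y, Sm (sg ν) y) (hv : Sm v x)
    (he : lap v x = Ph τ (SS ν v x)) :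
    pd (Y0 τ ν v) 0 x + pd (Y1 τ ν v) 1 x = - 2 * GG τ ν v x := by
  have a (i : Fin 2) := (hv.pd 0).HP i
  have b (i : Fin 2) := (hv.pd 1).HP i
  have g (i : Fin 2) := (sm_GG hτ hσ hv).HP i
  have h0 := (((((HP_coord 0 0 x).mul (((a 0).mul (a 0)).sub ((b 0).mul (b 0)))).cmul (1/2)).add
    ((HP_coord 1 0 x).mul ((a 0).mul (b 0)))).sub ((a 0).cmul (2 * ν))).sub ((HP_coord 0 0 x).mul (g 0))
  have h1 := (((((HP_coord 1 1 x).mul (((b 1).mul (b 1)).sub ((a 1).mul (a 1)))).cmul (1/2)).add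
    ((HP_coord 0 1 x).mul ((a 1).mul (b 1)))).sub ((b 1).cmul (2 * ν))).sub ((HP_coord 1 1 x).mul (g 1))
  have e0 : pd (Y0 τ ν v) 0 x = _ := h0.2
  have e1 : pd (Y1 τ ν v) 1 x = _ := h1.2
  rw [e0, e1]
  have hc := pd_comm hv 0 1
  have hg := GG_grad hτ hν hσ hv
  simp only [if_true, one_ne_zero, zero_ne_one, if_false]
  rw [hc]
  unfold lap at he
  rw [← he] at hg
  linear_combination -hg

lemma integral_pd_zero {f : Pl → ℝ} (hf : ∀ y, Sm f y) (hc : HasCompactSupport f) (i : Fin 2) :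
    Integrable (pd f i) ∧ ∫ y, pd f i y = 0 := by
  have e : pd f i = fun y => fderiv ℝ f y (ee i) := funext fun y => pd_eq (hf y).diff i
  have hcd : ContDiff ℝ (⊤ : ℕ∞) f := contDiff_iff_contDiffAt.mpr hf
  have hi : Integrable (fun y => fderiv ℝ f y (ee i)) := by
    apply Continuous.integrable_of_hasCompactSupport
    · exact (hcd.continuous_fderiv (by simp)).clm_apply continuous_const
    · exact hc.fderiv_apply ℝ (ee i)
  refine ⟨e ▸ hi, ?_⟩
  rw [e]
  have := integral_mul_fderiv_eq_neg_fderiv_mul_of_integrable (μ := (volume : Measure Pl))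
    (f := f) (g := fun _ => (1:ℝ)) (v := ee i) (by simpa using hi) (by simp)
    (by simpa using hcd.continuous.integrable_of_hasCompactSupport hc)
    (fun x _ => (hf x).diff) (fun x _ => differentiableAt_const _)
  simpa using this

lemma sm_cut {R : ℝ} (hR : 0 < R) {f : Pl → ℝ} (hf : ∀ y, ‖y‖ < R → Sm f y) (y : Pl) :
    Sm (fun y => eta R y * f y) y := by
  by_cases hy : ‖y‖ < R
  · exact (sm_eta R y).mul' (hf y hy)
  · have h1 : ∀ᶠ z : Pl in 𝓝 y, R / 2 * √2 < ‖z‖ := by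
      apply (isOpen_lt continuous_const continuous_norm).mem_nhds
      have : √2 < 2 := by rw [Real.sqrt_lt' (by norm_num)]; norm_num
      show R / 2 * √2 < ‖y‖
      nlinarith
    have : (fun y => eta R y * f y) =ᶠ[𝓝 y] fun _ => 0 := by
      filter_upwards [h1] with z hz
      rw [eta_zero hR, zero_mul]
      have h2 : (R / 2 * √2) ^ 2 ≤ ‖z‖ ^ 2 := by gcongr
      rw [mul_pow, Real.sq_sqrt (by norm_num)] at h2
      linarith
    exact (sm_const 0 y).congr_of_eventuallyEq this

lemma cs_cut {R : ℝ} (hR : 0 < R) (f : Pl → ℝ) : HasCompactSupport (fun y => eta R y * f y) := by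
  apply HasCompactSupport.intro (isCompact_closedBall (0 : Pl) R)
  intro y hy
  have : R < ‖y‖ := by simpa using hy
  rw [eta_zero hR, zero_mul]
  nlinarith

lemma pd_hat {ν : ℝ} {v : Pl → ℝ} {y : Pl} (hv : Sm v y) (hy : y ≠ 0) (i : Fin 2) :
    pd (hat ν v) i y = pd v i y - 2 * ν * (y i / ‖y‖ ^ 2) := by
  unfold hat
  rw [pd_sub hv.diff ((sm_log hy).diff.const_mul _), pd_const_mul _ (sm_log hy).diff, pd_log hy]

lemma cut_int {R : ℝ} (hR : 0 < R) {f : Pl → ℝ} (hf : ∀ y, ‖y‖ < R → Sm f y) :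
    Integrable (fun y => eta R y * f y) :=
  (contDiff_iff_contDiffAt.mpr (sm_cut hR hf)).continuous.integrable_of_hasCompactSupport (cs_cut hR f)

lemma pohozaev : ∃ C : ℝ, 0 < C ∧ ∀ (τ ν R κ : ℝ) (v : Pl → ℝ), 0 < τ → 0 ≤ ν → 0 < R →
    (∀ y, Sm (sg ν) y) → Sol τ ν R v → 0 ≤ κ → κ ≤ 1 →
    (∀ y, R / 2 ≤ ‖y‖ → ‖y‖ < R → |hat ν v y| ≤ κ ∧ ∀ i, |pd (hat ν v) i y| ≤ κ) →
    |(∫ y, eta R y * Gs τ (SS ν v y)) - 4 * (τ + 1) * π * ν ^ 2| ≤ C * (τ + 1) * R ^ 2 * κ ^ 2 := by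
  obtain ⟨D, hD0, hD⟩ := th'_bound
  refine ⟨12 * π * D, by positivity, ?_⟩
  intro τ ν R κ v hτ hν hR hσ hS hκ hκ1 hb
  have hY0 := sm_cut hR (fun y hy => sm_Y0 (ν := ν) hτ hσ (hS.sm y hy))
  have hY1 := sm_cut hR (fun y hy => sm_Y1 (ν := ν) hτ hσ (hS.sm y hy))
  obtain ⟨i0, z0⟩ := integral_pd_zero hY0 (cs_cut hR _) 0
  obtain ⟨i1, z1⟩ := integral_pd_zero hY1 (cs_cut hR _) 1
  have iG := cut_int hR (fun y hy => sm_GG (τ := τ) (ν := ν) hτ hσ (hS.sm y hy))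
  -- the boundary term
  set Q : Pl → ℝ := fun y => (y 0 * pd (hat ν v) 0 y + y 1 * pd (hat ν v) 1 y) ^ 2
    - ‖y‖ ^ 2 * (pd (hat ν v) 0 y ^ 2 + pd (hat ν v) 1 y ^ 2) / 2 - ‖y‖ ^ 2 * GG τ ν v y with hQ
  set T : Pl → ℝ := fun y => deriv th (‖y‖ ^ 2 / R ^ 2) * (2 / R ^ 2) with hT
  have key : ∀ y, pd (fun y => eta R y * Y0 τ ν v y) 0 y + pd (fun y => eta R y * Y1 τ ν v y) 1 y
      + 2 * (eta R y * GG τ ν v y) + 2 * ν ^ 2 * T y = T y * Q y := by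
    intro y
    by_cases hy : ‖y‖ ^ 2 < R ^ 2
    · have hyR : ‖y‖ < R := lt_of_pow_lt_pow_left₀ 2 hR.le hy
      have hv := hS.sm y hyR
      rw [pd_mul (sm_eta R y).diff (sm_Y0 hτ hσ hv).diff, pd_mul (sm_eta R y).diff (sm_Y1 hτ hσ hv).diff,
        pd_eta, pd_eta]
      have hdv := div_Y hτ hν hσ hv (hS.eq y hyR)
      by_cases hy0 : y = 0
      · have : deriv th (‖y‖ ^ 2 / R ^ 2) = 0 := th'_zero_left (by rw [hy0]; simp)
        simp only [hT, this]
        linear_combination (eta R y) * hdv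
      · have hn : ‖y‖ ^ 2 ≠ 0 := by simpa using hy0
        have e0 := pd_hat (ν := ν) hv hy0 0
        have e1 := pd_hat (ν := ν) hv hy0 1
        have ns := norm_sq_eq y
        have main : y 0 * Y0 τ ν v y + y 1 * Y1 τ ν v y + 2 * ν ^ 2 = Q y := by
          simp only [hQ, e0, e1, Y0, Y1]
          rw [ns] at hn ⊢
          field_simp
          ring
        simp only [hT]
        linear_combination (eta R y) * hdv + deriv th (‖y‖ ^ 2 / R ^ 2) * (2 / R ^ 2) * main
    · have hy' : R ^ 2 ≤ ‖y‖ ^ 2 := not_lt.mp hy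
      have hev : ∀ (f : Pl → ℝ), (fun y => eta R y * f y) =ᶠ[𝓝 y] fun _ => 0 := by
        intro f
        have h1 : ∀ᶠ z : Pl in 𝓝 y, R ^ 2 / 2 < ‖z‖ ^ 2 := by
          apply (isOpen_lt continuous_const (continuous_norm.pow 2)).mem_nhds
          show R ^ 2 / 2 < ‖y‖ ^ 2
          nlinarith [pow_pos hR 2]
        filter_upwards [h1] with z hz
        rw [eta_zero hR hz.le, zero_mul]
      have : T y = 0 := by
        simp only [hT]
        rw [th'_zero_right, zero_mul]
        rw [lt_div_iff₀ (by positivity)]; nlinarith [pow_pos hR 2]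
      rw [pd_congr (hev _), pd_congr (hev _), pd_const, pd_const, eta_zero hR (by nlinarith [pow_pos hR 2]), this]
      ring
  have iT : Integrable T := by
    apply Continuous.integrable_of_hasCompactSupport
    · have := th'_cont
      simp only [hT]; fun_prop
    · apply HasCompactSupport.intro (isCompact_closedBall (0 : Pl) R)
      intro y hy
      have : R < ‖y‖ := by simpa using hy
      simp only [hT]
      rw [th'_zero_right, zero_mul]
      rw [lt_div_iff₀ (by positivity)]
      have : R ^ 2 < ‖y‖ ^ 2 := by gcongr
      nlinarith [pow_pos hR 2]
  have hIntg : ∫ y, T y * Q y = 2 * (∫ y, eta R y * GG τ ν v y) - 4 * π * ν ^ 2 := by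
    have h1 : ∫ y, T y * Q y = ∫ y, (pd (fun y => eta R y * Y0 τ ν v y) 0 y +
      pd (fun y => eta R y * Y1 τ ν v y) 1 y + 2 * (eta R y * GG τ ν v y) + 2 * ν ^ 2 * T y) :=
      integral_congr_ae (Eventually.of_forall fun y => (key y).symm)
    have hTi : ∫ y, T y = -(2 * π) := integral_th' hR
    have i2 : Integrable (fun y => pd (fun y => eta R y * Y0 τ ν v y) 0 y +
      pd (fun y => eta R y * Y1 τ ν v y) 1 y) := i0.add i1
    have i3 : Integrable (fun y => pd (fun y => eta R y * Y0 τ ν v y) 0 y +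
      pd (fun y => eta R y * Y1 τ ν v y) 1 y + 2 * (eta R y * GG τ ν v y)) := i2.add (iG.const_mul 2)
    rw [h1, integral_add i3 (iT.const_mul _),
      integral_add i2 (iG.const_mul 2), integral_add i0 i1, z0, z1, integral_const_mul,
      integral_const_mul, hTi]
    ring
  have hGG : ∫ y, eta R y * Gs τ (SS ν v y) = 2 * (τ + 1) * ∫ y, eta R y * GG τ ν v y := by
    rw [← integral_const_mul]
    congr 1; funext y
    have : τ + 1 ≠ 0 := by positivity
    unfold GG; field_simp
  have hbound : |∫ y, T y * Q y| ≤ 12 * π * D * R ^ 2 * κ ^ 2 := by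
    have hz : ∀ y ∉ ball (0 : Pl) R, T y * Q y = 0 := by
      intro y hy
      have hy2 : R ≤ ‖y‖ := by simpa using hy
      have : T y = 0 := by
        simp only [hT]
        rw [th'_zero_right, zero_mul]
        rw [lt_div_iff₀ (by positivity)]; nlinarith [pow_pos hR 2]
      rw [this, zero_mul]
    rw [← setIntegral_eq_integral_of_forall_compl_eq_zero hz]
    have hvol : (volume : Measure Pl).real (ball 0 R) = π * R ^ 2 := by
      rw [Measure.real, EuclideanSpace.volume_ball_fin_two]
      simp [Real.pi_pos.le, hR.le]; ring
    have hpt : ∀ y ∈ ball (0 : Pl) R, ‖T y * Q y‖ ≤ 12 * D * κ ^ 2 := by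
      intro y hy
      have hy2 : ‖y‖ < R := by simpa using hy
      have hysq : ‖y‖ ^ 2 ≤ R ^ 2 := by gcongr
      by_cases h4 : ‖y‖ ^ 2 / R ^ 2 < 1 / 4
      · simp only [hT, th'_zero_left h4]
        simp; positivity
      have h5 : (R / 2) ^ 2 ≤ ‖y‖ ^ 2 := by
        have := not_lt.mp h4
        rw [le_div_iff₀ (by positivity)] at this
        linarith
      have h6 : R / 2 ≤ ‖y‖ := le_of_sq_le_sq h5 (norm_nonneg _)
      obtain ⟨hb0, hb1⟩ := hb y h6 hy2
      have hy0 : y ≠ 0 := norm_pos_iff.mp (by linarith)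
      have hGb : GG τ ν v y ≤ 9 / 2 * κ ^ 2 := by
        unfold GG
        rw [SS_eq (Or.inl hy0), div_le_iff₀ (by positivity)]
        have h7 := Gs_quad (t := hat ν v y) hτ (hb0.trans hκ1)
        have h8 : hat ν v y ^ 2 ≤ κ ^ 2 := sq_le_sq.mpr (by rwa [abs_of_nonneg hκ])
        nlinarith [mul_nonneg hτ.le (sq_nonneg κ)]
      have hG0 : 0 ≤ GG τ ν v y := by unfold GG; have := Gs_nonneg (τ := τ) (s := SS ν v y); positivity
      have p0 : pd (hat ν v) 0 y ^ 2 ≤ κ ^ 2 := sq_le_sq.mpr (by rw [abs_of_nonneg hκ]; exact hb1 0)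
      have p1 : pd (hat ν v) 1 y ^ 2 ≤ κ ^ 2 := sq_le_sq.mpr (by rw [abs_of_nonneg hκ]; exact hb1 1)
      have hQb : |Q y| ≤ R ^ 2 * (6 * κ ^ 2) := by
        have cs : (y 0 * pd (hat ν v) 0 y + y 1 * pd (hat ν v) 1 y) ^ 2
            ≤ ‖y‖ ^ 2 * (pd (hat ν v) 0 y ^ 2 + pd (hat ν v) 1 y ^ 2) := by
          rw [norm_sq_eq]
          nlinarith [sq_nonneg (y 0 * pd (hat ν v) 1 y - y 1 * pd (hat ν v) 0 y)]
        have l1 : ‖y‖ ^ 2 * (pd (hat ν v) 0 y ^ 2 + pd (hat ν v) 1 y ^ 2) ≤ R ^ 2 * (2 * κ ^ 2) := by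
          apply mul_le_mul hysq (by linarith) (by positivity) (by positivity)
        have l2 : ‖y‖ ^ 2 * GG τ ν v y ≤ R ^ 2 * (9 / 2 * κ ^ 2) :=
          mul_le_mul hysq hGb hG0 (by positivity)
        have l3 : 0 ≤ ‖y‖ ^ 2 * GG τ ν v y := by positivity
        have l4 := sq_nonneg (y 0 * pd (hat ν v) 0 y + y 1 * pd (hat ν v) 1 y)
        have l5 : 0 ≤ R ^ 2 * κ ^ 2 := by positivity
        simp only [hQ]
        rw [abs_le]; constructor <;> nlinarith
      rw [Real.norm_eq_abs, abs_mul]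
      have hTb : |T y| ≤ D * (2 / R ^ 2) := by
        simp only [hT]
        rw [abs_mul, abs_of_pos (by positivity : 0 < 2 / R ^ 2)]
        gcongr; exact hD _
      calc |T y| * |Q y| ≤ (D * (2 / R ^ 2)) * (R ^ 2 * (6 * κ ^ 2)) :=
            mul_le_mul hTb hQb (abs_nonneg _) (by positivity)
        _ = 12 * D * κ ^ 2 := by field_simp; ring
    have := norm_setIntegral_le_of_norm_le_const (μ := (volume : Measure Pl)) measure_ball_lt_top hpt
    rw [hvol, Real.norm_eq_abs] at this
    refine this.trans (le_of_eq ?_)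
    ring
  rw [hGG]
  have : 2 * (τ + 1) * (∫ y, eta R y * GG τ ν v y) - 4 * (τ + 1) * π * ν ^ 2
      = (τ + 1) * ∫ y, T y * Q y := by rw [hIntg]; ring
  rw [this, abs_mul, abs_of_pos (by positivity : 0 < τ + 1)]
  nlinarith

lemma vec_eq (w : Pl) : w = w 0 • ee 0 + w 1 • ee 1 := by
  ext j; fin_cases j <;> simp

lemma coord_le (w : Pl) (j : Fin 2) : |w j| ≤ ‖w‖ := by
  have := PiLp.norm_apply_le w j
  simpa using this

lemma fderiv_norm_le {u : Pl → ℝ} {x : Pl} {K : ℝ} (hu : Sm u x) (hK : ∀ i, |pd u i x| ≤ K) :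
    ‖fderiv ℝ u x‖ ≤ 2 * K := by
  have hK0 : 0 ≤ K := (abs_nonneg _).trans (hK 0)
  refine ContinuousLinearMap.opNorm_le_bound _ (by positivity) fun w => ?_
  have e : fderiv ℝ u x w = w 0 * pd u 0 x + w 1 * pd u 1 x := by
    conv_lhs => rw [vec_eq w]
    rw [map_add, map_smul, map_smul, pd_eq hu.diff, pd_eq hu.diff]; simp
  rw [e, Real.norm_eq_abs]
  calc |w 0 * pd u 0 x + w 1 * pd u 1 x| ≤ |w 0| * |pd u 0 x| + |w 1| * |pd u 1 x| := by
        rw [← abs_mul, ← abs_mul]; exact abs_add_le _ _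
    _ ≤ ‖w‖ * K + ‖w‖ * K := by
        gcongr
        · exact coord_le w 0
        · exact hK 0
        · exact coord_le w 1
        · exact hK 1
    _ = 2 * K * ‖w‖ := by ring

lemma lip_ball {u : Pl → ℝ} {c : Pl} {r K : ℝ} (hu : ∀ z, ‖z - c‖ ≤ r → Sm u z)
    (hK : ∀ z, ‖z - c‖ ≤ r → ∀ i, |pd u i z| ≤ K) {x y : Pl} (hx : ‖x - c‖ ≤ r) (hy : ‖y - c‖ ≤ r) :
    |u y - u x| ≤ 2 * K * ‖y - x‖ := by
  have := (convex_closedBall c r).norm_image_sub_le_of_norm_fderiv_le (𝕜 := ℝ) (f := u) (C := 2 * K)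
    (fun z hz => (hu z (by simpa [dist_eq_norm] using hz)).diff)
    (fun z hz => fderiv_norm_le (hu z (by simpa [dist_eq_norm] using hz))
      (hK z (by simpa [dist_eq_norm] using hz)))
    (x := x) (y := y) (by simpa [dist_eq_norm] using hx) (by simpa [dist_eq_norm] using hy)
  simpa using this

/-- the outer smallness -/
def Far (ν R δ : ℝ) (v : Pl → ℝ) : Prop := ∀ y, R / 4 ≤ ‖y‖ → ‖y‖ < R → |hat ν v y| ≤ δ

lemma hat_sm {τ ν R : ℝ} {v : Pl → ℝ} (hS : Sol τ ν R v) {y : Pl} (h0 : 0 < ‖y‖) (h : ‖y‖ < R) :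
    Sm (hat ν v) y := sm_hat (hS.sm y h) (Or.inl (norm_pos_iff.mp h0))

lemma hat_eq {τ ν R : ℝ} {v : Pl → ℝ} (hS : Sol τ ν R v) {y : Pl} (h0 : 0 < ‖y‖) (h : ‖y‖ < R) :
    lap (hat ν v) y = Ph τ (exp (-(hat ν v y))) := by
  have h1 : y ≠ 0 ∨ ν = 0 := Or.inl (norm_pos_iff.mp h0)
  rw [lap_hat (hS.sm y h) h1, hS.eq y h, SS_eq h1]

lemma norm_tri (z x : Pl) : ‖x‖ - ‖z - x‖ ≤ ‖z‖ ∧ ‖z‖ ≤ ‖x‖ + ‖z - x‖ := by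
  have h1 := norm_sub_norm_le x z
  have h2 := norm_sub_norm_le z x
  rw [norm_sub_rev] at h1
  constructor <;> linarith

lemma far_decay {τ ν R δ : ℝ} {v : Pl → ℝ} (hτ : 0 < τ) (hS : Sol τ ν R v) (hR : 32 ≤ R)
    (hδ : 0 < δ) (hδ1 : δ ≤ 1) (hF : Far ν R δ v) {x : Pl} (h1 : 3 * R / 8 ≤ ‖x‖) (h2 : ‖x‖ < 3 * R / 4) :
    |hat ν v x| ≤ 8192 / c0 τ * δ / R ^ 2 ∧ ∀ i, |pd (hat ν v) i x| ≤ 8192 / c0 τ * δ / R ^ 2 := by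
  have hc := c0_pos hτ
  have hz : ∀ z : Pl, ‖z - x‖ ≤ R / 8 → R / 4 ≤ ‖z‖ ∧ ‖z‖ < R := by
    intro z hz
    have := norm_tri z x
    constructor <;> linarith [this.1, this.2]
  have s1 : ∀ z : Pl, ‖z - x‖ ≤ R / 8 → Sm (hat ν v) z := fun z h =>
    hat_sm hS (by linarith [(hz z h).1]) (hz z h).2
  have s2 : ∀ z : Pl, ‖z - x‖ ≤ R / 8 → lap (hat ν v) z = Ph τ (exp (-(hat ν v z))) := fun z h =>
    hat_eq hS (by linarith [(hz z h).1]) (hz z h).2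
  have s3 : ∀ z : Pl, ‖z - x‖ ≤ R / 8 → |hat ν v z| ≤ δ := fun z h => hF z (hz z h).1 (hz z h).2
  have e : 128 / c0 τ * δ / (R / 8) ^ 2 = 8192 / c0 τ * δ / R ^ 2 := by field_simp; ring
  constructor
  · have := decay hτ (by linarith) hδ hδ1 s1 s2 s3
    rw [← e]
    refine this.trans ?_
    gcongr; norm_num
  · intro i
    rw [← e]
    exact decay_grad hτ (by linarith) hδ hδ1 s1 s2 s3 i

lemma energy {τ ν : ℝ} (hτ : 0 < τ) (hν : 0 ≤ ν) (hσ : ∀ y, Sm (sg ν) y) :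
    ∃ R1 C1 : ℝ, 32 ≤ R1 ∧ 0 < C1 ∧ ∀ R v, R1 ≤ R → Sol τ ν R v → Far ν R 1 v →
      |(∫ y, eta (3 * R / 4) y * Gs τ (SS ν v y)) - 4 * (τ + 1) * π * ν ^ 2| ≤ C1 / R ^ 2 := by
  obtain ⟨C, hC, hP⟩ := pohozaev
  have hc := c0_pos hτ
  set q := 8192 / c0 τ with hq
  have hq0 : 0 < q := by positivity
  refine ⟨max 32 (q + 1), C * (τ + 1) * q ^ 2, le_max_left _ _, by positivity, ?_⟩
  intro R v hR hS hF
  have hR32 : 32 ≤ R := (le_max_left _ _).trans hR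
  have hRq : q + 1 ≤ R := (le_max_right _ _).trans hR
  have hR0 : 0 < R := by linarith
  have hκ1 : q * 1 / R ^ 2 ≤ 1 := by rw [div_le_one (by positivity)]; nlinarith
  have hS' : Sol τ ν (3 * R / 4) v := ⟨fun y hy => hS.sm y (by linarith), fun y hy => hS.eq y (by linarith)⟩
  have := hP τ ν (3 * R / 4) (q * 1 / R ^ 2) v hτ hν (by positivity) hσ hS' (by positivity) hκ1
    (fun y h1 h2 => far_decay hτ hS hR32 one_pos le_rfl hF (by linarith) h2)
  refine this.trans ?_
  have e : C * (τ + 1) * (3 * R / 4) ^ 2 * (q * 1 / R ^ 2) ^ 2 = (9 / 16) * (C * (τ + 1) * q ^ 2 / R ^ 2) := by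
    field_simp; ring
  rw [e]
  have : 0 < C * (τ + 1) * q ^ 2 / R ^ 2 := by positivity
  linarith

lemma far_lower {τ ν R δ : ℝ} {v : Pl → ℝ} (hτ : 0 < τ) (hν : 0 ≤ ν) (hS : Sol τ ν R v) (hR : 0 < R)
    (hδ : 0 ≤ δ) (hF : Far ν R δ v) {y : Pl} (h0 : 0 < ‖y‖) (h : ‖y‖ < R) : -δ ≤ hat ν v y := by
  by_cases h1 : R / 4 ≤ ‖y‖
  · exact (abs_le.mp (hF y h1 h)).1
  have := comp_lower (r := R / 4) (B := δ) hτ hν hS (by linarith) hδ ?_ y (by linarith)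
  · rw [SS_eq (Or.inl (norm_pos_iff.mp h0)), Real.exp_le_exp] at this
    linarith
  · intro z hz
    rw [SS_eq (Or.inl (norm_pos_iff.mp (by rw [hz]; linarith))), Real.exp_le_exp]
    linarith [(abs_le.mp (hF z hz.ge (by linarith))).1]

lemma far_upper {τ ν R δ B r : ℝ} {v : Pl → ℝ} (hτ : 0 < τ) (hS : Sol τ ν R v) (hR : 0 < R) (hr : 0 < r)
    (hδ : 0 ≤ δ) (hF : Far ν R δ v) (hB : δ ≤ B) (hb : ∀ y, ‖y‖ = r → hat ν v y ≤ B)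
     {y : Pl} (h0 : r ≤ ‖y‖) (h : ‖y‖ < R) : hat ν v y ≤ B := by
  by_cases h1 : R / 4 ≤ ‖y‖
  · exact ((abs_le.mp (hF y h1 h)).2).trans hB
  refine comp_annulus (r' := R / 4) (B := B) hτ hS hr (by linarith) (hδ.trans hB) hb ?_ y h0 (by linarith)
  intro z hz
  exact ((abs_le.mp (hF z hz.ge (by linarith))).2).trans hB

lemma exists_max_sphere {f : Pl → ℝ} {r : ℝ} (hr : 0 ≤ r) (hf : ∀ y, ‖y‖ = r → ContinuousAt f y) :
    ∃ x : Pl, ‖x‖ = r ∧ ∀ y, ‖y‖ = r → f y ≤ f x := by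
  obtain ⟨x, hx, hm⟩ := (isCompact_sphere (0 : Pl) r).exists_isMaxOn
    (by exact ⟨r • ee 0, by simp [norm_smul, abs_of_nonneg hr]⟩)
    (f := f) (fun y hy => (hf y (by simpa using hy)).continuousWithinAt)
  exact ⟨x, by simpa using hx, fun y hy => hm (show y ∈ sphere 0 r by simpa using hy)⟩

lemma unif_bound {τ ν : ℝ} (hτ : 0 < τ) (hν : 0 ≤ ν) (hσ : ∀ y, Sm (sg ν) y) :
    ∃ R2 M : ℝ, 32 ≤ R2 ∧ 1 ≤ M ∧ ∀ R v, R2 ≤ R → Sol τ ν R v → Far ν R 1 v →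
      ∀ y, ‖y‖ = 1 → hat ν v y ≤ M := by
  obtain ⟨R1, C1, hR1, hC1, hE⟩ := energy hτ hν hσ
  set g := Gs τ (exp (-1)) with hg
  have hg0 : 0 < g := Gs_pos hτ (exp_pos _).le (by rw [Real.exp_lt_one_iff]; norm_num)
  set A := 4 * (τ + 1) * π * ν ^ 2 + C1 with hA
  have hA0 : 0 < A := by positivity
  set ρ := 64 * (A / g + 1) with hρ
  have hAg : 0 < A / g := by positivity
  have hρ1 : 64 ≤ ρ := by rw [hρ]; linarith
  have hρA : A < π * (ρ / 64) ^ 2 * g := by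
    have e1 : ρ / 64 = A / g + 1 := by rw [hρ]; ring
    rw [e1]
    have e2 : A / g * g = A := by field_simp
    have h3 := Real.pi_gt_three
    have h4 : A / g ≤ (A / g + 1) ^ 2 := by nlinarith
    have h5 : 0 < (A / g + 1) ^ 2 * g := by positivity
    nlinarith
  set L := 2 * ν * Real.log (1 + ρ) with hL
  have hL0 : 0 ≤ L := by
    have : 0 ≤ Real.log (1 + ρ) := Real.log_nonneg (by linarith)
    positivity
  have hC0 := C0_pos hτ
  set M := 4 * (1 + L + (C0 τ + 1) * ρ ^ 2) with hM
  have hM1 : 1 ≤ M := by have : 0 ≤ (C0 τ + 1) * ρ ^ 2 := by positivity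
                         rw [hM]; linarith
  refine ⟨max R1 (8 * ρ), M, hR1.trans (le_max_left _ _), hM1, ?_⟩
  intro R v hR hS hF
  have hRR1 : R1 ≤ R := (le_max_left _ _).trans hR
  have hRρ : 8 * ρ ≤ R := (le_max_right _ _).trans hR
  have hR0 : 0 < R := by linarith
  obtain ⟨x1, hx1, hmax⟩ := exists_max_sphere (f := hat ν v) (r := 1) zero_le_one
    (fun y hy => (hat_sm hS (by rw [hy]; norm_num) (by linarith)).continuousAt)
  set m := hat ν v x1 with hm
  intro y hy
  refine (hmax y hy).trans ?_
  by_contra hgt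
  push Not at hgt
  have hm1 : 1 ≤ m := by linarith
  -- a point on the larger circle
  obtain ⟨x0, hx0, hmax0⟩ := exists_max_sphere (f := hat ν v) (r := 1 + ρ) (by linarith)
    (fun y hy => (hat_sm hS (by rw [hy]; linarith) (by linarith)).continuousAt)
  have hx0m : m - L ≤ hat ν v x0 := by
    have h1 := comp_upper (r := 1 + ρ) (M := max 0 (hat ν v x0)) hτ hν hS (by linarith) (by linarith)
      (le_max_left _ _) (fun y hy => (hmax0 y hy).trans (le_max_right _ _)) x1 (by linarith)
    have h2 : v x1 = m := by rw [hm]; unfold hat; rw [hx1]; simp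
    rw [h2, ← hL] at h1
    rcases le_total (hat ν v x0) 0 with h3 | h3
    · rw [max_eq_left h3] at h1
      exfalso
      have : 0 ≤ (C0 τ + 1) * ρ ^ 2 := by positivity
      rw [hM] at hgt
      linarith
    · rw [max_eq_right h3] at h1; linarith
  have hab : ∀ z : Pl, 1 ≤ ‖z‖ → ‖z‖ < R → |hat ν v z| ≤ m := by
    intro z h1 h2
    rw [abs_le]
    have a1 := far_lower hτ hν hS hR0 zero_le_one hF (y := z) (by linarith) h2
    have a2 := far_upper hτ hS hR0 one_pos zero_le_one hF hm1 hmax h1 h2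
    constructor <;> linarith
  have hgr : ∀ z : Pl, ‖z - x0‖ ≤ ρ / 64 → ∀ i, |pd (hat ν v) i z| ≤ 2 * m / (ρ / 4) + (C0 τ + 1) * (ρ / 4) / 2 := by
    intro z hz i
    have hin : ∀ w : Pl, ‖w - z‖ ≤ 2 * (ρ / 4) → 1 ≤ ‖w‖ ∧ ‖w‖ < R := by
      intro w hw
      have t1 := norm_tri w z
      have t2 := norm_tri z x0
      constructor <;> linarith [t1.1, t1.2, t2.1, t2.2]
    refine pd_bound (by positivity) i (fun w hw => hat_sm hS (by linarith [(hin w hw).1]) (hin w hw).2)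
      (fun w hw => hab w (hin w hw).1 (hin w hw).2) (fun w hw => ?_)
    rw [hat_eq hS (by linarith [(hin w hw).1]) (hin w hw).2]
    linarith [Ph_bound hτ (exp_pos (-(hat ν v w))).le]
  have hin0 : ∀ z : Pl, ‖z - x0‖ ≤ ρ / 64 → 1 ≤ ‖z‖ ∧ ‖z‖ ≤ 3 * R / 4 / 2 := by
    intro z hz
    have t2 := norm_tri z x0
    constructor <;> linarith [t2.1, t2.2]
  have hbig : ∀ z : Pl, ‖z - x0‖ ≤ ρ / 64 → 1 ≤ hat ν v z := by
    intro z hz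
    have h1 := lip_ball (fun w hw => hat_sm hS (by linarith [(hin0 w hw).1]) (by linarith [(hin0 w hw).2]))
      hgr (x := x0) (y := z) (by simp; linarith) hz
    have h2 : 2 * (2 * m / (ρ / 4) + (C0 τ + 1) * (ρ / 4) / 2) * ‖z - x0‖
        ≤ 2 * (2 * m / (ρ / 4) + (C0 τ + 1) * (ρ / 4) / 2) * (ρ / 64) := by gcongr
    have h3 : 2 * (2 * m / (ρ / 4) + (C0 τ + 1) * (ρ / 4) / 2) * (ρ / 64)
        = m / 4 + (C0 τ + 1) * ρ ^ 2 / 256 := by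
      field_simp; ring
    have h4 := (abs_le.mp (h1.trans (h2.trans h3.le))).1
    have : 0 ≤ (C0 τ + 1) * ρ ^ 2 := by positivity
    rw [hM] at hgt
    linarith
  have hIntg : Integrable (fun y => eta (3 * R / 4) y * Gs τ (SS ν v y)) := by
    have := (cut_int (R := 3 * R / 4) (by positivity) (fun y hy => sm_GG (τ := τ) (ν := ν) hτ hσ
      (hS.sm y (by linarith)))).const_mul (2 * (τ + 1))
    refine this.congr (Eventually.of_forall fun y => ?_)
    have : τ + 1 ≠ 0 := by positivity
    simp only [GG]; field_simp
  have hle : ∫ y, eta (3 * R / 4) y * Gs τ (SS ν v y) ≤ A := by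
    have h1 := hE R v hRR1 hS hF
    have h2 : C1 / R ^ 2 ≤ C1 := div_le_self hC1.le (by nlinarith)
    have := (abs_le.mp h1).2
    rw [hA]; linarith
  have hge : π * (ρ / 64) ^ 2 * g ≤ ∫ y, eta (3 * R / 4) y * Gs τ (SS ν v y) := by
    have h0 : ∀ y, 0 ≤ eta (3 * R / 4) y * Gs τ (SS ν v y) := fun y => mul_nonneg (eta_nonneg _ _) Gs_nonneg
    refine le_trans ?_ (setIntegral_le_integral (s := ball x0 (ρ / 64)) hIntg (Eventually.of_forall h0))
    have hvol : (volume : Measure Pl).real (ball x0 (ρ / 64)) = π * (ρ / 64) ^ 2 := by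
      rw [Measure.real, EuclideanSpace.volume_ball_fin_two, ENNReal.toReal_mul, ENNReal.toReal_pow,
        ENNReal.toReal_ofReal (by positivity), mul_comm,
        ENNReal.toReal_ofReal Real.pi_pos.le]
    have h5 := setIntegral_mono_on (μ := (volume : Measure Pl)) (s := ball x0 (ρ / 64)) (f := fun _ => g)
      (g := fun y => eta (3 * R / 4) y * Gs τ (SS ν v y))
      (integrableOn_const (by exact measure_ball_lt_top.ne)) hIntg.integrableOn measurableSet_ball ?_
    · rw [setIntegral_const, hvol] at h5
      simpa using h5
    · intro z hz
      have hz' : ‖z - x0‖ ≤ ρ / 64 := by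
        have := mem_ball.mp hz; rw [dist_eq_norm] at this; exact this.le
      have hz0 := (hin0 z hz').1
      rw [eta_one (by positivity) (hin0 z hz').2, one_mul, SS_eq (Or.inl (norm_pos_iff.mp (by linarith)))]
      refine Gs_anti hτ (exp_pos _).le ?_ ?_
      · rw [Real.exp_le_exp]; linarith [hbig z hz']
      · rw [Real.exp_le_one_iff]; norm_num
  linarith

lemma local_bound {τ ν : ℝ} (hτ : 0 < τ) (hν : 0 ≤ ν) (hσ : ∀ y, Sm (sg ν) y) :
    ∃ R2 M : ℝ, 32 ≤ R2 ∧ 1 ≤ M ∧ (∀ R v, R2 ≤ R → Sol τ ν R v → Far ν R 1 v →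
      ∀ y, 1 ≤ ‖y‖ → ‖y‖ < R → |hat ν v y| ≤ M) ∧ ∀ r, 1 ≤ r → ∃ B, 0 < B ∧
      ∀ R v, R2 ≤ R → r < R → Sol τ ν R v → Far ν R 1 v → ∀ y, ‖y‖ ≤ r → |v y| ≤ B := by
  obtain ⟨R2, M, hR2, hM, h⟩ := unif_bound hτ hν hσ
  have h1 : ∀ R v, R2 ≤ R → Sol τ ν R v → Far ν R 1 v → ∀ y, 1 ≤ ‖y‖ → ‖y‖ < R → |hat ν v y| ≤ M := by
    intro R v hR hS hF y hy1 hyR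
    have a1 := far_lower hτ hν hS (by linarith) zero_le_one hF (y := y) (by linarith) hyR
    have a2 := far_upper hτ hS (by linarith) one_pos zero_le_one hF hM (h R v hR hS hF) hy1 hyR
    rw [abs_le]; constructor <;> linarith
  refine ⟨R2, M, hR2, hM, h1, fun r hr => ?_⟩
  have hlr : 0 ≤ Real.log r := Real.log_nonneg hr
  have hC0 := C0_pos hτ
  refine ⟨M + 2 * ν * Real.log r + C0 τ * r ^ 2, by positivity, ?_⟩
  intro R v hR hrR hS hF y hy
  have a1 := comp_upper (r := r) (M := M) hτ hν hS (by linarith) hrR (by linarith)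
    (fun z hz => (abs_le.mp (h1 R v hR hS hF z (by linarith) (by linarith))).2) y hy
  have a2 := comp_vlower (r := r) (m := -M + 2 * ν * Real.log r) hτ hS hrR (fun z hz => by
    have := (abs_le.mp (h1 R v hR hS hF z (by linarith) (by linarith))).1
    unfold hat at this; rw [hz] at this; linarith) y hy
  have : 0 ≤ 2 * ν * Real.log r := by positivity
  have : 0 ≤ C0 τ * r ^ 2 := by positivity
  rw [abs_le]; constructor <;> linarith

/-- eventually smooth on every ball -/
def ES (a : ℕ → Pl → ℝ) : Prop := ∀ r : ℝ, ∀ᶠ n in atTop, ∀ y : Pl, ‖y‖ < r → Sm (a n) y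
/-- locally uniformly Cauchy -/
def Cv (a : ℕ → Pl → ℝ) : Prop := ∀ r : ℝ, ∀ e : ℝ, 0 < e → ∃ N : ℕ, ∀ m, N ≤ m → ∀ n, N ≤ n →
  ∀ y : Pl, ‖y‖ < r → |a m y - a n y| ≤ e
/-- eventually equal on every ball -/
def EqE (a b : ℕ → Pl → ℝ) : Prop := ∀ r : ℝ, ∀ᶠ n in atTop, ∀ y : Pl, ‖y‖ < r → a n y = b n y
/-- Cauchy with derivatives up to order k -/
def CC : ℕ → (ℕ → Pl → ℝ) → Prop
  | 0, a => ES a ∧ Cv a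
  | k + 1, a => (ES a ∧ Cv a) ∧ ∀ i, CC k (fun n => pd (a n) i)

lemma nhds_ball {y : Pl} {r : ℝ} (h : ‖y‖ < r) : ∀ᶠ z in 𝓝 y, ‖z‖ < r := (ob_open r).mem_nhds h

lemma CC.base {k : ℕ} {a : ℕ → Pl → ℝ} (h : CC k a) : ES a ∧ Cv a := by
  cases k with
  | zero => exact h
  | succ k => exact h.1

lemma CC.mono {k : ℕ} : ∀ {a : ℕ → Pl → ℝ}, CC (k + 1) a → CC k a := by
  induction k with
  | zero => intro a h; exact h.1
  | succ k ih => intro a h; exact ⟨h.1, fun i => ih (h.2 i)⟩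

lemma EqE.pd {a b : ℕ → Pl → ℝ} (h : EqE a b) (i : Fin 2) :
    EqE (fun n => pd (a n) i) (fun n => pd (b n) i) := by
  intro r
  filter_upwards [h r] with n hn y hy
  exact pd_congr (by filter_upwards [nhds_ball hy] with z hz using hn z hz) i

lemma CC.congr {k : ℕ} : ∀ {a b : ℕ → Pl → ℝ}, CC k a → EqE a b → CC k b := by
  have base : ∀ {a b : ℕ → Pl → ℝ}, ES a ∧ Cv a → EqE a b → ES b ∧ Cv b := by
    intro a b h he
    constructor
    · intro r
      filter_upwards [h.1 r, he r] with n h1 h2 y hy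
      refine (h1 y hy).congr_of_eventuallyEq ?_
      filter_upwards [nhds_ball hy] with z hz using (h2 z hz).symm
    · intro r e hpos
      obtain ⟨N, hN⟩ := h.2 r e hpos
      obtain ⟨N', hN'⟩ := eventually_atTop.mp (he r)
      refine ⟨max N N', fun m hm n hn y hy => ?_⟩
      rw [← hN' m ((le_max_right _ _).trans hm) y hy, ← hN' n ((le_max_right _ _).trans hn) y hy]
      exact hN m ((le_max_left _ _).trans hm) n ((le_max_left _ _).trans hn) y hy
  induction k with
  | zero => intro a b h he; exact base h he
  | succ k ih => intro a b h he; exact ⟨base h.1 he, fun i => ih (h.2 i) (he.pd i)⟩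

lemma CC.bdd {k : ℕ} {a : ℕ → Pl → ℝ} (h : CC k a) (r : ℝ) :
    ∃ B : ℝ, 0 < B ∧ ∀ᶠ n in atTop, ∀ y : Pl, ‖y‖ < r → |a n y| ≤ B := by
  obtain ⟨h1, h2⟩ := h.base
  obtain ⟨N, hN⟩ := h2 r 1 one_pos
  obtain ⟨N', hN'⟩ := eventually_atTop.mp (h1 (r + 1))
  set M := max N N'
  have hc : ContinuousOn (a M) {y : Pl | ‖y‖ ≤ r} := sm_continuousOn fun y hy =>
    hN' M (le_max_right _ _) y (by have : ‖y‖ ≤ r := hy; linarith)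
  obtain ⟨B, hB⟩ := (cb_compact r).exists_bound_of_continuousOn hc
  refine ⟨|B| + 1, by positivity, eventually_atTop.mpr ⟨M, fun n hn y hy => ?_⟩⟩
  have b1 := hN n ((le_max_left _ _).trans hn) M (le_max_left _ _) y hy
  have b2 := hB y hy.le
  rw [Real.norm_eq_abs] at b2
  have : |a n y| ≤ |a n y - a M y| + |a M y| := by
    have := abs_add_le (a n y - a M y) (a M y); simpa using this
  linarith [le_abs_self B]

lemma CC.add {k : ℕ} : ∀ {a b : ℕ → Pl → ℝ}, CC k a → CC k b → CC k (fun n y => a n y + b n y) := by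
  have base : ∀ {a b : ℕ → Pl → ℝ}, ES a ∧ Cv a → ES b ∧ Cv b →
      ES (fun n y => a n y + b n y) ∧ Cv (fun n y => a n y + b n y) := by
    intro a b ha hb
    constructor
    · intro r
      filter_upwards [ha.1 r, hb.1 r] with n h1 h2 y hy using (h1 y hy).add' (h2 y hy)
    · intro r e he
      obtain ⟨N, hN⟩ := ha.2 r (e / 2) (by positivity)
      obtain ⟨N', hN'⟩ := hb.2 r (e / 2) (by positivity)
      refine ⟨max N N', fun m hm n hn y hy => ?_⟩
      have h1 := hN m ((le_max_left _ _).trans hm) n ((le_max_left _ _).trans hn) y hy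
      have h2 := hN' m ((le_max_right _ _).trans hm) n ((le_max_right _ _).trans hn) y hy
      rw [abs_le] at *
      constructor <;> linarith [h1.1, h1.2, h2.1, h2.2]
  induction k with
  | zero => intro a b ha hb; exact base ha hb
  | succ k ih =>
    intro a b ha hb
    refine ⟨base ha.1 hb.1, fun i => (ih (ha.2 i) (hb.2 i)).congr ?_⟩
    intro r
    filter_upwards [ha.1.1 r, hb.1.1 r] with n h1 h2 y hy
    exact (pd_add (h1 y hy).diff (h2 y hy).diff i).symm

lemma CC.mul {k : ℕ} : ∀ {a b : ℕ → Pl → ℝ}, CC k a → CC k b → CC k (fun n y => a n y * b n y) := by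
  have base : ∀ {a b : ℕ → Pl → ℝ}, ES a ∧ Cv a → ES b ∧ Cv b →
      ES (fun n y => a n y * b n y) ∧ Cv (fun n y => a n y * b n y) := by
    intro a b ha hb
    constructor
    · intro r
      filter_upwards [ha.1 r, hb.1 r] with n h1 h2 y hy using (h1 y hy).mul' (h2 y hy)
    · intro r e he
      obtain ⟨A, hA, hA'⟩ := CC.bdd (k := 0) ha r
      obtain ⟨B, hB, hB'⟩ := CC.bdd (k := 0) hb r
      obtain ⟨NA, hA'⟩ := eventually_atTop.mp hA'
      obtain ⟨NB, hB'⟩ := eventually_atTop.mp hB'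
      obtain ⟨N, hN⟩ := ha.2 r (e / (2 * B)) (by positivity)
      obtain ⟨N', hN'⟩ := hb.2 r (e / (2 * A)) (by positivity)
      refine ⟨max (max N N') (max NA NB), fun m hm n hn y hy => ?_⟩
      simp only [max_le_iff] at hm hn
      have h1 := hN m hm.1.1 n hn.1.1 y hy
      have h2 := hN' m hm.1.2 n hn.1.2 y hy
      have h3 := hA' n hn.2.1 y hy
      have h4 := hB' m hm.2.2 y hy
      calc |a m y * b m y - a n y * b n y|
          = |(a m y - a n y) * b m y + a n y * (b m y - b n y)| := by congr 1; ring
        _ ≤ |a m y - a n y| * |b m y| + |a n y| * |b m y - b n y| := by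
            rw [← abs_mul, ← abs_mul]; exact abs_add_le _ _
        _ ≤ e / (2 * B) * B + A * (e / (2 * A)) := by gcongr
        _ = e := by field_simp; ring
  induction k with
  | zero => intro a b ha hb; exact base ha hb
  | succ k ih =>
    intro a b ha hb
    refine ⟨base ha.1 hb.1, fun i => (CC.add (ih (ha.2 i) hb.mono) (ih ha.mono (hb.2 i))).congr ?_⟩
    intro r
    filter_upwards [ha.1.1 r, hb.1.1 r] with n h1 h2 y hy
    exact (pd_mul (h1 y hy).diff (h2 y hy).diff i).symm

lemma CC.const {k : ℕ} : ∀ {f : Pl → ℝ}, (∀ y, Sm f y) → CC k (fun _ => f) := by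
  have base : ∀ {f : Pl → ℝ}, (∀ y, Sm f y) → ES (fun _ => f) ∧ Cv (fun _ => f) := by
    intro f hf
    exact ⟨fun r => Eventually.of_forall fun n y _ => hf y, fun r e he => ⟨0, fun m _ n _ y _ => by simpa using he.le⟩⟩
  induction k with
  | zero => intro f hf; exact base hf
  | succ k ih => intro f hf; exact ⟨base hf, fun i => ih fun y => (hf y).pd i⟩

lemma CC.comp {S : Set ℝ} (hS : IsClosed S) {k : ℕ} : ∀ {F : ℝ → ℝ} {a : ℕ → Pl → ℝ},
    (∀ s ∈ S, ContDiffAt ℝ (⊤ : ℕ∞) F s) → (∀ n y, a n y ∈ S) → CC k a → CC k (fun n y => F (a n y)) := by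
  have base : ∀ {F : ℝ → ℝ} {a : ℕ → Pl → ℝ},
    (∀ s ∈ S, ContDiffAt ℝ (⊤ : ℕ∞) F s) → (∀ n y, a n y ∈ S) → ES a ∧ Cv a →
      ES (fun n y => F (a n y)) ∧ Cv (fun n y => F (a n y)) := by
    intro F a hF haS ha
    constructor
    · intro r
      filter_upwards [ha.1 r] with n h1 y hy
      exact (hF _ (haS n y)).comp y (h1 y hy)
    · intro r e he
      obtain ⟨A, hA, hA'⟩ := CC.bdd (k := 0) ha r
      obtain ⟨NA, hA'⟩ := eventually_atTop.mp hA'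
      have hK : IsCompact (S ∩ Icc (-A) A) := isCompact_Icc.inter_left hS
      have hc : ContinuousOn F (S ∩ Icc (-A) A) := fun s hs => (hF s hs.1).continuousAt.continuousWithinAt
      have hu := hK.uniformContinuousOn_of_continuous hc
      rw [Metric.uniformContinuousOn_iff] at hu
      obtain ⟨δ, hδ, hu⟩ := hu e he
      obtain ⟨N, hN⟩ := ha.2 r (δ / 2) (by positivity)
      refine ⟨max N NA, fun m hm n hn y hy => ?_⟩
      simp only [max_le_iff] at hm hn
      have h1 := hN m hm.1 n hn.1 y hy
      have := hu (a m y) ⟨haS m y, abs_le.mp (hA' m hm.2 y hy)⟩ (a n y) ⟨haS n y, abs_le.mp (hA' n hn.2 y hy)⟩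
        (by rw [Real.dist_eq]; linarith)
      rw [Real.dist_eq] at this
      exact this.le
  induction k with
  | zero => intro F a hF haS ha; exact base hF haS ha
  | succ k ih =>
    intro F a hF haS ha
    refine ⟨base hF haS ha.1, fun i => (CC.mul (ih (F := deriv F) ?_ haS ha.mono) (ha.2 i)).congr ?_⟩
    · intro s hs
      have : ContDiffAt ℝ (⊤ : ℕ∞) (fun y => fderiv ℝ F y 1) s :=
        (ContDiffAt.fderiv_right (hF s hs) (by simp)).clm_apply contDiffAt_const
      simpa using this
    · intro r
      filter_upwards [ha.1.1 r] with n h1 y hy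
      exact (pd_comp ((hF _ (haS n y)).differentiableAt (by simp)).hasDerivAt (h1 y hy).diff i).symm

/-- elliptic gain -/
lemma CC.ell {k : ℕ} : ∀ {a : ℕ → Pl → ℝ}, CC 0 a → CC k (fun n => lap (a n)) → CC (k + 1) a := by
  have base : ∀ {a : ℕ → Pl → ℝ}, CC 0 a → CC 0 (fun n => lap (a n)) → ∀ i, CC 0 (fun n => _root_.pd (a n) i) := by
    intro a ha hl i
    constructor
    · intro r
      filter_upwards [ha.1 r] with n h1 y hy using (h1 y hy).pd i
    · intro r e he
      obtain ⟨N, hN⟩ := ha.2 (r + 3) (e / 4) (by positivity)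
      obtain ⟨N', hN'⟩ := hl.2 (r + 3) (e / 2) (by positivity)
      obtain ⟨N'', hN''⟩ := eventually_atTop.mp (ha.1 (r + 3))
      refine ⟨max (max N N') N'', fun m hm n hn y hy => ?_⟩
      simp only [max_le_iff] at hm hn
      have hz : ∀ z : Pl, ‖z - y‖ ≤ 2 * 1 → ‖z‖ < r + 3 := fun z hz => by linarith [(norm_tri z y).2]
      have s1 := fun z hh => hN'' m hm.2 z (hz z hh)
      have s2 := fun z hh => hN'' n hn.2 z (hz z hh)
      have := pd_bound (u := fun y => a m y - a n y) (x := y) (d := 1) (M := e / 4) (N := e) one_pos i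
        (fun z hh => (s1 z hh).sub' (s2 z hh)) (fun z hh => hN m hm.1.1 n hn.1.1 z (hz z hh))
        (fun z hh => by
          rw [lap_sub (s1 z hh) (s2 z hh)]
          have := hN' m hm.1.2 n hn.1.2 z (hz z hh)
          linarith)
      rw [pd_sub (s1 y (by simp)).diff (s2 y (by simp)).diff] at this
      refine this.trans ?_
      linarith
  induction k with
  | zero => intro a ha hl; exact ⟨ha, base ha hl⟩
  | succ k ih =>
    intro a ha hl
    refine ⟨ha, fun i => ih (base ha hl.base i) ((hl.2 i).congr ?_)⟩
    intro r
    filter_upwards [ha.1 r] with n h1 y hy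
    exact (lap_pd (h1 y hy) i (by filter_upwards [nhds_ball hy] with z hz using h1 z hz)).symm

lemma CC.boot {τ ν : ℝ} (hτ : 0 < τ) (hσ : ∀ y, Sm (sg ν) y) {a : ℕ → Pl → ℝ} (ha : CC 0 a)
    (he : EqE (fun n y => Ph τ (SS ν (a n) y)) (fun n => lap (a n))) (k : ℕ) : CC k a := by
  induction k with
  | zero => exact ha
  | succ k ih =>
    refine CC.ell ha (CC.congr ?_ he)
    refine CC.comp (S := Ici 0) isClosed_Ici (F := Ph τ) (fun s hs => sm_Ph hτ hs) (fun n y => SS_nonneg _ _ _) ?_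
    refine CC.mul (CC.const hσ) ?_
    exact CC.comp (S := univ) isClosed_univ (F := fun t => exp (-t)) (fun s _ => by fun_prop) (fun n y => mem_univ _) ih

/-- limit of a Cauchy sequence -/
def lm (a : ℕ → Pl → ℝ) (y : Pl) : ℝ := limUnder atTop (fun n => a n y)

lemma Cv.tendsto {a : ℕ → Pl → ℝ} (h : Cv a) (y : Pl) : Tendsto (fun n => a n y) atTop (𝓝 (lm a y)) := by
  refine CauchySeq.tendsto_limUnder ?_
  rw [Metric.cauchySeq_iff]
  intro e he
  obtain ⟨N, hN⟩ := h (‖y‖ + 1) (e / 2) (by positivity)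
  refine ⟨N, fun m hm n hn => ?_⟩
  rw [Real.dist_eq]
  have := hN m hm n hn y (by linarith)
  linarith

lemma Cv.unif {a : ℕ → Pl → ℝ} (h : Cv a) (r e : ℝ) (he : 0 < e) :
    ∃ N, ∀ n, N ≤ n → ∀ y : Pl, ‖y‖ < r → |a n y - lm a y| ≤ e := by
  obtain ⟨N, hN⟩ := h r e he
  refine ⟨N, fun n hn y hy => ?_⟩
  have ht : Tendsto (fun m => |a n y - a m y|) atTop (𝓝 |a n y - lm a y|) :=
    ((h.tendsto y).const_sub _).abs
  refine le_of_tendsto ht ?_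
  filter_upwards [eventually_ge_atTop N] with m hm using hN n hn m hm y hy

lemma CC.lim_hasFDeriv {a : ℕ → Pl → ℝ} (h : CC 1 a) (x : Pl) :
    HasFDerivAt (lm a) (∑ i, lm (fun n => _root_.pd (a n) i) x • cf i) x := by
  refine hasFDerivAt_of_tendstoUniformlyOnFilter (𝕜 := ℝ) (l := atTop) (f := a)
    (f' := fun n y => ∑ i, _root_.pd (a n) i y • cf i)
    (g' := fun y => ∑ i, lm (fun n => _root_.pd (a n) i) y • cf i) ?_ ?_ ?_
  · rw [Metric.tendstoUniformlyOnFilter_iff]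
    intro e he
    have hcf : ∀ i, ‖cf i‖ ≤ 1 := fun i => ContinuousLinearMap.opNorm_le_bound _ zero_le_one fun w => by
      simpa using coord_le w i
    obtain ⟨N, hN⟩ := (h.2 0).2.unif (‖x‖ + 1) (e / 4) (by positivity)
    obtain ⟨N', hN'⟩ := (h.2 1).2.unif (‖x‖ + 1) (e / 4) (by positivity)
    have hb := nhds_ball (y := x) (r := ‖x‖ + 1) (by linarith)
    filter_upwards [(eventually_ge_atTop (max N N')).prod_mk hb] with q hq
    obtain ⟨hq1, hq2⟩ := hq
    simp only [max_le_iff] at hq1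
    have h1 := hN q.1 hq1.1 q.2 hq2
    have h2 := hN' q.1 hq1.2 q.2 hq2
    rw [dist_comm, dist_eq_norm, Fin.sum_univ_two, Fin.sum_univ_two, add_sub_add_comm, ← sub_smul, ← sub_smul]
    calc _ ≤ _ := norm_add_le _ _
      _ ≤ e / 4 * 1 + e / 4 * 1 := by
        rw [norm_smul, norm_smul, Real.norm_eq_abs, Real.norm_eq_abs]
        gcongr
        · exact hcf 0
        · exact hcf 1
      _ < e := by linarith
  · have hb := nhds_ball (y := x) (r := ‖x‖ + 1) (by linarith)
    filter_upwards [(h.1.1 (‖x‖ + 1)).prod_mk hb] with q hq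
    have hs := hq.1 q.2 hq.2
    have e : (∑ i, _root_.pd (a q.1) i q.2 • cf i) = fderiv ℝ (a q.1) q.2 := by
      refine ContinuousLinearMap.ext fun w => ?_
      have e2 : fderiv ℝ (a q.1) q.2 w = w 0 * fderiv ℝ (a q.1) q.2 (ee 0) + w 1 * fderiv ℝ (a q.1) q.2 (ee 1) := by
        conv_lhs => rw [vec_eq w]
        rw [map_add, map_smul, map_smul]; simp
      rw [e2, Fin.sum_univ_two, pd_eq hs.diff, pd_eq hs.diff]
      have e3 : ∀ i, cf i w = w i := fun i => rfl
      simp only [add_apply, smul_apply, smul_eq_mul, e3]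
      ring
    rw [e]
    exact hs.diff.hasFDerivAt
  · exact Eventually.of_forall fun y => h.1.2.tendsto y

lemma CC.lim_pd {a : ℕ → Pl → ℝ} (h : CC 1 a) (i : Fin 2) :
    _root_.pd (lm a) i = lm (fun n => _root_.pd (a n) i) := by
  funext x
  rw [pd_of_hasFDerivAt (h.lim_hasFDeriv x)]
  fin_cases i <;> simp [Fin.sum_univ_two, cf]

lemma CC.lim_contDiff {k : ℕ} : ∀ {a : ℕ → Pl → ℝ}, CC (k + 1) a → ContDiff ℝ k (lm a) := by
  induction k with
  | zero =>
    intro a h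
    exact contDiff_zero.mpr (continuous_iff_continuousAt.mpr fun x => (CC.lim_hasFDeriv h x).continuousAt)
  | succ k ih =>
    intro a h
    push_cast
    rw [contDiff_succ_iff_hasFDerivAt]
    refine ⟨_, ?_, fun x => CC.lim_hasFDeriv (a := a) ⟨h.1, fun i => (h.2 i).base⟩ x⟩
    exact ContDiff.sum fun i _ => (ih (h.2 i)).smul contDiff_const

lemma CC.lim_smooth {a : ℕ → Pl → ℝ} (h : ∀ k, CC k a) (y : Pl) : Sm (lm a) y :=
  (contDiff_infty.mpr fun k => CC.lim_contDiff (h (k + 1))).contDiffAt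

lemma extract {v : ℕ → Pl → ℝ} (hES : ES v)
    (hb : ∀ r : ℝ, ∃ B : ℝ, 0 < B ∧ ∀ᶠ n in atTop, ∀ y : Pl, ‖y‖ < r → |v n y| ≤ B)
    (hg : ∀ r : ℝ, ∃ K : ℝ, 0 < K ∧ ∀ᶠ n in atTop, ∀ y : Pl, ‖y‖ < r → ∀ i, |pd (v n) i y| ≤ K) :
    ∃ φ : ℕ → ℕ, StrictMono φ ∧ CC 0 (fun n => v (φ n)) := by
  choose B hB0 hB using hb
  choose K hK0 hK using hg
  set d : ℕ → Pl := TopologicalSpace.denseSeq Pl with hd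
  set b : ℕ → ℝ := fun k => B (‖d k‖ + 1) with hbdef
  have hb0 : ∀ k, 0 < b k := fun k => hB0 _
  set X : ℕ → (ℕ → ℝ) := fun n k => max (-b k) (min (b k) (v n (d k))) with hX
  have hmem : ∀ n, X n ∈ Set.pi univ (fun k => Icc (-b k) (b k)) := by
    intro n k _
    exact ⟨le_max_left _ _, max_le (by linarith [hb0 k]) (min_le_left _ _)⟩
  obtain ⟨a, _, φ, hφ, hlim⟩ := (isCompact_univ_pi (fun k => isCompact_Icc (a := -b k) (b := b k))).tendsto_subseq hmem
  refine ⟨φ, hφ, ?_, ?_⟩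
  · intro r
    exact hφ.tendsto_atTop.eventually (hES r)
  have hpt : ∀ k, CauchySeq (fun n => v (φ n) (d k)) := by
    intro k
    have h1 : Tendsto (fun n => X (φ n) k) atTop (𝓝 (a k)) := (tendsto_pi_nhds.mp hlim) k
    have h2 : (fun n => X (φ n) k) =ᶠ[atTop] fun n => v (φ n) (d k) := by
      filter_upwards [hφ.tendsto_atTop.eventually (hB (‖d k‖ + 1))] with n hn
      have := abs_le.mp (hn (d k) (by linarith))
      simp only [hX]
      rw [min_eq_right this.2, max_eq_right this.1]
    exact (h1.congr' h2).cauchySeq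
  intro r e he
  set κ := K (r + 2) with hκ
  have hκ0 : 0 < κ := hK0 _
  set δ := min 1 (e / (8 * κ)) with hδ
  have hδ0 : 0 < δ := by positivity
  have hδ1 : δ ≤ 1 := min_le_left _ _
  have hδ2 : κ * δ ≤ e / 8 := by
    calc κ * δ ≤ κ * (e / (8 * κ)) := by gcongr; exact min_le_right _ _
      _ = e / 8 := by field_simp
  obtain ⟨t, ht⟩ := (cb_compact r).elim_finite_subcover (fun k => ball (d k) δ) (fun k => isOpen_ball) (by
    intro y _
    obtain ⟨k, hk⟩ := (TopologicalSpace.denseRange_denseSeq Pl).exists_dist_lt y hδ0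
    exact mem_iUnion.mpr ⟨k, hk⟩)
  have hN1 : ∀ k, ∃ N, ∀ m, N ≤ m → ∀ n, N ≤ n → |v (φ m) (d k) - v (φ n) (d k)| < e / 2 := by
    intro k
    obtain ⟨N, hN⟩ := Metric.cauchySeq_iff.mp (hpt k) (e / 2) (by positivity)
    exact ⟨N, fun m hm n hn => by have := hN m hm n hn; rwa [Real.dist_eq] at this⟩
  choose N1 hN1 using hN1
  obtain ⟨N2, hN2⟩ := eventually_atTop.mp (hφ.tendsto_atTop.eventually ((hES (r + 2)).and (hK (r + 2))))
  refine ⟨max (t.sup N1) N2, fun m hm n hn y hy => ?_⟩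
  simp only [max_le_iff] at hm hn
  obtain ⟨k, hk, hyk⟩ : ∃ k ∈ t, y ∈ ball (d k) δ := by
    have := ht (show y ∈ {y : Pl | ‖y‖ ≤ r} from hy.le)
    simpa using this
  rw [mem_ball, dist_eq_norm] at hyk
  have hdk : ‖d k‖ < r + 1 := by
    have := (norm_tri (d k) y).2
    rw [norm_sub_rev] at this; linarith
  have hN1k : N1 k ≤ t.sup N1 := Finset.le_sup hk
  have hlip : ∀ m, N2 ≤ m → |v (φ m) y - v (φ m) (d k)| ≤ e / 4 := by
    intro m hm
    have := lip_ball (u := v (φ m)) (c := 0) (r := r + 1) (K := κ)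
      (fun z hz => (hN2 m hm).1 z (by rw [sub_zero] at hz; linarith))
      (fun z hz => (hN2 m hm).2 z (by rw [sub_zero] at hz; linarith))
      (x := d k) (y := y) (by rw [sub_zero]; linarith) (by rw [sub_zero]; linarith)
    refine this.trans ?_
    calc 2 * κ * ‖y - d k‖ ≤ 2 * κ * δ := by gcongr
      _ ≤ e / 4 := by linarith
  have h1 := abs_le.mp (hlip m hm.2)
  have h2 := abs_le.mp (hlip n hn.2)
  have h3 := abs_lt.mp (hN1 k m (hN1k.trans hm.1) n (hN1k.trans hn.1))
  rw [abs_le]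
  constructor <;> linarith [h1.1, h1.2, h2.1, h2.2, h3.1, h3.2]

lemma sm_Gs' {τ s : ℝ} (hτ : 0 < τ) (h0 : 0 ≤ s) : ContDiffAt ℝ (⊤ : ℕ∞) (Gs τ) s := by
  unfold Gs
  exact ContDiffAt.div (by fun_prop) (by fun_prop) (by positivity)

lemma limit_exists {τ ν : ℝ} (hτ : 0 < τ) (hν : 0 ≤ ν) (hσ : ∀ y, Sm (sg ν) y) {R : ℕ → ℝ} {v : ℕ → Pl → ℝ}
    (hR : Tendsto R atTop atTop) (hS : ∀ n, Sol τ ν (R n) (v n))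
    (hF : ∀ e : ℝ, 0 < e → ∀ᶠ n in atTop, Far ν (R n) e (v n)) :
    ∃ φ : ℕ → ℕ, StrictMono φ ∧ ∃ W : Pl → ℝ, (∀ r, Sol τ ν r W) ∧
      (∀ r e : ℝ, 0 < e → ∃ N, ∀ n, N ≤ n → ∀ y : Pl, ‖y‖ < r → |v (φ n) y - W y| ≤ e) ∧
      (∀ y, 0 < ‖y‖ → 0 ≤ hat ν W y) ∧ (∃ M : ℝ, ∀ y, 1 ≤ ‖y‖ → |hat ν W y| ≤ M) ∧
      Integrable (fun y => Gs τ (SS ν W y)) := by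
  obtain ⟨R2, M, hR2, hM, hb1, hb2⟩ := local_bound hτ hν hσ
  have hRr : ∀ r : ℝ, ∀ᶠ n in atTop, r < R n := fun r => hR.eventually_gt_atTop r
  have hES : ES v := fun r => by
    filter_upwards [hRr r] with n hn y hy using (hS n).sm y (hy.trans hn)
  have hbd : ∀ r : ℝ, ∃ B : ℝ, 0 < B ∧ ∀ᶠ n in atTop, ∀ y : Pl, ‖y‖ < r → |v n y| ≤ B := by
    intro r
    obtain ⟨B, hB, h⟩ := hb2 (max 1 r) (le_max_left _ _)
    refine ⟨B, hB, ?_⟩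
    filter_upwards [hRr R2, hRr (max 1 r), hF 1 one_pos] with n h1 h2 h3 y hy
    exact h (R n) (v n) h1.le h2 (hS n) h3 y (hy.le.trans (le_max_right _ _))
  have hC0 := C0_pos hτ
  have hgr : ∀ r : ℝ, ∃ K : ℝ, 0 < K ∧ ∀ᶠ n in atTop, ∀ y : Pl, ‖y‖ < r → ∀ i, |pd (v n) i y| ≤ K := by
    intro r
    obtain ⟨B, hB, h⟩ := hbd (r + 3)
    refine ⟨2 * B / 1 + (C0 τ + 1) * 1 / 2, by positivity, ?_⟩
    filter_upwards [h, hRr (r + 3)] with n h1 h2 y hy i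
    have hz : ∀ z : Pl, ‖z - y‖ ≤ 2 * 1 → ‖z‖ < r + 3 := fun z hz => by linarith [(norm_tri z y).2]
    refine pd_bound one_pos i (fun z hh => (hS n).sm z ((hz z hh).trans h2)) (fun z hh => h1 z (hz z hh)) fun z hh => ?_
    rw [(hS n).eq z ((hz z hh).trans h2)]
    linarith [Ph_bound (τ := τ) hτ (SS_nonneg ν (v n) z)]
  obtain ⟨φ, hφ, hCC⟩ := extract hES hbd hgr
  have hφt := hφ.tendsto_atTop
  have hk := CC.boot hτ hσ hCC (fun r => by
    filter_upwards [hφt.eventually (hRr r)] with n hn y hy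
    exact ((hS (φ n)).eq y (hy.trans hn)).symm)
  set W := lm (fun n => v (φ n)) with hW
  have hWsm : ∀ y, Sm W y := CC.lim_smooth hk
  have hWt : ∀ y, Tendsto (fun n => v (φ n) y) atTop (𝓝 (W y)) := hCC.2.tendsto
  have hSSt : ∀ y, Tendsto (fun n => SS ν (v (φ n)) y) atTop (𝓝 (SS ν W y)) := fun y =>
    ((Real.continuous_exp.tendsto _).comp (hWt y).neg).const_mul _
  have hhat : ∀ y, Tendsto (fun n => hat ν (v (φ n)) y) atTop (𝓝 (hat ν W y)) := fun y =>
    (hWt y).sub_const _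
  have hlap : ∀ y, lap W y = Ph τ (SS ν W y) := by
    intro y
    have h1 : ∀ i, pd W i = lm (fun n => pd (v (φ n)) i) := fun i => (hk 1).lim_pd i
    have h2 : ∀ i, pd (pd W i) i = lm (fun n => pd (pd (v (φ n)) i) i) := fun i => by
      rw [h1]; exact CC.lim_pd ((hk 2).2 i) i
    have h3 : ∀ i, Tendsto (fun n => pd (pd (v (φ n)) i) i y) atTop (𝓝 (pd (pd W i) i y)) := fun i => by
      rw [h2]; exact (((hk 2).2 i).2 i).2.tendsto y
    have h4 : Tendsto (fun n => lap (v (φ n)) y) atTop (𝓝 (lap W y)) := (h3 0).add (h3 1)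
    have h5 : Tendsto (fun n => Ph τ (SS ν (v (φ n)) y)) atTop (𝓝 (Ph τ (SS ν W y))) :=
      (sm_Ph hτ (SS_nonneg _ _ _)).continuousAt.tendsto.comp (hSSt y)
    refine tendsto_nhds_unique h4 (h5.congr' ?_)
    filter_upwards [hφt.eventually (hRr ‖y‖)] with n hn
    exact ((hS (φ n)).eq y hn).symm
  refine ⟨φ, hφ, W, fun r => ⟨fun y _ => hWsm y, fun y _ => hlap y⟩, fun r e he => hCC.2.unif r e he, ?_, ⟨M, ?_⟩, ?_⟩
  · intro y hy
    refine le_of_forall_pos_le_add fun e he => ?_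
    have : -e ≤ hat ν W y := by
      refine ge_of_tendsto (hhat y) ?_
      filter_upwards [hφt.eventually (hRr ‖y‖), hφt.eventually (hF e he)] with n h1 h2
      exact far_lower hτ hν (hS _) (by linarith) he.le h2 hy h1
    linarith
  · intro y hy
    refine le_of_tendsto (hhat y).abs ?_
    filter_upwards [hφt.eventually (hRr ‖y‖), hφt.eventually (hRr R2), hφt.eventually (hF 1 one_pos)] with n h1 h2 h3
    exact hb1 _ _ h2.le (hS _) h3 y hy h1
  · obtain ⟨R1, C1, hR1, hC1, hE⟩ := energy hτ hν hσ
    set A := 4 * (τ + 1) * π * ν ^ 2 + C1 with hA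
    have hA0 : 0 < A := by positivity
    have hGs : ∀ s : ℝ, 0 ≤ s → ContDiffAt ℝ (⊤ : ℕ∞) (Gs τ) s := fun s hs => sm_Gs' hτ hs
    have hGc : ∀ s : ℝ, 0 ≤ s → ContinuousAt (Gs τ) s := fun s hs => (hGs s hs).continuousAt
    have hWc : Continuous (fun y => Gs τ (SS ν W y)) := by
      rw [continuous_iff_continuousAt]
      intro y
      have : ContinuousAt (SS ν W) y := (sm_SS hσ (hWsm y)).continuousAt
      exact ContinuousAt.comp (f := SS ν W) (hGc _ (SS_nonneg _ _ _)) this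
    refine ⟨hWc.aestronglyMeasurable, ?_⟩
    rw [hasFiniteIntegral_iff_ofReal (Eventually.of_forall fun y => Gs_nonneg)]
    set G : ℕ → Pl → ℝ := fun n y => eta (3 * R (φ n) / 4) y * Gs τ (SS ν (v (φ n)) y) with hG
    obtain ⟨N, hN⟩ := eventually_atTop.mp (hφt.eventually ((hRr R1).and (hF 1 one_pos)))
    have hIntg : ∀ n, N ≤ n → Integrable (G n) := fun n hn => cut_int (by linarith [(hN n hn).1]) fun y hy =>
      ContDiffAt.comp (g := Gs τ) y (hGs _ (SS_nonneg _ _ _)) (sm_SS hσ ((hS _).sm y (by linarith [(hN n hn).1])))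
    have hbound : ∀ n, N ≤ n → ∫⁻ y, ENNReal.ofReal (G n y) ≤ ENNReal.ofReal A := by
      intro n hn
      rw [← ofReal_integral_eq_lintegral_ofReal (hIntg n hn)
        (Eventually.of_forall fun y => mul_nonneg (eta_nonneg _ _) Gs_nonneg)]
      apply ENNReal.ofReal_le_ofReal
      have h1 := (abs_le.mp (hE (R (φ n)) (v (φ n)) (hN n hn).1.le (hS _) (hN n hn).2)).2
      have h2 : C1 / R (φ n) ^ 2 ≤ C1 := by
        apply div_le_self hC1.le
        have := (hN n hn).1
        nlinarith
      linarith
    have hlimG : ∀ y, Tendsto (fun n => ENNReal.ofReal (G (n + N) y)) atTop (𝓝 (ENNReal.ofReal (Gs τ (SS ν W y)))) := by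
      intro y
      refine (ENNReal.continuous_ofReal.tendsto _).comp ?_
      refine Tendsto.comp (g := fun n => G n y) ?_ (tendsto_add_atTop_nat N)
      have h1 : Tendsto (fun n => Gs τ (SS ν (v (φ n)) y)) atTop (𝓝 (Gs τ (SS ν W y))) :=
        (hGc _ (SS_nonneg _ _ _)).tendsto.comp (hSSt y)
      refine h1.congr' ?_
      filter_upwards [hφt.eventually (hRr (4 * ‖y‖ + 1))] with n hn
      simp only [hG]
      rw [eta_one (by linarith [norm_nonneg y]) (by linarith [norm_nonneg y]), one_mul]
    have hfat := lintegral_liminf_le' (μ := (volume : Measure Pl)) (u := (atTop : Filter ℕ)) (f := fun n y => ENNReal.ofReal (G (n + N) y))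
      (fun n => (hIntg (n + N) (by omega)).aestronglyMeasurable.aemeasurable.ennreal_ofReal)
    have e1 : ∀ y, liminf (fun n => ENNReal.ofReal (G (n + N) y)) atTop = ENNReal.ofReal (Gs τ (SS ν W y)) :=
      fun y => (hlimG y).liminf_eq
    simp only [e1] at hfat
    refine lt_of_le_of_lt (hfat.trans ?_) (ENNReal.ofReal_lt_top (r := A))
    calc _ ≤ liminf (fun _ : ℕ => ENNReal.ofReal A) atTop :=
          liminf_le_liminf (Eventually.of_forall fun n => hbound (n + N) (by omega))
      _ = _ := by simp

lemma vol_ball (x : Pl) {r : ℝ} (hr : 0 ≤ r) : (volume : Measure Pl).real (ball x r) = π * r ^ 2 := by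
  rw [Measure.real, EuclideanSpace.volume_ball_fin_two, ENNReal.toReal_mul, ENNReal.toReal_pow,
    ENNReal.toReal_ofReal hr, mul_comm, ENNReal.toReal_ofReal Real.pi_pos.le]

lemma entire_grad {τ ν M : ℝ} {W : Pl → ℝ} (hτ : 0 < τ) (hS : ∀ r, Sol τ ν r W)
    (hM : ∀ y, 1 ≤ ‖y‖ → |hat ν W y| ≤ M) :
    ∃ K : ℝ, 0 < K ∧ ∀ y, 1 ≤ ‖y‖ → ∀ i, |pd (hat ν W) i y| ≤ K := by
  have hsm : ∀ y : Pl, 0 < ‖y‖ → Sm (hat ν W) y := fun y hy => hat_sm (hS (‖y‖ + 1)) hy (by linarith)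
  have hC0 := C0_pos hτ
  have hcpt : ∀ i, ∃ B, ∀ y : Pl, 1 ≤ ‖y‖ → ‖y‖ ≤ 4 → |pd (hat ν W) i y| ≤ B := by
    intro i
    have hK : IsCompact ({y : Pl | ‖y‖ ≤ 4} ∩ {y : Pl | 1 ≤ ‖y‖}) :=
      (cb_compact 4).inter_right (isClosed_le continuous_const continuous_norm)
    obtain ⟨B, hB⟩ := hK.exists_bound_of_continuousOn (f := pd (hat ν W) i)
      (sm_continuousOn fun y hy => (hsm y (lt_of_lt_of_le one_pos hy.2)).pd i)
    exact ⟨B, fun y h1 h2 => hB y ⟨h2, h1⟩⟩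
  choose B hB using hcpt
  refine ⟨|B 0| + |B 1| + |2 * M / 1 + (C0 τ + 1) * 1 / 2| + 1, by positivity, fun y hy i => ?_⟩
  by_cases h4 : ‖y‖ ≤ 4
  · have := hB i y hy h4
    have h2 : B i ≤ |B 0| + |B 1| := by
      fin_cases i
      · exact (le_abs_self (B 0)).trans (by linarith [abs_nonneg (B 1)])
      · exact (le_abs_self (B 1)).trans (by linarith [abs_nonneg (B 0)])
    linarith [abs_nonneg (2 * M / 1 + (C0 τ + 1) * 1 / 2)]
  · push Not at h4
    have hz : ∀ z : Pl, ‖z - y‖ ≤ 2 * 1 → 1 ≤ ‖z‖ := fun z hz => by linarith [(norm_tri z y).1]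
    have := pd_bound (u := hat ν W) (x := y) (d := 1) (M := M) (N := C0 τ + 1) one_pos i
      (fun z hh => hsm z (by linarith [hz z hh])) (fun z hh => hM z (hz z hh)) (fun z hh => by
        rw [hat_eq (hS (‖z‖ + 1)) (by linarith [hz z hh]) (by linarith)]
        linarith [Ph_bound (τ := τ) hτ (exp_pos (-(hat ν W z))).le])
    linarith [abs_nonneg (B 0), abs_nonneg (B 1), le_abs_self (2 * M / 1 + (C0 τ + 1) * 1 / 2)]

lemma entire_zero {τ ν M : ℝ} {W : Pl → ℝ} (hτ : 0 < τ) (hS : ∀ r, Sol τ ν r W)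
    (h0 : ∀ y, 0 < ‖y‖ → 0 ≤ hat ν W y)
    (hM : ∀ y, 1 ≤ ‖y‖ → |hat ν W y| ≤ M) (hI : Integrable (fun y => Gs τ (SS ν W y)))
    {e : ℝ} (he : 0 < e) : ∃ ρ : ℝ, 1 ≤ ρ ∧ ∀ y, ρ ≤ ‖y‖ → |hat ν W y| ≤ e := by
  obtain ⟨K, hK, hKb⟩ := entire_grad hτ hS hM
  have hsm : ∀ y : Pl, 0 < ‖y‖ → Sm (hat ν W) y := fun y hy => hat_sm (hS (‖y‖ + 1)) hy (by linarith)
  set δ := min 1 (e / (4 * K)) with hδ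
  have hδ0 : 0 < δ := by positivity
  have hδ1 : δ ≤ 1 := min_le_left _ _
  have hδ2 : 2 * K * δ ≤ e / 2 := by
    calc 2 * K * δ ≤ 2 * K * (e / (4 * K)) := by gcongr; exact min_le_right _ _
      _ = e / 2 := by field_simp; ring
  set g := Gs τ (exp (-(e / 2))) with hg
  have hg0 : 0 < g := Gs_pos hτ (exp_pos _).le (by rw [Real.exp_lt_one_iff]; linarith)
  have htail := tendsto_setIntegral_of_antitone (μ := (volume : Measure Pl)) (f := fun y => Gs τ (SS ν W y))
    (s := fun n : ℕ => {y : Pl | (n : ℝ) ≤ ‖y‖})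
    (fun n => (isClosed_le continuous_const continuous_norm).measurableSet)
    (fun m n hmn y hy => by
      have h1 : (m : ℝ) ≤ n := by exact_mod_cast hmn
      exact h1.trans hy) ⟨0, hI.integrableOn⟩
  have hemp : (⋂ n : ℕ, {y : Pl | (n : ℝ) ≤ ‖y‖}) = ∅ := by
    rw [eq_empty_iff_forall_notMem]
    intro y hy
    obtain ⟨n, hn⟩ := exists_nat_gt ‖y‖
    have : (n : ℝ) ≤ ‖y‖ := mem_iInter.mp hy n
    linarith
  rw [hemp, setIntegral_empty] at htail
  obtain ⟨N, hN⟩ := (htail.eventually_lt_const (show 0 < g * (π * δ ^ 2) by positivity)).exists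
  refine ⟨N + 3, by have : (0:ℝ) ≤ N := Nat.cast_nonneg N; linarith, fun y hy => ?_⟩
  have hNn : (0:ℝ) ≤ N := Nat.cast_nonneg N
  rw [abs_of_nonneg (h0 y (by linarith))]
  by_contra hgt
  push Not at hgt
  have hin : ∀ z : Pl, ‖z - y‖ ≤ δ → N + 2 ≤ ‖z‖ := fun z hz => by linarith [(norm_tri z y).1]
  have hlow : ∀ z : Pl, ‖z - y‖ ≤ δ → e / 2 ≤ hat ν W z := by
    intro z hz
    have := lip_ball (u := hat ν W) (c := y) (r := δ) (K := K) (fun z hz => hsm z (by linarith [hin z hz]))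
      (fun z hz => hKb z (by linarith [hin z hz])) (x := y) (y := z) (by simpa using hδ0.le) hz
    have h2 : 2 * K * ‖z - y‖ ≤ e / 2 := le_trans (by gcongr) hδ2
    linarith [(abs_le.mp this).1]
  have h5 := setIntegral_mono_on (μ := (volume : Measure Pl)) (s := ball y δ) (f := fun _ => g)
    (g := fun y => Gs τ (SS ν W y))
    (integrableOn_const (by exact measure_ball_lt_top.ne)) hI.integrableOn measurableSet_ball (by
      intro z hz
      have hz' : ‖z - y‖ ≤ δ := by
        have := mem_ball.mp hz; rw [dist_eq_norm] at this; exact this.le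
      rw [SS_eq (Or.inl (norm_pos_iff.mp (by linarith [hin z hz'])))]
      have hl := hlow z hz'
      exact Gs_anti hτ (exp_pos _).le (Real.exp_le_exp.mpr (by linarith)) (by rw [Real.exp_le_one_iff]; linarith))
  rw [setIntegral_const, vol_ball y hδ0.le, smul_eq_mul] at h5
  have h6 : ∫ z in ball y δ, Gs τ (SS ν W z) ≤ ∫ z in {y : Pl | (N : ℝ) ≤ ‖y‖}, Gs τ (SS ν W z) := by
    refine setIntegral_mono_set hI.integrableOn (Eventually.of_forall fun z => Gs_nonneg) ?_
    refine HasSubset.Subset.eventuallyLE ?_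
    intro z hz
    have := mem_ball.mp hz; rw [dist_eq_norm] at this
    have := hin z this.le
    show (N : ℝ) ≤ ‖z‖
    linarith
  linarith

lemma entire_decay {τ ν M : ℝ} {W : Pl → ℝ} (hτ : 0 < τ) (hS : ∀ r, Sol τ ν r W)
    (h0 : ∀ y, 0 < ‖y‖ → 0 ≤ hat ν W y)
    (hM : ∀ y, 1 ≤ ‖y‖ → |hat ν W y| ≤ M) (hI : Integrable (fun y => Gs τ (SS ν W y))) :
    ∃ ρ C : ℝ, 1 ≤ ρ ∧ 0 < C ∧ ∀ y, ρ ≤ ‖y‖ → |hat ν W y| ≤ 1 ∧ |hat ν W y| ≤ C / ‖y‖ ^ 4 := by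
  obtain ⟨ρ, hρ, hb⟩ := entire_zero hτ hS h0 hM hI one_pos
  have hc := c0_pos hτ
  have hsm : ∀ y : Pl, 0 < ‖y‖ → Sm (hat ν W) y := fun y hy => hat_sm (hS (‖y‖ + 1)) hy (by linarith)
  have heq : ∀ y : Pl, 0 < ‖y‖ → lap (hat ν W) y = Ph τ (exp (-(hat ν W y))) := fun y hy =>
    hat_eq (hS (‖y‖ + 1)) hy (by linarith)
  have hin : ∀ x z : Pl, ‖z - x‖ ≤ ‖x‖ / 2 → ‖x‖ / 2 ≤ ‖z‖ := fun x z hz => by linarith [(norm_tri z x).1]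
  have d1 : ∀ x : Pl, 2 * ρ ≤ ‖x‖ → |hat ν W x| ≤ 16 / c0 τ / ‖x‖ ^ 2 := by
    intro x hx
    have hx0 : 0 < ‖x‖ := by linarith
    have := decay (u := hat ν W) (x := x) (ρ := ‖x‖ / 2) hτ (by positivity) one_pos le_rfl
      (fun z hz => hsm z (by linarith [hin x z hz])) (fun z hz => heq z (by linarith [hin x z hz]))
      (fun z hz => hb z (by linarith [hin x z hz]))
    refine this.trans (le_of_eq ?_)
    field_simp; ring
  refine ⟨4 * ρ + 64 / c0 τ, 1024 / c0 τ ^ 2, by have : 0 < 64 / c0 τ := by positivity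
                                                 linarith, by positivity, ?_⟩
  intro x hx
  have hq : 0 < 64 / c0 τ := by positivity
  have hx4 : 4 * ρ ≤ ‖x‖ := by linarith
  have hx1 : 1 ≤ ‖x‖ := by linarith
  have hx0 : 0 < ‖x‖ := by linarith
  refine ⟨hb x (by linarith), ?_⟩
  have hδ1 : 64 / c0 τ / ‖x‖ ^ 2 ≤ 1 := by
    rw [div_le_one (by positivity)]
    nlinarith
  have := decay (u := hat ν W) (x := x) (ρ := ‖x‖ / 2) (δ := 64 / c0 τ / ‖x‖ ^ 2) hτ (by positivity) (by positivity) hδ1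
    (fun z hz => hsm z (by linarith [hin x z hz])) (fun z hz => heq z (by linarith [hin x z hz]))
    (fun z hz => by
      have hz2 := hin x z hz
      refine (d1 z (by linarith)).trans ?_
      have e : 64 / c0 τ / ‖x‖ ^ 2 = 16 / c0 τ / (‖x‖ / 2) ^ 2 := by field_simp; ring
      rw [e]
      gcongr)
  refine this.trans (le_of_eq ?_)
  field_simp; ring

lemma entire_props {τ ν M : ℝ} {W : Pl → ℝ} (hτ : 0 < τ) (hν : 0 ≤ ν) (hσ : ∀ y, Sm (sg ν) y) (hS : ∀ r, Sol τ ν r W)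
    (h0 : ∀ y, 0 < ‖y‖ → 0 ≤ hat ν W y)
    (hM : ∀ y, 1 ≤ ‖y‖ → |hat ν W y| ≤ M) (hI : Integrable (fun y => Gs τ (SS ν W y))) :
    Integrable (fun y => Ph τ (SS ν W y)) ∧ ∫ y, Gs τ (SS ν W y) = 4 * (τ + 1) * π * ν ^ 2 := by
  obtain ⟨ρ, C, hρ, hC, hd⟩ := entire_decay hτ hS h0 hM hI
  have hWsm : ∀ y, Sm W y := fun y => (hS (‖y‖ + 1)).sm y (by linarith)
  have hSc : ∀ y, ContinuousAt (SS ν W) y := fun y => (sm_SS hσ (hWsm y)).continuousAt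
  have hC0 := C0_pos hτ
  constructor
  · have hc : Continuous (fun y => Ph τ (SS ν W y)) := continuous_iff_continuousAt.mpr fun y =>
      ContinuousAt.comp (f := SS ν W) (sm_Ph hτ (SS_nonneg _ _ _)).continuousAt (hSc y)
    have hj : Integrable (fun y : Pl => (1 + ‖y‖) ^ (-(4:ℝ))) := integrable_one_add_norm (by simp; norm_num)
    refine (hj.const_mul (144 * C + C0 τ * (1 + ρ) ^ 4)).mono' hc.aestronglyMeasurable (Eventually.of_forall fun y => ?_)
    rw [Real.norm_eq_abs, Real.rpow_neg (by positivity), ← div_eq_mul_inv,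
      show (1 + ‖y‖) ^ (4:ℝ) = (1 + ‖y‖) ^ 4 by exact_mod_cast Real.rpow_natCast (1 + ‖y‖) 4,
      le_div_iff₀ (by positivity)]
    by_cases hy : ρ ≤ ‖y‖
    · have hy0 : 0 < ‖y‖ := by linarith
      rw [SS_eq (Or.inl (norm_pos_iff.mp hy0))]
      obtain ⟨h1, h2⟩ := hd y hy
      have h3 := Ph_lin hτ h1
      have h4 : (1 + ‖y‖) ^ 4 ≤ 16 * ‖y‖ ^ 4 := by
        have : (1 + ‖y‖) ^ 4 ≤ (2 * ‖y‖) ^ 4 := by gcongr; linarith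
        calc _ ≤ _ := this
          _ = _ := by ring
      calc |Ph τ (exp (-(hat ν W y)))| * (1 + ‖y‖) ^ 4 ≤ (9 * (C / ‖y‖ ^ 4)) * (16 * ‖y‖ ^ 4) := by
            gcongr; linarith
        _ = 144 * C := by field_simp; ring
        _ ≤ _ := by
            have : 0 ≤ C0 τ * (1 + ρ) ^ 4 := by positivity
            linarith
    · push Not at hy
      have h3 := Ph_bound (τ := τ) hτ (SS_nonneg ν W y)
      calc _ ≤ C0 τ * (1 + ρ) ^ 4 := by gcongr
        _ ≤ _ := by linarith
  · obtain ⟨R1, C1, hR1, hC1, hE⟩ := energy hτ hν hσ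
    have hT1 : Tendsto (fun n : ℕ => ∫ y, eta (3 * (n:ℝ) / 4) y * Gs τ (SS ν W y)) atTop (𝓝 (∫ y, Gs τ (SS ν W y))) := by
      refine tendsto_integral_filter_of_dominated_convergence (fun y => Gs τ (SS ν W y)) ?_ ?_ hI ?_
      · filter_upwards [eventually_gt_atTop 0] with n hn
        have hn' : (0:ℝ) < n := by exact_mod_cast hn
        exact (cut_int (by positivity) fun y hy =>
          ContDiffAt.comp (g := Gs τ) y (sm_Gs' hτ (SS_nonneg _ _ _)) (sm_SS hσ (hWsm y))).aestronglyMeasurable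
      · refine Eventually.of_forall fun n => Eventually.of_forall fun y => ?_
        rw [Real.norm_eq_abs, abs_of_nonneg (mul_nonneg (eta_nonneg _ _) Gs_nonneg)]
        exact mul_le_of_le_one_left Gs_nonneg (eta_le_one _ _)
      · refine Eventually.of_forall fun y => ?_
        refine tendsto_const_nhds.congr' ?_
        obtain ⟨N, hN⟩ := exists_nat_gt (4 * ‖y‖ + 1)
        filter_upwards [eventually_ge_atTop N] with n hn
        have hn' : (N:ℝ) ≤ n := by exact_mod_cast hn
        rw [eta_one (by linarith [norm_nonneg y]) (by linarith [norm_nonneg y]), one_mul]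
    have hT2 : Tendsto (fun n : ℕ => ∫ y, eta (3 * (n:ℝ) / 4) y * Gs τ (SS ν W y)) atTop (𝓝 (4 * (τ + 1) * π * ν ^ 2)) := by
      rw [tendsto_iff_dist_tendsto_zero]
      have hz : Tendsto (fun n : ℕ => C1 / (n:ℝ) ^ 2) atTop (𝓝 0) :=
        tendsto_const_nhds.div_atTop ((tendsto_pow_atTop two_ne_zero).comp tendsto_natCast_atTop_atTop)
      refine squeeze_zero' (Eventually.of_forall fun n => dist_nonneg) ?_ hz
      obtain ⟨N, hN⟩ := exists_nat_gt (R1 + 4 * ρ)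
      filter_upwards [eventually_ge_atTop N] with n hn
      have hn' : (N:ℝ) ≤ n := by exact_mod_cast hn
      rw [Real.dist_eq]
      exact hE n W (by linarith) (hS _) fun y hy _ => (hd y (by linarith)).1
    exact tendsto_nhds_unique hT1 hT2

lemma unif_conv {τ ν : ℝ} (hτ : 0 < τ) (hν : 0 ≤ ν) {R : ℕ → ℝ} {v : ℕ → Pl → ℝ} {W : Pl → ℝ}
    (hR : Tendsto R atTop atTop) (hS : ∀ n, Sol τ ν (R n) (v n))
    (hF : ∀ e : ℝ, 0 < e → ∀ᶠ n in atTop, Far ν (R n) e (v n))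
    (hW : ∀ r e : ℝ, 0 < e → ∃ N, ∀ n, N ≤ n → ∀ y : Pl, ‖y‖ < r → |v n y - W y| ≤ e)
    (hz : ∀ e : ℝ, 0 < e → ∃ ρ : ℝ, 1 ≤ ρ ∧ ∀ y, ρ ≤ ‖y‖ → |hat ν W y| ≤ e) {e : ℝ} (he : 0 < e) :
    ∀ᶠ n in atTop, ∀ y, 0 < ‖y‖ → ‖y‖ < R n → |hat ν (v n) y - hat ν W y| ≤ e := by
  obtain ⟨ρ, hρ, hb⟩ := hz (e / 4) (by positivity)
  obtain ⟨N, hN⟩ := hW (ρ + 1) (e / 4) (by positivity)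
  filter_upwards [eventually_ge_atTop N, hF (e / 4) (by positivity), hR.eventually_gt_atTop (ρ + 1)] with n hn hFn hRn y h0 h1
  have hcl : ∀ y : Pl, ‖y‖ < ρ + 1 → |hat ν (v n) y - hat ν W y| ≤ e / 4 := by
    intro y hy
    have : hat ν (v n) y - hat ν W y = v n y - W y := by unfold hat; ring
    rw [this]; exact hN n hn y hy
  by_cases hy : ‖y‖ < ρ + 1
  · linarith [hcl y hy]
  push Not at hy
  have hl := far_lower hτ hν (hS n) (by linarith) (by positivity) hFn h0 h1
  have hu := far_upper (B := e / 2) (r := ρ) hτ (hS n) (by linarith) (by linarith) (by positivity) hFn (by linarith)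
    (fun z hz => by
      have h1 := abs_le.mp (hcl z (by linarith))
      have h2 := abs_le.mp (hb z hz.ge)
      linarith [h1.2, h2.2]) (by linarith : ρ ≤ ‖y‖) h1
  have h2 := abs_le.mp (hb y (by linarith))
  rw [abs_le]; constructor <;> linarith [h2.1, h2.2]

lemma fτ_eq {τ : ℝ} (hτ : 0 < τ) (t : ℝ) : fτ τ t = -Ph τ (exp (-t)) := by
  unfold fτ Ph
  rw [Real.exp_neg]
  have := exp_pos t
  have h1 : τ + exp t ≠ 0 := by positivity
  have h2 : exp t + τ ≠ 0 := by positivity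
  field_simp
  ring

lemma G_eq {τ : ℝ} (hτ : 0 < τ) (t : ℝ) : (1 - exp t) ^ 2 / (τ + exp t) ^ 2 = Gs τ (exp (-t)) := by
  unfold Gs
  rw [Real.exp_neg]
  have := exp_pos t
  have h1 : τ + exp t ≠ 0 := by positivity
  have h2 : exp t + τ ≠ 0 := by positivity
  field_simp
  ring

/-- blow-up of one solution -/
lemma blow {V : VortexData} {τ ε : ℝ} (hτ : 0 < τ) (hε : 0 < ε) {u : Pl → ℝ} (hu : IsSolution V τ ε u)
    (j₀ : Fin V.d₂) (r₀ : ℝ) (hr₀ : 0 < r₀)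
    (hiso : closedBall (V.p₂ j₀) r₀ ∩ V.Z = {V.p₂ j₀}) :
    ∃ v : Pl → ℝ, Sol τ (V.m₂ j₀) (r₀ / ε) v ∧
      ∀ y, y ≠ 0 → hat (V.m₂ j₀) v y = u (V.p₂ j₀ + ε • y) := by
  classical
  set p := V.p₂ j₀ with hp
  set ν := V.m₂ j₀ with hνd
  have hν : 0 ≤ ν := V.m₂_nonneg j₀
  obtain ⟨r, hr, v0, hv0, hv0e⟩ := hu.sing₂ j₀
  have hnZ : ∀ x, ‖x - p‖ ≤ r₀ → x ≠ p → x ∉ V.Z := by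
    intro x hx hne hxZ
    have : x ∈ closedBall p r₀ ∩ V.Z := ⟨by rw [mem_closedBall, dist_eq_norm]; exact hx, hxZ⟩
    rw [hiso] at this
    exact hne this
  set g : Pl → ℝ := fun x => if x = p then v0 p else u x + 2 * ν * Real.log ‖x - p‖ with hg
  have husm : ∀ x, ‖x - p‖ < r₀ → x ≠ p → Sm u x := by
    intro x hx hne
    refine hu.smooth.contDiffAt ?_
    have h1 : ∀ᶠ z in 𝓝 x, ‖z - p‖ < r₀ :=
      (isOpen_lt (by fun_prop) continuous_const).mem_nhds hx
    filter_upwards [h1, isOpen_ne.mem_nhds hne] with z hz hz'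
    exact hnZ z hz.le hz'
  have hgsm : ∀ x, ‖x - p‖ < r₀ → Sm g x := by
    intro x hx
    by_cases hne : x = p
    · rw [hne]
      have h1 : Sm v0 p := hv0.contDiffAt (ball_mem_nhds _ hr)
      refine h1.congr_of_eventuallyEq ?_
      filter_upwards [ball_mem_nhds p hr] with z hz
      by_cases hzx : z = p
      · simp only [hg, hzx, if_true]
      · simp only [hg, hzx, if_false]
        rw [hv0e z hz hzx]; ring
    · have h2 : Sm (fun z : Pl => Real.log ‖z - p‖) x := by
        have := (sm_log (x := x - p) (sub_ne_zero.mpr hne))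
        exact ContDiffAt.comp (g := fun z : Pl => Real.log ‖z‖) x this (contDiffAt_id.sub contDiffAt_const)
      refine ((husm x hx hne).add' ((sm_const (2 * ν) x).mul' h2)).congr_of_eventuallyEq ?_
      filter_upwards [isOpen_ne.mem_nhds hne] with z hz
      have hz' : z ≠ p := hz
      simp only [hg, hz', if_false]
  set A : Pl → Pl := fun y => p + ε • y with hA
  have hAn : ∀ y, ‖A y - p‖ = ε * ‖y‖ := fun y => by simp [hA, norm_smul, abs_of_pos hε]
  have hAr : ∀ y, ‖y‖ < r₀ / ε → ‖A y - p‖ < r₀ := fun y hy => by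
    rw [hAn]; rw [lt_div_iff₀ hε] at hy; linarith
  have hAne : ∀ y, y ≠ 0 → A y ≠ p := fun y hy h => by
    have := hAn y
    rw [h, sub_self, norm_zero] at this
    have h2 : 0 < ε * ‖y‖ := mul_pos hε (norm_pos_iff.mpr hy)
    linarith
  set v : Pl → ℝ := fun y => g (A y) - 2 * ν * Real.log ε with hv
  have hhat : ∀ y, y ≠ 0 → hat ν v y = u (A y) := by
    intro y hy
    simp only [hat, hv, hg, hAne y hy, if_false]
    rw [hAn, Real.log_mul hε.ne' (norm_ne_zero_iff.mpr hy)]; ring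
  have hAsm : ∀ y, ContDiffAt ℝ (⊤ : ℕ∞) A y := fun y => by simp only [hA]; fun_prop
  have hvsm : ∀ y, ‖y‖ < r₀ / ε → Sm v y := fun y hy =>
    Sm.sub' (u := fun y => g (A y)) (ContDiffAt.comp (g := g) y (hgsm _ (hAr y hy)) (hAsm y)) (sm_const _ y)
  have heq : ∀ y, y ≠ 0 → ‖y‖ < r₀ / ε → lap v y = Ph τ (SS ν v y) := by
    intro y hy hyr
    rw [← lap_hat (ν := ν) (hvsm y hyr) (Or.inl hy), SS_eq (Or.inl hy), hhat y hy]
    have e1 : hat ν v =ᶠ[𝓝 y] fun z => u (A z) := by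
      filter_upwards [isOpen_ne.mem_nhds hy] with z hz using hhat z hz
    rw [lap_congr e1, lap_affine (s := fun _ => ε) (q := ε ^ 2) (fun _ => rfl) (fun z t k => by
      simp only [hA]; rw [smul_add, smul_smul, add_assoc, mul_comm t])]
    have h3 := hu.pde (A y) (hnZ _ (hAr y hyr).le (hAne y hy))
    rw [fτ_eq hτ] at h3
    have hε2 : ε ^ 2 ≠ 0 := by positivity
    field_simp at h3
    linarith
  have hR0 : 0 < r₀ / ε := by positivity
  refine ⟨v, ⟨hvsm, fun y hyr => ?_⟩, hhat⟩
  by_cases hy : y = 0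
  swap
  · exact heq y hy hyr
  subst hy
  have c1 : Tendsto (lap v) (𝓝[≠] (0 : Pl)) (𝓝 (lap v 0)) :=
    (hvsm 0 hyr).lap.continuousAt.tendsto.mono_left nhdsWithin_le_nhds
  have c2 : ContinuousAt (SS ν v) 0 := by
    have : ContinuousAt v 0 := (hvsm 0 hyr).continuousAt
    exact (sg_continuous hν).continuousAt.mul this.neg.rexp
  have c3 : Tendsto (fun y => Ph τ (SS ν v y)) (𝓝[≠] (0 : Pl)) (𝓝 (Ph τ (SS ν v 0))) :=
    Tendsto.mono_left (ContinuousAt.comp (g := Ph τ) (f := SS ν v) (sm_Ph hτ (SS_nonneg _ _ _)).continuousAt c2).tendsto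
      nhdsWithin_le_nhds
  haveI : (𝓝[≠] (0 : Pl)).NeBot := Module.punctured_nhds_neBot ℝ Pl 0
  refine tendsto_nhds_unique c1 (c3.congr' ?_)
  filter_upwards [self_mem_nhdsWithin, nhdsWithin_le_nhds (nhds_ball hyr)] with z hz hz'
  exact (heq z hz hz').symm

theorem convergence_to_entire_topological
    (V : VortexData) (τ : ℝ) (hτ : 0 < τ)
    (ε : ℕ → ℝ) (hε : ∀ n, 0 < ε n) (hε0 : Tendsto ε atTop (nhds 0))
    (u : ℕ → Pl → ℝ) (hu : ∀ n, IsSolution V τ (ε n) (u n))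
    (htop : ∀ K : Set Pl, IsCompact K → K ⊆ (V.Z)ᶜ →
        TendstoUniformlyOn u (fun _ => (0:ℝ)) atTop K)
    (j₀ : Fin V.d₂) (r₀ : ℝ) (hr₀ : 0 < r₀)
    (hiso : closedBall (V.p₂ j₀) r₀ ∩ V.Z = {V.p₂ j₀}) :
    ∃ σ : ℕ → ℕ, StrictMono σ ∧
      ∃ w : Pl → ℝ,
        ContDiffOn ℝ (⊤ : ℕ∞) w {V.p₂ j₀}ᶜ ∧
        (∀ x : Pl, x ≠ V.p₂ j₀ → lap w x + fτ τ (w x) = 0) ∧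
        LogSing w (V.p₂ j₀) (-(V.m₂ j₀)) ∧
        (∃ C : ℝ, ∀ y : Pl, 1 ≤ dist y (V.p₂ j₀) → Real.sqrt (gradSq w y) ≤ C) ∧
        Integrable (fun x : Pl => fτ τ (w x)) ∧
        Integrable (fun x : Pl => (1 - exp (w x)) ^ 2 / (τ + exp (w x)) ^ 2) ∧
        Tendsto w (cocompact Pl) (nhds 0) ∧
        (∫ x : Pl, (1 - exp (w x)) ^ 2 / (τ + exp (w x)) ^ 2)
          = 4 * (τ + 1) * π * (V.m₂ j₀) ^ 2 ∧
        Tendsto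
          (fun n => sSup ((fun y =>
              |u (σ n) (V.p₂ j₀ + ε (σ n) • (y - V.p₂ j₀)) - w y|) ''
            (ball (V.p₂ j₀) (r₀ / ε (σ n)) \ {V.p₂ j₀})))
          atTop (nhds 0) := by
  have hν : 0 ≤ V.m₂ j₀ := V.m₂_nonneg j₀
  choose v hS hvh using fun n => blow hτ (hε n) (hu n) j₀ r₀ hr₀ hiso
  set p := V.p₂ j₀ with hp
  set ν := V.m₂ j₀ with hνd
  have hσ : ∀ y, Sm (sg ν) y := sm_sg hτ hν (div_pos hr₀ (hε 0)) (hS 0)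
  have hR : Tendsto (fun n => r₀ / ε n) atTop atTop := by
    have h1 : Tendsto ε atTop (𝓝[>] 0) := tendsto_nhdsWithin_iff.mpr ⟨hε0, Eventually.of_forall hε⟩
    have h2 := (tendsto_inv_nhdsGT_zero.comp h1).const_mul_atTop hr₀
    exact h2.congr fun n => by simp [div_eq_mul_inv]
  have hF : ∀ e : ℝ, 0 < e → ∀ᶠ n in atTop, Far ν (r₀ / ε n) e (v n) := by
    intro e he
    have hK : IsCompact (closedBall p r₀ \ ball p (r₀ / 4)) := (isCompact_closedBall p r₀).diff isOpen_ball
    have hKZ : closedBall p r₀ \ ball p (r₀ / 4) ⊆ (V.Z)ᶜ := by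
      intro x hx hxZ
      have h1 : x ∈ closedBall p r₀ ∩ V.Z := ⟨hx.1, hxZ⟩
      rw [hiso] at h1
      have h2 : x = p := h1
      exact hx.2 (by rw [h2]; exact mem_ball_self (by positivity))
    have := Metric.tendstoUniformlyOn_iff.mp (htop _ hK hKZ) e he
    filter_upwards [this] with n hn y h1 h2
    have hεn := hε n
    have hR0 : 0 < r₀ / ε n := by positivity
    have hy0 : y ≠ 0 := norm_pos_iff.mp (by linarith)
    rw [hvh n y hy0]
    have hd : dist (p + ε n • y) p = ε n * ‖y‖ := by
      rw [dist_eq_norm]; simp [norm_smul, abs_of_pos hεn]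
    have h1' : r₀ / 4 ≤ ε n * ‖y‖ := by
      calc r₀ / 4 = ε n * (r₀ / ε n / 4) := by field_simp
        _ ≤ _ := by gcongr
    have h2' : ε n * ‖y‖ ≤ r₀ := by
      rw [lt_div_iff₀ hεn] at h2; linarith
    have := hn (p + ε n • y) ⟨by rw [mem_closedBall, hd]; exact h2', by rw [mem_ball, hd]; linarith⟩
    rw [Real.dist_eq, zero_sub, abs_neg] at this
    exact this.le
  obtain ⟨φ, hφ, W, hWS, hWc, hW0, ⟨M, hM⟩, hI⟩ := limit_exists hτ hν hσ hR hS hF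
  obtain ⟨hI2, hE⟩ := entire_props hτ hν hσ hWS hW0 hM hI
  obtain ⟨K, hK, hKb⟩ := entire_grad hτ hWS hM
  have hz : ∀ e : ℝ, 0 < e → ∃ ρ : ℝ, 1 ≤ ρ ∧ ∀ y, ρ ≤ ‖y‖ → |hat ν W y| ≤ e := fun e he =>
    entire_zero hτ hWS hW0 hM hI he
  have hWsm : ∀ y, Sm W y := fun y => (hWS (‖y‖ + 1)).sm y (by linarith)
  set w : Pl → ℝ := fun x => hat ν W (x - p) with hw
  have hwsm : ∀ x, x ≠ p → Sm w x := fun x hx =>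
    ContDiffAt.comp (g := hat ν W) x (hat_sm (hWS (‖x - p‖ + 1)) (norm_pos_iff.mpr (sub_ne_zero.mpr hx)) (by linarith))
      (contDiffAt_id.sub contDiffAt_const)
  have hAff : ∀ (z : Pl) (t : ℝ) (k : Fin 2), (fun x : Pl => x - p) (z + t • ee k)
      = (fun x : Pl => x - p) z + (t * (fun _ => (1:ℝ)) k) • ee k := fun z t k => by
    simp only [mul_one]; abel
  have hae : ∀ᵐ x : Pl, x ≠ p := by
    rw [ae_iff]; simp
  have hSSw : ∀ x, x ≠ p → SS ν W (x - p) = exp (-(w x)) := fun x hx => SS_eq (Or.inl (sub_ne_zero.mpr hx))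
  have hGae : (fun x : Pl => (1 - exp (w x)) ^ 2 / (τ + exp (w x)) ^ 2) =ᵐ[volume] fun x => Gs τ (SS ν W (x - p)) := by
    filter_upwards [hae] with x hx
    rw [G_eq hτ, hSSw x hx]
  have hFae : (fun x : Pl => fτ τ (w x)) =ᵐ[volume] fun x => -Ph τ (SS ν W (x - p)) := by
    filter_upwards [hae] with x hx
    rw [fτ_eq hτ, hSSw x hx]
  refine ⟨φ, hφ, w, ?_, ?_, ?_, ?_, ?_, ?_, ?_, ?_, ?_⟩
  · exact fun x hx => (hwsm x hx).contDiffWithinAt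
  · intro x hx
    have h1 := lap_affine (A := fun x : Pl => x - p) (s := fun _ => (1:ℝ)) (q := 1) (fun _ => by norm_num) hAff (hat ν W) x
    have h2 : lap w x = 1 * lap (hat ν W) (x - p) := h1
    rw [h2, hat_eq (hWS (‖x - p‖ + 1)) (norm_pos_iff.mpr (sub_ne_zero.mpr hx)) (by linarith), fτ_eq hτ]
    simp [hw]
  · refine ⟨1, one_pos, fun x => W (x - p), ?_, ?_⟩
    · exact fun x _ => (ContDiffAt.comp (g := W) x (hWsm _) (contDiffAt_id.sub contDiffAt_const)).contDiffWithinAt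
    · intro x _ _
      simp only [hw, hat]; ring
  · refine ⟨2 * K, fun y hy => ?_⟩
    rw [dist_eq_norm] at hy
    have h1 : ∀ i, |pd w i y| ≤ K := by
      intro i
      have h2 := pd_affine (A := fun x : Pl => x - p) (s := fun _ => (1:ℝ)) hAff (hat ν W) i 1
      have h3 : pd w i y = pd (hat ν W) i (y - p) := by
        have h4 := congrFun h2 y
        simpa [hw] using h4
      rw [h3]; exact hKb _ hy i
    rw [Real.sqrt_le_left (by positivity)]
    unfold gradSq
    have a0 := sq_le_sq' (abs_le.mp (h1 0)).1 (abs_le.mp (h1 0)).2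
    have a1 := sq_le_sq' (abs_le.mp (h1 1)).1 (abs_le.mp (h1 1)).2
    nlinarith
  · exact (hI2.comp_sub_right p).neg.congr hFae.symm
  · exact (hI.comp_sub_right p).congr hGae.symm
  · rw [Metric.tendsto_nhds]
    intro e he
    obtain ⟨ρ, hρ, hb⟩ := hz (e / 2) (by positivity)
    filter_upwards [(tendsto_norm_cocompact_atTop (E := Pl)).eventually_ge_atTop (ρ + ‖p‖)] with x hx
    have h1 : ρ ≤ ‖x - p‖ := by linarith [norm_sub_norm_le x p]
    rw [Real.dist_eq, sub_zero]
    have := hb _ h1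
    simp only [hw]; linarith
  · rw [integral_congr_ae hGae, integral_sub_right_eq_self (fun x => Gs τ (SS ν W x)) p, hE]
  · have huc := fun (e : ℝ) (he : 0 < e) => unif_conv (e := e) hτ hν (hR.comp hφ.tendsto_atTop) (fun n => hS (φ n))
      (fun e he => hφ.tendsto_atTop.eventually (hF e he)) hWc hz he
    rw [Metric.tendsto_nhds]
    intro e he
    filter_upwards [huc (e / 2) (by positivity)] with n hn
    rw [Real.dist_eq, sub_zero, abs_of_nonneg]
    · refine lt_of_le_of_lt (Real.sSup_le ?_ (by positivity : 0 ≤ e / 2)) (by linarith)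
      rintro _ ⟨y, ⟨hy1, hy2⟩, rfl⟩
      have hne : y - p ≠ 0 := sub_ne_zero.mpr hy2
      rw [mem_ball, dist_eq_norm] at hy1
      have := hn (y - p) (norm_pos_iff.mpr hne) hy1
      rw [hvh (φ n) _ hne] at this
      exact this
    · refine Real.sSup_nonneg ?_
      rintro _ ⟨y, _, rfl⟩
      exact abs_nonneg _
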